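/- Let N ≥ 2, α ∈ (0,2) with α < N, let Ω ⊂ ℝ^N be a bounded open set and f a bounded continuous function on Ω. Let w be a classical solution of the extension problem on C_Ω = Ω × (0,∞) with data f, and let v be a classical solution of the extension problem on C_{Ω^#} = Ω^# × (0,∞) with data f^#, radially symmetric and radially nonincreasing in x for each y ≥ 0. Set u := w(·,0) and φ := v(·,0). Then ∫_0^s u*(σ) dσ ≤ ∫_0^s φ*(σ) dσ for every s ∈ [0,|Ω|]. -/

import Mathlib

open MeasureTheory Filter Set

noncomputable section

abbrev Euc (N : ℕ) := EuclideanSpace ℝ (Fin N)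

/-- Decreasing rearrangement of `g` on `E`:
`g*(s) = sup {t ≥ 0 : |{x ∈ E : |g x| > t}| > s}`. -/
def rearr {N : ℕ} (E : Set (Euc N)) (g : Euc N → ℝ) (s : ℝ) : ℝ :=
  sSup {t : ℝ | 0 ≤ t ∧ ENNReal.ofReal s < volume {x | x ∈ E ∧ t < |g x|}}

/-- Measure of the unit ball of `ℝ^N`. -/
def omegaN (N : ℕ) : ℝ := (volume (Metric.ball (0 : Euc N) 1)).toReal

/-- Radius of the ball centered at the origin with the same measure as `Ω`. -/
def ballRad {N : ℕ} (Ω : Set (Euc N)) : ℝ := ((volume Ω).toReal / omegaN N) ^ ((N : ℝ)⁻¹)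

/-- `Ω^#`: the ball centered at the origin with the same measure as `Ω`. -/
def symmBall {N : ℕ} (Ω : Set (Euc N)) : Set (Euc N) := Metric.ball 0 (ballRad Ω)

/-- Schwarz rearrangement `f^#(x) = f*(ω_N |x|^N)`. -/
def schwarz {N : ℕ} (Ω : Set (Euc N)) (f : Euc N → ℝ) (x : Euc N) : ℝ :=
  rearr Ω f (omegaN N * ‖x‖ ^ N)

/-- `κ_α = 2^{1-α} Γ(1-α/2) / Γ(α/2)`. -/
def kappa (α : ℝ) : ℝ := (2 : ℝ) ^ (1 - α) * Real.Gamma (1 - α / 2) / Real.Gamma (α / 2)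

/-- Laplacian of `w` with respect to the `x` variables. -/
def lapx {N : ℕ} (w : Euc N → ℝ → ℝ) (x : Euc N) (y : ℝ) : ℝ :=
  ∑ i : Fin N, deriv (deriv fun t : ℝ => w (x + t • EuclideanSpace.single i (1 : ℝ)) y) 0

/-- A classical solution of the extension problem on `C_Ω = Ω × (0,∞)` with data `f`:
continuous and bounded up to the boundary, smooth with bounded derivatives up to
order two inside, satisfying the extension PDE, vanishing on the lateral boundary,
decaying uniformly as `y → ∞`, and with the Neumann data `f`. -/
structure IsExtSol {N : ℕ} (α : ℝ) (Ω : Set (Euc N)) (f : Euc N → ℝ)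
    (w : Euc N → ℝ → ℝ) : Prop where
  cont : ContinuousOn (fun p : Euc N × ℝ => w p.1 p.2) (closure (Ω ×ˢ Ioi (0 : ℝ)))
  bdd : ∃ M : ℝ, ∀ p ∈ closure (Ω ×ˢ Ioi (0 : ℝ)), |w (Prod.fst p) p.2| ≤ M
  smooth : ContDiffOn ℝ 2 (fun p : Euc N × ℝ => w p.1 p.2) (Ω ×ˢ Ioi (0 : ℝ))
  derivBdd : ∃ M : ℝ, ∀ p ∈ Ω ×ˢ Ioi (0 : ℝ),
    ‖fderiv ℝ (fun q : Euc N × ℝ => w q.1 q.2) p‖ ≤ M ∧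
    ‖fderiv ℝ (fderiv ℝ fun q : Euc N × ℝ => w q.1 q.2) p‖ ≤ M
  pde : ∀ x ∈ Ω, ∀ y ∈ Ioi (0 : ℝ),
    lapx w x y + ((1 - α) / y) * deriv (w x) y + deriv (deriv (w x)) y = 0
  lateral : ∀ x ∈ frontier Ω, ∀ y ∈ Ici (0 : ℝ), w x y = 0
  decay : ∀ ε > (0 : ℝ), ∃ Y : ℝ, ∀ y ≥ Y, ∀ x ∈ Ω, |w x y| ≤ ε
  neumann : ∀ x ∈ Ω,
    Tendsto (fun y : ℝ => y ^ (1 - α) * deriv (w x) y) (nhdsWithin 0 (Ioi 0))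
      (nhds (-(kappa α) * f x))

/-- `v` is radially symmetric and radially nonincreasing in `x` for each `y ≥ 0`. -/
def RadialDecr {N : ℕ} (v : Euc N → ℝ → ℝ) : Prop :=
  ∀ y : ℝ, 0 ≤ y → ∀ x x' : Euc N, ‖x‖ ≤ ‖x'‖ → v x' y ≤ v x y

/-! ### Reflections and polarization -/

/-- Reflection across the affine hyperplane `{x | ⟪a, x⟫ = c}`, for a unit vector `a`. -/
def hyperRefl {N : ℕ} (a : Euc N) (c : ℝ) (x : Euc N) : Euc N :=
  x - (2 * (inner ℝ a x - c)) • a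

section Reflection

variable {N : ℕ} {a : Euc N} {c : ℝ}

lemma inner_hyperRefl (ha : ‖a‖ = 1) (x : Euc N) :
    inner ℝ a (hyperRefl a c x) = 2 * c - inner ℝ a x := by
  rw [hyperRefl, inner_sub_right, inner_smul_right, real_inner_self_eq_norm_sq, ha]
  ring

lemma hyperRefl_hyperRefl (ha : ‖a‖ = 1) (x : Euc N) :
    hyperRefl a c (hyperRefl a c x) = x := by
  conv_lhs => rw [hyperRefl, inner_hyperRefl ha]
  rw [hyperRefl, sub_sub, ← add_smul]
  have : 2 * (inner ℝ a x - c) + 2 * (2 * c - inner ℝ a x - c) = 0 := by ring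
  rw [this, zero_smul, sub_zero]

lemma norm_hyperRefl_sq (ha : ‖a‖ = 1) (x : Euc N) :
    ‖hyperRefl a c x‖ ^ 2 = ‖x‖ ^ 2 - 4 * c * (inner ℝ a x - c) := by
  rw [hyperRefl, norm_sub_sq_real, inner_smul_right, norm_smul, ha, real_inner_comm,
    Real.norm_eq_abs, mul_one, sq_abs]
  ring

lemma dist_hyperRefl_sq (ha : ‖a‖ = 1) (x z : Euc N) :
    dist x (hyperRefl a c z) ^ 2 =
      dist x z ^ 2 + 4 * (inner ℝ a x - c) * (inner ℝ a z - c) := by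
  have h : x - hyperRefl a c z = (x - z) + (2 * (inner ℝ a z - c)) • a := by
    rw [hyperRefl]; abel
  rw [dist_eq_norm, dist_eq_norm, h, norm_add_sq_real, inner_smul_right, norm_smul, ha,
    real_inner_comm a (x - z), inner_sub_right, Real.norm_eq_abs, mul_one, sq_abs]
  ring

lemma dist_hyperRefl_hyperRefl (ha : ‖a‖ = 1) (x z : Euc N) :
    dist (hyperRefl a c x) (hyperRefl a c z) = dist x z := by
  have h : dist (hyperRefl a c x) (hyperRefl a c z) ^ 2 = dist x z ^ 2 := by
    rw [dist_hyperRefl_sq ha, dist_comm, dist_hyperRefl_sq ha, inner_hyperRefl ha, dist_comm]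
    ring
  exact (pow_left_inj₀ dist_nonneg dist_nonneg two_ne_zero).1 h

lemma dist_hyperRefl_comm (ha : ‖a‖ = 1) (x z : Euc N) :
    dist (hyperRefl a c x) z = dist x (hyperRefl a c z) := by
  rw [← dist_hyperRefl_hyperRefl (c := c) ha x, hyperRefl_hyperRefl ha]

lemma measurePreserving_hyperRefl (ha : ‖a‖ = 1) :
    MeasurePreserving (hyperRefl a c) (volume : Measure (Euc N)) volume := by
  have h : hyperRefl a c = (fun x => x + (2 * c) • a) ∘ ((ℝ ∙ a)ᗮ.reflection) := by
    funext x
    simp only [Function.comp, Submodule.reflection_orthogonal_apply,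
      Submodule.reflection_singleton_apply, ha, hyperRefl]
    simp only [RCLike.ofReal_real_eq_id, id, one_pow, div_one]
    rw [mul_sub, sub_smul, mul_smul, two_smul]
    simp only [two_smul]
    abel
  rw [h]
  exact (measurePreserving_add_right volume _).comp (LinearIsometryEquiv.measurePreserving _)

lemma continuous_hyperRefl : Continuous (hyperRefl a c) := by
  unfold hyperRefl; fun_prop

lemma measurableEmbedding_hyperRefl (ha : ‖a‖ = 1) :
    MeasurableEmbedding (hyperRefl a c) :=
  (MeasurableEquiv.mk ⟨hyperRefl a c, hyperRefl a c, hyperRefl_hyperRefl ha,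
    hyperRefl_hyperRefl ha⟩ continuous_hyperRefl.measurable
    continuous_hyperRefl.measurable).measurableEmbedding

lemma integral_comp_hyperRefl (ha : ‖a‖ = 1) (φ : Euc N → ℝ) :
    ∫ x, φ (hyperRefl a c x) = ∫ x, φ x :=
  (measurePreserving_hyperRefl ha).integral_comp (measurableEmbedding_hyperRefl ha) φ

/-- For two points with distinct norms some hyperplane reflection exchanges them, the point of
smaller norm lying on the same side as the origin. -/
lemma exists_hyperRefl_eq {x x' : Euc N} (h : ‖x‖ ≤ ‖x'‖) (hne : x ≠ x') :
    ∃ (a : Euc N) (c : ℝ), ‖a‖ = 1 ∧ 0 ≤ c ∧ inner ℝ a x < c ∧ hyperRefl a c x = x' ∧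
      (‖x‖ < ‖x'‖ → 0 < c) := by
  set d := ‖x' - x‖ with hd
  have hd0 : 0 < d := norm_pos_iff.2 (sub_ne_zero.2 hne.symm)
  have e1 : inner ℝ (d⁻¹ • (x' - x)) x = d⁻¹ * (inner ℝ x' x - ‖x‖ ^ 2) := by
    rw [real_inner_smul_left, inner_sub_left, real_inner_self_eq_norm_sq]
  have e2 : d ^ 2 = ‖x'‖ ^ 2 - 2 * inner ℝ x' x + ‖x‖ ^ 2 := norm_sub_sq_real _ _
  have e3 : inner ℝ (d⁻¹ • (x' - x)) x - (‖x'‖ ^ 2 - ‖x‖ ^ 2) / (2 * d) = -d / 2 := by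
    rw [e1]; field_simp; linarith
  refine ⟨d⁻¹ • (x' - x), (‖x'‖ ^ 2 - ‖x‖ ^ 2) / (2 * d), ?_, ?_, ?_, ?_, ?_⟩
  · rw [norm_smul, norm_inv, Real.norm_of_nonneg hd0.le, ← hd, inv_mul_cancel₀ hd0.ne']
  · have : ‖x‖ ^ 2 ≤ ‖x'‖ ^ 2 := by gcongr
    exact div_nonneg (by linarith) (by positivity)
  · linarith
  · rw [hyperRefl, e3, smul_smul]
    have : 2 * (-d / 2) * d⁻¹ = -1 := by field_simp
    rw [this, neg_one_smul]; abel
  · intro hlt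
    have : ‖x‖ ^ 2 < ‖x'‖ ^ 2 := by gcongr
    exact div_pos (by linarith) (by positivity)

end Reflection

/-- Polarization (two-point rearrangement) of `F` with respect to the half-space
`{x | ⟪a, x⟫ ≤ c}`. -/
def polarize {N : ℕ} (a : Euc N) (c : ℝ) (F : Euc N → ℝ) (x : Euc N) : ℝ :=
  if inner ℝ a x ≤ c then max (F x) (F (hyperRefl a c x)) else min (F x) (F (hyperRefl a c x))

section Polarize

variable {N : ℕ} {a : Euc N} {c : ℝ} {F : Euc N → ℝ}

lemma hyperRefl_of_inner_eq {x : Euc N} (h : inner ℝ a x = c) : hyperRefl a c x = x := by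
  simp [hyperRefl, h]

lemma polarize_of_le {x : Euc N} (h : inner ℝ a x ≤ c) :
    polarize a c F x = max (F x) (F (hyperRefl a c x)) := if_pos h

lemma polarize_of_ge {x : Euc N} (h : c ≤ inner ℝ a x) :
    polarize a c F x = min (F x) (F (hyperRefl a c x)) := by
  rcases h.eq_or_lt with h | h
  · rw [polarize, if_pos h.ge, hyperRefl_of_inner_eq h.symm, max_self, min_self]
  · exact if_neg h.not_ge

lemma polarize_hyperRefl_of_le (ha : ‖a‖ = 1) {x : Euc N} (h : inner ℝ a x ≤ c) :
    polarize a c F (hyperRefl a c x) = min (F x) (F (hyperRefl a c x)) := by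
  rw [polarize_of_ge (by rw [inner_hyperRefl ha]; linarith), hyperRefl_hyperRefl ha, min_comm]

lemma polarize_hyperRefl_of_ge (ha : ‖a‖ = 1) {x : Euc N} (h : c ≤ inner ℝ a x) :
    polarize a c F (hyperRefl a c x) = max (F x) (F (hyperRefl a c x)) := by
  rw [polarize_of_le (by rw [inner_hyperRefl ha]; linarith), hyperRefl_hyperRefl ha, max_comm]

lemma polarize_nonneg (hF : ∀ x, 0 ≤ F x) (x : Euc N) : 0 ≤ polarize a c F x := by
  unfold polarize
  split_ifs
  · exact le_max_of_le_left (hF _)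
  · exact le_min (hF _) (hF _)

lemma polarize_le {M : ℝ} (hF : ∀ x, F x ≤ M) (x : Euc N) : polarize a c F x ≤ M := by
  unfold polarize
  split_ifs
  · exact max_le (hF _) (hF _)
  · exact min_le_of_left_le (hF _)

lemma polarize_eq_zero (ha : ‖a‖ = 1) (hc : 0 ≤ c) {R : ℝ} (hF : ∀ x, 0 ≤ F x)
    (hs : ∀ x, R < ‖x‖ → F x = 0) (x : Euc N) (hx : R < ‖x‖) : polarize a c F x = 0 := by
  rcases le_total (inner ℝ a x) c with h | h
  · have : ‖x‖ ≤ ‖hyperRefl a c x‖ := by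
      refine (pow_le_pow_iff_left₀ (norm_nonneg _) (norm_nonneg _) two_ne_zero).1 ?_
      rw [norm_hyperRefl_sq ha]
      nlinarith
    rw [polarize_of_le h, hs x hx, hs _ (hx.trans_le this), max_self]
  · rw [polarize_of_ge h, hs x hx, min_eq_left (hF _)]

/-- Polarization preserves any modulus of continuity. -/
lemma abs_polarize_sub_le (ha : ‖a‖ = 1) {δ ε : ℝ}
    (hF : ∀ x z, dist x z ≤ δ → |F x - F z| ≤ ε) (x z : Euc N) (hxz : dist x z ≤ δ) :
    |polarize a c F x - polarize a c F z| ≤ ε := by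
  have h1 := abs_le.1 (hF x z hxz)
  have h2 := abs_le.1 (hF (hyperRefl a c x) (hyperRefl a c z)
    (by rwa [dist_hyperRefl_hyperRefl ha]))
  have cross : (inner ℝ a x - c) * (inner ℝ a z - c) ≤ 0 →
      |F x - F (hyperRefl a c z)| ≤ ε ∧ |F (hyperRefl a c x) - F z| ≤ ε := by
    intro h
    have : dist x (hyperRefl a c z) ≤ dist x z := by
      refine (pow_le_pow_iff_left₀ dist_nonneg dist_nonneg two_ne_zero).1 ?_
      rw [dist_hyperRefl_sq ha]; linarith
    exact ⟨hF _ _ (this.trans hxz), hF _ _ (by rw [dist_hyperRefl_comm ha]; exact this.trans hxz)⟩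
  rcases le_total (inner ℝ a x) c with hx | hx <;> rcases le_total (inner ℝ a z) c with hz | hz
  · rw [polarize_of_le hx, polarize_of_le hz, abs_le]
    grind
  · obtain ⟨h3, h4⟩ := cross (mul_nonpos_of_nonpos_of_nonneg (by linarith) (by linarith))
    rw [abs_le] at h3 h4
    rw [polarize_of_le hx, polarize_of_ge hz, abs_le]
    grind
  · obtain ⟨h3, h4⟩ := cross (mul_nonpos_of_nonneg_of_nonpos (by linarith) (by linarith))
    rw [abs_le] at h3 h4
    rw [polarize_of_ge hx, polarize_of_le hz, abs_le]
    grind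
  · rw [polarize_of_ge hx, polarize_of_ge hz, abs_le]
    grind

lemma integral_comp_polarize (ha : ‖a‖ = 1) {G : ℝ → ℝ}
    (hi : Integrable fun x => G (F x)) (hi' : Integrable fun x => G (polarize a c F x)) :
    ∫ x, G (polarize a c F x) = ∫ x, G (F x) := by
  have key : ∀ φ : Euc N → ℝ, Integrable φ →
      ∫ x, (φ x + φ (hyperRefl a c x)) = 2 * ∫ x, φ x := by
    intro φ hφ
    have hφ' : Integrable fun x => φ (hyperRefl a c x) :=
      (measurePreserving_hyperRefl ha).integrable_comp_of_integrable hφ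
    rw [integral_add hφ hφ', integral_comp_hyperRefl ha, two_mul]
  have h : ∀ x, G (polarize a c F x) + G (polarize a c F (hyperRefl a c x)) =
      G (F x) + G (F (hyperRefl a c x)) := by
    intro x
    rcases le_total (inner ℝ a x) c with hx | hx
    · rw [polarize_of_le hx, polarize_hyperRefl_of_le ha hx]
      rcases le_total (F x) (F (hyperRefl a c x)) with h | h <;> simp [h, add_comm]
    · rw [polarize_of_ge hx, polarize_hyperRefl_of_ge ha hx]
      rcases le_total (F x) (F (hyperRefl a c x)) with h | h <;> simp [h, add_comm]
  have h1 := key _ hi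
  have h2 := key _ hi'
  simp only [h] at h2
  linarith

end Polarize

section PolarizeRiesz

variable {N : ℕ} {a : Euc N} {c : ℝ} {F : Euc N → ℝ}

lemma two_point_rearrangement {A : ℝ → ℝ} (hA : Monotone A) {k l : ℝ} (hkl : l ≤ k)
    (p q r s : ℝ) :
    k * (A p * r + A q * s) + l * (A q * r + A p * s) ≤
      k * (A (max p q) * max r s + A (min p q) * min r s) +
        l * (A (min p q) * max r s + A (max p q) * min r s) := by
  rcases le_total p q with h1 | h1 <;> rcases le_total r s with h2 | h2 <;>
    simp only [h1, h2, max_eq_left, max_eq_right, min_eq_left, min_eq_right] <;>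
    nlinarith [mul_nonneg (sub_nonneg.2 hkl) (mul_nonneg (sub_nonneg.2 (hA h1))
      (sub_nonneg.2 h2))]

/-- Riesz-type two-point inequality: polarization does not decrease
`∫∫ κ(|x - z|) G(F x) F z`. -/
lemma integral_kernel_le_polarize (ha : ‖a‖ = 1) {G κ : ℝ → ℝ} (hG : Monotone G)
    (hκ : Antitone κ)
    (hi : Integrable fun p : Euc N × Euc N => κ (dist p.1 p.2) * (G (F p.1) * F p.2))
    (hi' : Integrable fun p : Euc N × Euc N =>
      κ (dist p.1 p.2) * (G (polarize a c F p.1) * polarize a c F p.2)) :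
    ∫ p : Euc N × Euc N, κ (dist p.1 p.2) * (G (F p.1) * F p.2) ≤
      ∫ p : Euc N × Euc N,
        κ (dist p.1 p.2) * (G (polarize a c F p.1) * polarize a c F p.2) := by
  set σ := hyperRefl a c with hσ
  have me := measurableEmbedding_hyperRefl (c := c) ha
  have mp := measurePreserving_hyperRefl (c := c) ha
  have m1 : MeasurePreserving (Prod.map σ id) (volume : Measure (Euc N × Euc N)) volume :=
    mp.prod (MeasurePreserving.id _)
  have m2 : MeasurePreserving (Prod.map id σ) (volume : Measure (Euc N × Euc N)) volume :=
    (MeasurePreserving.id _).prod mp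
  have m3 : MeasurePreserving (Prod.map σ σ) (volume : Measure (Euc N × Euc N)) volume :=
    mp.prod mp
  have e1 : MeasurableEmbedding (Prod.map σ (id : Euc N → Euc N)) :=
    me.prodMap MeasurableEmbedding.id
  have e2 : MeasurableEmbedding (Prod.map (id : Euc N → Euc N) σ) :=
    MeasurableEmbedding.id.prodMap me
  have e3 : MeasurableEmbedding (Prod.map σ σ) := me.prodMap me
  have sym : ∀ Ψ : Euc N × Euc N → ℝ, Integrable Ψ →
      Integrable (fun p => Ψ p + Ψ (Prod.map σ id p) + (Ψ (Prod.map id σ p) + Ψ (Prod.map σ σ p)))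
      ∧ ∫ p, (Ψ p + Ψ (Prod.map σ id p) + (Ψ (Prod.map id σ p) + Ψ (Prod.map σ σ p)))
        = 4 * ∫ p, Ψ p := by
    intro Ψ hΨ
    have i1 : Integrable fun p => Ψ (Prod.map σ id p) := m1.integrable_comp_of_integrable hΨ
    have i2 : Integrable fun p => Ψ (Prod.map id σ p) := m2.integrable_comp_of_integrable hΨ
    have i3 : Integrable fun p => Ψ (Prod.map σ σ p) := m3.integrable_comp_of_integrable hΨ
    have i01 : Integrable fun p => Ψ p + Ψ (Prod.map σ id p) := hΨ.add i1
    have i23 : Integrable fun p => Ψ (Prod.map id σ p) + Ψ (Prod.map σ σ p) := i2.add i3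
    refine ⟨i01.add i23, ?_⟩
    rw [integral_add i01 i23, integral_add hΨ i1, integral_add i2 i3,
      m1.integral_comp e1, m2.integral_comp e2, m3.integral_comp e3]
    ring
  obtain ⟨j1, h1⟩ := sym _ hi
  obtain ⟨j2, h2⟩ := sym _ hi'
  suffices h : 4 * ∫ p : Euc N × Euc N, κ (dist p.1 p.2) * (G (F p.1) * F p.2) ≤
      4 * ∫ p : Euc N × Euc N,
        κ (dist p.1 p.2) * (G (polarize a c F p.1) * polarize a c F p.2) by linarith
  rw [← h1, ← h2]
  refine integral_mono j1 j2 ?_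
  rintro ⟨x, z⟩
  simp only [Prod.map, id]
  rw [dist_hyperRefl_hyperRefl ha, dist_hyperRefl_comm ha]
  have hd : 0 ≤ (inner ℝ a x - c) * (inner ℝ a z - c) → κ (dist x (σ z)) ≤ κ (dist x z) := by
    intro h
    refine hκ ((pow_le_pow_iff_left₀ dist_nonneg dist_nonneg two_ne_zero).1 ?_)
    rw [dist_hyperRefl_sq ha]; linarith
  have hd' : (inner ℝ a x - c) * (inner ℝ a z - c) ≤ 0 → κ (dist x z) ≤ κ (dist x (σ z)) := by
    intro h
    refine hκ ((pow_le_pow_iff_left₀ dist_nonneg dist_nonneg two_ne_zero).1 ?_)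
    rw [dist_hyperRefl_sq ha]; linarith
  rcases le_total (inner ℝ a x) c with hx | hx <;> rcases le_total (inner ℝ a z) c with hz | hz
  · rw [polarize_of_le hx, polarize_hyperRefl_of_le ha hx, polarize_of_le hz,
      polarize_hyperRefl_of_le ha hz]
    have := two_point_rearrangement hG
      (hd (mul_nonneg_of_nonpos_of_nonpos (by linarith) (by linarith)))
      (F x) (F (σ x)) (F z) (F (σ z))
    linarith
  · rw [polarize_of_le hx, polarize_hyperRefl_of_le ha hx, polarize_of_ge hz,
      polarize_hyperRefl_of_ge ha hz]
    have := two_point_rearrangement hG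
      (hd' (mul_nonpos_of_nonpos_of_nonneg (by linarith) (by linarith)))
      (F x) (F (σ x)) (F (σ z)) (F z)
    rw [max_comm (F (σ z)), min_comm (F (σ z))] at this
    linarith
  · rw [polarize_of_ge hx, polarize_hyperRefl_of_ge ha hx, polarize_of_le hz,
      polarize_hyperRefl_of_le ha hz]
    have := two_point_rearrangement hG
      (hd' (mul_nonpos_of_nonneg_of_nonpos (by linarith) (by linarith)))
      (F (σ x)) (F x) (F z) (F (σ z))
    rw [max_comm (F (σ x)), min_comm (F (σ x))] at this
    linarith
  · rw [polarize_of_ge hx, polarize_hyperRefl_of_ge ha hx, polarize_of_ge hz,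
      polarize_hyperRefl_of_ge ha hz]
    have := two_point_rearrangement hG
      (hd (mul_nonneg (by linarith) (by linarith)))
      (F (σ x)) (F x) (F (σ z)) (F z)
    rw [max_comm (F (σ x)), min_comm (F (σ x)), max_comm (F (σ z)), min_comm (F (σ z))] at this
    linarith

/-- Polarization with respect to a half-space containing the origin lowers the second moment,
strictly unless it fixes the function. -/
lemma le_of_integral_norm_sq_le_polarize (ha : ‖a‖ = 1) (hc : 0 < c) (hF : Continuous F)
    (hP : Continuous (polarize a c F)) (hFs : HasCompactSupport F)
    (hPs : HasCompactSupport (polarize a c F))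
    (h : ∫ x, F x * ‖x‖ ^ 2 ≤ ∫ x, polarize a c F x * ‖x‖ ^ 2) {x : Euc N}
    (hx : inner ℝ a x < c) : F (hyperRefl a c x) ≤ F x := by
  set σ := hyperRefl a c with hσ
  have hσc : Continuous σ := continuous_hyperRefl
  set D : Euc N → ℝ := fun x => (F x - polarize a c F x) * ‖x‖ ^ 2 with hD
  have hDc : Continuous D := by fun_prop
  have hDs : HasCompactSupport D := (hFs.sub hPs).mul_right
  have i0 : Integrable D := hDc.integrable_of_hasCompactSupport hDs
  have i1 : Integrable fun x => D (σ x) :=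
    (measurePreserving_hyperRefl ha).integrable_comp_of_integrable i0
  have hsum : ∫ x, (D x + D (σ x)) ≤ 0 := by
    have iF : Integrable fun x => F x * ‖x‖ ^ 2 :=
      Continuous.integrable_of_hasCompactSupport (by fun_prop) hFs.mul_right
    have iP : Integrable fun x => polarize a c F x * ‖x‖ ^ 2 :=
      Continuous.integrable_of_hasCompactSupport (by fun_prop) hPs.mul_right
    have hDi : ∫ x, D x = (∫ x, F x * ‖x‖ ^ 2) - ∫ x, polarize a c F x * ‖x‖ ^ 2 := by
      rw [← integral_sub iF iP]
      congr 1; funext x; simp only [hD]; ring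
    rw [integral_add i0 i1, hσ, integral_comp_hyperRefl ha]
    linarith
  have hle : ∀ x, inner ℝ a x ≤ c → D x + D (σ x) =
      (max (F x) (F (σ x)) - F x) * (4 * c * (c - inner ℝ a x)) := by
    intro x hx
    simp only [hD]
    rw [polarize_of_le hx, polarize_hyperRefl_of_le ha hx, norm_hyperRefl_sq ha, ← hσ]
    rcases le_total (F x) (F (σ x)) with h | h <;>
      simp only [h, max_eq_left, max_eq_right, min_eq_left, min_eq_right] <;> ring
  have hnn : ∀ x, 0 ≤ D x + D (σ x) := by
    have : ∀ x, inner ℝ a x ≤ c → 0 ≤ D x + D (σ x) := by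
      intro x hx
      rw [hle x hx]
      exact mul_nonneg (sub_nonneg.2 (le_max_left _ _))
        (mul_nonneg (by positivity) (by linarith))
    intro x
    rcases le_total (inner ℝ a x) c with hx | hx
    · exact this x hx
    · have h1 := this (σ x) (by rw [inner_hyperRefl ha]; linarith)
      rwa [hσ, hyperRefl_hyperRefl ha, add_comm] at h1
  by_contra hcon
  push Not at hcon
  have hne : D x + D (σ x) ≠ 0 := by
    rw [hle x hx.le, max_eq_right hcon.le]
    exact (mul_pos (by linarith) (mul_pos (by positivity) (by linarith))).ne'
  have hpos : 0 < ∫ x, (D x + D (σ x)) :=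
    integral_pos_of_integrable_nonneg_nonzero (f := fun x => D x + D (σ x)) (x := x)
      (by fun_prop) (i0.add i1) hnn hne
  linarith

end PolarizeRiesz

/-- The indicator of `[-∞, δ]`, used as the profile of the ball kernel. -/
def ballProfile (δ d : ℝ) : ℝ := if d ≤ δ then 1 else 0

lemma ballProfile_antitone (δ : ℝ) : Antitone (ballProfile δ) := by
  intro x y hxy
  unfold ballProfile
  split_ifs <;> linarith

/-- Continuous functions with values in `[0, M]`, vanishing off the ball of radius `R`, with a
prescribed modulus of continuity. -/
def equiClass (N : ℕ) (M R : ℝ) (d : ℝ → ℝ) : Set C(Euc N, ℝ) :=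
  {F | (∀ x, 0 ≤ F x) ∧ (∀ x, F x ≤ M) ∧ (∀ x, R < ‖x‖ → F x = 0) ∧
    ∀ ε > 0, ∀ x z, dist x z ≤ d ε → |F x - F z| ≤ ε}

section EquiClass

variable {N : ℕ} {M R : ℝ} {d : ℝ → ℝ}

lemma continuous_of_modulus {F : Euc N → ℝ} (hd : ∀ ε > 0, 0 < d ε)
    (hF : ∀ ε > 0, ∀ x z, dist x z ≤ d ε → |F x - F z| ≤ ε) : Continuous F := by
  rw [Metric.continuous_iff]
  intro x ε hε
  refine ⟨d (ε / 2), hd _ (by positivity), fun z hz => ?_⟩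
  rw [Real.dist_eq]
  linarith [hF (ε / 2) (by positivity) z x hz.le]

lemma isCompact_equiClass (hd : ∀ ε > 0, 0 < d ε) : IsCompact (equiClass N M R d) := by
  apply ArzelaAscoli.isCompact_of_equicontinuous
  · have himg : ContinuousMap.toFun '' equiClass N M R d =
        {F : Euc N → ℝ | (∀ x, 0 ≤ F x) ∧ (∀ x, F x ≤ M) ∧ (∀ x, R < ‖x‖ → F x = 0) ∧
          ∀ ε > 0, ∀ x z, dist x z ≤ d ε → |F x - F z| ≤ ε} := by
      ext F
      constructor
      · rintro ⟨G, hG, rfl⟩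
        exact hG
      · intro hF
        exact ⟨⟨F, continuous_of_modulus hd hF.2.2.2⟩, hF, rfl⟩
    rw [himg]
    refine (isCompact_univ_pi (s := fun _ : Euc N => Icc (0 : ℝ) M)
      fun _ => isCompact_Icc).of_isClosed_subset ?_ ?_
    · simp only [ofPred_and, ofPred_forall]
      refine ((isClosed_iInter fun x => ?_).inter ((isClosed_iInter fun x => ?_).inter
        ((isClosed_iInter fun x => isClosed_iInter fun _ => ?_).inter
          (isClosed_iInter fun ε => isClosed_iInter fun _ => isClosed_iInter fun x =>
            isClosed_iInter fun z => isClosed_iInter fun _ => ?_))))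
      · exact isClosed_le continuous_const (continuous_apply x)
      · exact isClosed_le (continuous_apply x) continuous_const
      · exact isClosed_eq (continuous_apply x) continuous_const
      · exact isClosed_le (((continuous_apply x).sub (continuous_apply z)).abs) continuous_const
    · intro F hF x _
      exact ⟨hF.1 x, hF.2.1 x⟩
  · intro x
    rw [Metric.equicontinuousAt_iff]
    intro ε hε
    refine ⟨d (ε / 2), hd _ (by positivity), fun z hz F => ?_⟩
    rw [Real.dist_eq, abs_sub_comm]
    linarith [F.2.2.2.2 (ε / 2) (by positivity) z x hz.le]

lemma hasCompactSupport_of_norm {F : Euc N → ℝ} (h : ∀ x, R < ‖x‖ → F x = 0) :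
    HasCompactSupport F :=
  HasCompactSupport.intro (isCompact_closedBall 0 R) fun x hx =>
    h x (by simpa using hx)

lemma continuous_integral_equiClass (hd : ∀ ε > 0, 0 < d ε) {Φ : Euc N → ℝ → ℝ}
    (hΦ : Continuous Φ.uncurry) (h0 : ∀ x, Φ x 0 = 0) :
    Continuous fun F : equiClass N M R d => ∫ x, Φ x (F.1 x) := by
  have := isCompact_iff_compactSpace.1 (isCompact_equiClass (N := N) (M := M) (R := R) hd)
  have h : (fun F : equiClass N M R d => ∫ x, Φ x (F.1 x)) =
      fun F : equiClass N M R d => ∫ x in Metric.closedBall 0 R, Φ x (F.1 x) := by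
    funext F
    refine (setIntegral_eq_integral_of_forall_compl_eq_zero fun x hx => ?_).symm
    rw [F.2.2.2.1 x (by simpa using hx), h0]
  rw [h]
  refine continuous_parametric_integral_of_continuous (X := equiClass N M R d)
    (f := fun F x => Φ x (F.1 x)) ?_ (isCompact_closedBall _ _)
  have e : Continuous fun q : equiClass N M R d × Euc N => q.1.1 q.2 :=
    continuous_eval.comp (by fun_prop : Continuous fun q : equiClass N M R d × Euc N =>
      (q.1.1, q.2))
  exact hΦ.comp (continuous_snd.prodMk e)

lemma continuous_integral_kernel_equiClass (hd : ∀ ε > 0, 0 < d ε) {G : ℝ → ℝ}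
    (hG : Continuous G) (h0 : G 0 = 0) (δ : ℝ) :
    Continuous fun F : equiClass N M R d =>
      ∫ p : Euc N × Euc N, ballProfile δ (dist p.1 p.2) * (G (F.1 p.1) * F.1 p.2) := by
  have := isCompact_iff_compactSpace.1 (isCompact_equiClass (N := N) (M := M) (R := R) hd)
  set S : Set (Euc N × Euc N) :=
    (Metric.closedBall 0 R ×ˢ Metric.closedBall 0 R) ∩ {p | dist p.1 p.2 ≤ δ} with hS
  have hSc : IsCompact S :=
    ((isCompact_closedBall 0 R).prod (isCompact_closedBall 0 R)).inter_right
      (isClosed_le (by fun_prop) continuous_const)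
  have h : (fun F : equiClass N M R d =>
      ∫ p : Euc N × Euc N, ballProfile δ (dist p.1 p.2) * (G (F.1 p.1) * F.1 p.2)) =
      fun F : equiClass N M R d => ∫ p in S, G (F.1 p.1) * F.1 p.2 := by
    funext F
    rw [← integral_indicator hSc.measurableSet]
    congr 1; funext p
    by_cases hp : p ∈ S
    · have hp2 : dist p.1 p.2 ≤ δ := hp.2
      rw [indicator_of_mem hp, ballProfile, if_pos hp2, one_mul]
    · rw [indicator_of_notMem hp]
      by_cases hδ : dist p.1 p.2 ≤ δ
      · have : ¬ (‖p.1‖ ≤ R ∧ ‖p.2‖ ≤ R) := fun h => hp ⟨by simpa using h, hδ⟩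
        by_cases h1 : ‖p.1‖ ≤ R
        · rw [F.2.2.2.1 p.2 (lt_of_not_ge fun h2 => this ⟨h1, h2⟩)]; simp
        · rw [F.2.2.2.1 p.1 (lt_of_not_ge h1), h0]; simp
      · rw [ballProfile, if_neg hδ, zero_mul]
  rw [h]
  have : IsLocallyFiniteMeasure (volume : Measure (Euc N × Euc N)) := by
    rw [Measure.volume_eq_prod]; infer_instance
  refine continuous_parametric_integral_of_continuous (X := equiClass N M R d)
    (μ := (volume : Measure (Euc N × Euc N))) (f := fun F p => G (F.1 p.1) * F.1 p.2) ?_ hSc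
  have e : Continuous fun q : equiClass N M R d × Euc N => q.1.1 q.2 :=
    continuous_eval.comp (by fun_prop : Continuous fun q : equiClass N M R d × Euc N =>
      (q.1.1, q.2))
  have e1 : Continuous fun q : equiClass N M R d × (Euc N × Euc N) => q.1.1 q.2.1 :=
    e.comp (by fun_prop : Continuous fun q : equiClass N M R d × (Euc N × Euc N) =>
      (q.1, q.2.1))
  have e2 : Continuous fun q : equiClass N M R d × (Euc N × Euc N) => q.1.1 q.2.2 :=
    e.comp (by fun_prop : Continuous fun q : equiClass N M R d × (Euc N × Euc N) =>
      (q.1, q.2.2))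
  exact (hG.comp e1).mul e2

lemma integrable_kernel {F : Euc N → ℝ} (hF : Continuous F) (hs : ∀ x, R < ‖x‖ → F x = 0)
    {G : ℝ → ℝ} (hG : Continuous G) (h0 : G 0 = 0) (δ : ℝ) :
    Integrable fun p : Euc N × Euc N =>
      ballProfile δ (dist p.1 p.2) * (G (F p.1) * F p.2) := by
  have hi : Integrable fun p : Euc N × Euc N => G (F p.1) * F p.2 := by
    refine Integrable.mul_prod (f := fun x => G (F x)) (g := F) ?_ ?_
    · exact (hG.comp hF).integrable_of_hasCompactSupport
        (hasCompactSupport_of_norm (R := R) fun x hx => by simp [hs x hx, h0])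
    · exact hF.integrable_of_hasCompactSupport (hasCompactSupport_of_norm hs)
  have hm : MeasurableSet {p : Euc N × Euc N | dist p.1 p.2 ≤ δ} :=
    (isClosed_le (by fun_prop) continuous_const).measurableSet
  refine (hi.indicator hm).congr (Eventually.of_forall fun p => ?_)
  by_cases hp : dist p.1 p.2 ≤ δ
  · simp [indicator, ballProfile, hp]
  · simp [indicator, ballProfile, hp]

end EquiClass

/-- Existence of the symmetric decreasing rearrangement of a continuous compactly supported
nonnegative function, together with the Riesz inequality for ball kernels. -/
theorem exists_symmetrization {N : ℕ} {h : Euc N → ℝ} (hc : Continuous h) (h0 : ∀ x, 0 ≤ h x)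
    {R : ℝ} (hs : ∀ x, R < ‖x‖ → h x = 0) :
    ∃ F : Euc N → ℝ, Continuous F ∧ (∀ x, 0 ≤ F x) ∧ (∀ x, R < ‖x‖ → F x = 0) ∧
      (∀ x x', ‖x‖ ≤ ‖x'‖ → F x' ≤ F x) ∧
      (∀ G : ℝ → ℝ, Continuous G → G 0 = 0 → ∫ x, G (F x) = ∫ x, G (h x)) ∧
      (∀ (G : ℝ → ℝ) (δ : ℝ), Continuous G → Monotone G → G 0 = 0 →
        ∫ p : Euc N × Euc N, ballProfile δ (dist p.1 p.2) * (G (h p.1) * h p.2) ≤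
          ∫ p : Euc N × Euc N, ballProfile δ (dist p.1 p.2) * (G (F p.1) * F p.2)) := by
  have hcs := hasCompactSupport_of_norm hs
  obtain ⟨M, hM⟩ : ∃ M, ∀ x, h x ≤ M := by
    obtain ⟨M, hM⟩ := hc.bounded_above_of_compact_support hcs
    exact ⟨M, fun x => (le_abs_self _).trans (hM x)⟩
  have huc : UniformContinuous h := hc.uniformContinuous_of_tendsto_cocompact
    (hcs.is_zero_at_infty)
  have : ∀ ε : ℝ, ∃ d : ℝ, 0 < ε → 0 < d ∧ ∀ x z, dist x z ≤ d → |h x - h z| ≤ ε := by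
    intro ε
    by_cases hε : 0 < ε
    · obtain ⟨d, hd, H⟩ := Metric.uniformContinuous_iff.1 huc ε hε
      exact ⟨d / 2, fun _ => ⟨by positivity, fun x z hxz =>
        by simpa [Real.dist_eq] using (H (a := x) (b := z) (by linarith)).le⟩⟩
    · exact ⟨0, fun h => absurd h hε⟩
  choose d hd' using this
  have hd : ∀ ε > 0, 0 < d ε := fun ε hε => (hd' ε hε).1
  set S := equiClass N M R d
  have : CompactSpace S := isCompact_iff_compactSpace.1 (isCompact_equiClass hd)
  let T : Set S := {F | (∀ G : ℝ → ℝ, Continuous G → G 0 = 0 →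
      ∫ x, G (F.1 x) = ∫ x, G (h x)) ∧
    ∀ (G : ℝ → ℝ) (δ : ℝ), Continuous G → Monotone G → G 0 = 0 →
      ∫ p : Euc N × Euc N, ballProfile δ (dist p.1 p.2) * (G (h p.1) * h p.2) ≤
        ∫ p : Euc N × Euc N, ballProfile δ (dist p.1 p.2) * (G (F.1 p.1) * F.1 p.2)}
  have hTc : IsClosed T := by
    simp only [T, ofPred_and, ofPred_forall]
    refine IsClosed.inter ?_ ?_
    · refine isClosed_iInter fun G => isClosed_iInter fun hG => isClosed_iInter fun hG0 => ?_
      exact isClosed_eq (continuous_integral_equiClass hd (Φ := fun _ => G)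
        (hG.comp continuous_snd) fun _ => hG0) continuous_const
    · refine isClosed_iInter fun G => isClosed_iInter fun δ => isClosed_iInter fun hG =>
        isClosed_iInter fun _ => isClosed_iInter fun hG0 => ?_
      exact isClosed_le continuous_const (continuous_integral_kernel_equiClass hd hG hG0 δ)
  have hTne : T.Nonempty :=
    ⟨⟨⟨h, hc⟩, h0, hM, hs, fun ε hε => (hd' ε hε).2⟩, fun _ _ _ => rfl, fun _ _ _ _ _ => le_rfl⟩
  have hmom : Continuous fun F : S => ∫ x, F.1 x * ‖x‖ ^ 2 :=
    continuous_integral_equiClass hd (Φ := fun x t => t * ‖x‖ ^ 2)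
      (by unfold Function.uncurry; fun_prop) (by simp)
  obtain ⟨F, hFT, hmin⟩ := hTc.isCompact.exists_isMinOn hTne hmom.continuousOn
  have hFc : Continuous F.1 := F.1.continuous
  have hF0 := F.2.1
  have hFM := F.2.2.1
  have hFs := F.2.2.2.1
  have hFm := F.2.2.2.2
  have hpol : ∀ (a : Euc N) (c : ℝ), ‖a‖ = 1 → 0 < c → ∀ x, inner ℝ a x < c →
      F.1 (hyperRefl a c x) ≤ F.1 x := by
    intro a c ha hc0 x hx
    have hPm : ∀ ε > 0, ∀ x z, dist x z ≤ d ε →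
        |polarize a c F.1 x - polarize a c F.1 z| ≤ ε :=
      fun ε hε => abs_polarize_sub_le ha (hFm ε hε)
    have hPc : Continuous (polarize a c F.1) := continuous_of_modulus hd hPm
    have hPs := polarize_eq_zero ha hc0.le hF0 hFs
    have hPT : (⟨⟨polarize a c F.1, hPc⟩, polarize_nonneg hF0, polarize_le hFM, hPs, hPm⟩ : S)
        ∈ T := by
      constructor
      · intro G hG hG0
        rw [← hFT.1 G hG hG0]
        exact integral_comp_polarize ha
          ((hG.comp hFc).integrable_of_hasCompactSupport
            (hasCompactSupport_of_norm (R := R) fun x hx => by simp [hFs x hx, hG0]))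
          ((hG.comp hPc).integrable_of_hasCompactSupport
            (hasCompactSupport_of_norm (R := R) fun x hx => by simp [hPs x hx, hG0]))
      · intro G δ hG hGm hG0
        exact (hFT.2 G δ hG hGm hG0).trans (integral_kernel_le_polarize ha hGm
          (ballProfile_antitone δ) (integrable_kernel hFc hFs hG hG0 δ)
          (integrable_kernel hPc hPs hG hG0 δ))
    exact le_of_integral_norm_sq_le_polarize ha hc0 hFc hPc (hasCompactSupport_of_norm hFs)
      (hasCompactSupport_of_norm hPs) (hmin hPT) hx
  have hlt : ∀ x x', ‖x‖ < ‖x'‖ → F.1 x' ≤ F.1 x := by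
    intro x x' hxx
    obtain ⟨a, c, ha, _, hx, hr, hpos⟩ := exists_hyperRefl_eq hxx.le (by rintro rfl; simp at hxx)
    rw [← hr]
    exact hpol a c ha (hpos hxx) x hx
  refine ⟨F.1, hFc, hF0, hFs, ?_, hFT.1, hFT.2⟩
  intro x x' hxx
  by_cases hx' : x' = 0
  · have : x = 0 := by simpa [hx'] using hxx
    rw [this, hx']
  have hl : Tendsto (fun t : ℝ => F.1 (t • x)) (nhdsWithin 1 (Iio 1)) (nhds (F.1 x)) := by
    have : Continuous fun t : ℝ => F.1 (t • x) := by fun_prop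
    simpa using (this.tendsto 1).mono_left nhdsWithin_le_nhds
  refine ge_of_tendsto hl ?_
  filter_upwards [self_mem_nhdsWithin, mem_nhdsWithin_of_mem_nhds (Ioi_mem_nhds one_pos)]
    with t ht ht0
  apply hlt
  rw [norm_smul, Real.norm_of_nonneg (le_of_lt ht0)]
  rcases (norm_nonneg x).eq_or_lt with h | h
  · rw [← h, mul_zero]; exact norm_pos_iff.2 hx'
  · exact (mul_lt_of_lt_one_left h ht).trans_le hxx

/-! ### Concentration function and decreasing rearrangement -/

/-- The concentration function `s ↦ inf_{t ≥ 0} (t s + ∫ (|h| - t)₊)`; it is the largest mass of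
`|h|` on a set of measure `s`. -/
def conc {N : ℕ} (h : Euc N → ℝ) (s : ℝ) : ℝ :=
  ⨅ t : NNReal, ((t : ℝ) * s + ∫ x, max (|h x| - t) 0)

section Concentration

variable {N : ℕ} {h g : Euc N → ℝ} {s : ℝ}

lemma conc_bddBelow (h : Euc N → ℝ) (hs : 0 ≤ s) :
    BddBelow (range fun t : NNReal => ((t : ℝ) * s + ∫ x, max (|h x| - t) 0)) := by
  refine ⟨0, ?_⟩
  rintro _ ⟨t, rfl⟩
  exact add_nonneg (mul_nonneg t.2 hs) (integral_nonneg fun x => le_max_right _ _)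

lemma conc_le (hs : 0 ≤ s) {t : ℝ} (ht : 0 ≤ t) :
    conc h s ≤ t * s + ∫ x, max (|h x| - t) 0 :=
  ciInf_le (conc_bddBelow h hs) ⟨t, ht⟩

lemma integrable_excess (hh : Integrable h) {t : ℝ} (ht : 0 ≤ t) :
    Integrable fun x => max (|h x| - t) 0 := by
  refine hh.abs.mono
    ((hh.abs.aestronglyMeasurable.sub aestronglyMeasurable_const).sup aestronglyMeasurable_const)
    (Eventually.of_forall fun x => ?_)
  simp only [Real.norm_eq_abs, abs_abs]
  rw [abs_of_nonneg (le_max_right _ _)]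
  exact max_le (by linarith) (abs_nonneg _)

lemma integrable_weight_mul (hh : Integrable h) (hg : Integrable g) (hg0 : ∀ x, 0 ≤ g x)
    (hg1 : ∀ x, g x ≤ 1) : Integrable fun x => g x * |h x| :=
  hh.abs.bdd_mul hg.aestronglyMeasurable (c := 1) (Eventually.of_forall fun x => by
    rw [Real.norm_of_nonneg (hg0 x)]; exact hg1 x)

lemma le_conc (hh : Integrable h) (hg : Integrable g) (hg0 : ∀ x, 0 ≤ g x)
    (hg1 : ∀ x, g x ≤ 1) (hs : ∫ x, g x ≤ s) : ∫ x, g x * |h x| ≤ conc h s := by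
  refine le_ciInf fun t => ?_
  have ht : (0 : ℝ) ≤ t := t.coe_nonneg
  have h1 : ∫ x, g x * |h x| ≤ ∫ x, ((t : ℝ) * g x + max (|h x| - t) 0) := by
    refine integral_mono (integrable_weight_mul hh hg hg0 hg1)
      ((hg.const_mul _).add (integrable_excess hh ht)) fun x => ?_
    dsimp only
    nlinarith [le_max_left (|h x| - t) 0, le_max_right (|h x| - t) 0, hg0 x, hg1 x]
  rw [integral_add (hg.const_mul (t : ℝ)) (integrable_excess hh ht), integral_const_mul] at h1
  linarith [mul_le_mul_of_nonneg_left hs ht]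

lemma conc_le_of_level (hh : Integrable h) (hg : Integrable g) {t : ℝ} (ht : 0 ≤ t)
    (hgt : ∀ x, t < |h x| → g x = 1) (hlt : ∀ x, |h x| < t → g x = 0) (hs : ∫ x, g x = s)
    (hs0 : 0 ≤ s) : conc h s ≤ ∫ x, g x * |h x| := by
  refine (conc_le hs0 ht).trans ?_
  rw [← hs, ← integral_const_mul, ← integral_add (hg.const_mul _) (integrable_excess hh ht)]
  refine le_of_eq (integral_congr_ae (Eventually.of_forall fun x => ?_))
  dsimp only
  rcases lt_trichotomy t (|h x|) with h1 | h1 | h1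
  · rw [hgt x h1, max_eq_left (by linarith)]; ring
  · rw [← h1]; simp [mul_comm]
  · rw [hlt x h1, max_eq_right (by linarith)]; ring

end Concentration

section Rearrangement

variable {N : ℕ} {E : Set (Euc N)} {g : Euc N → ℝ} {M : ℝ}

lemma rearr_bddAbove (hb : ∀ x ∈ E, |g x| ≤ M) (s : ℝ) :
    BddAbove {t : ℝ | 0 ≤ t ∧ ENNReal.ofReal s < volume {x | x ∈ E ∧ t < |g x|}} := by
  refine ⟨M, fun t ht => ?_⟩
  obtain ⟨x, hx⟩ := nonempty_of_measure_ne_zero (ne_bot_of_gt ht.2)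
  exact (hx.2.le).trans (hb x hx.1)

lemma rearr_nonneg (s : ℝ) : 0 ≤ rearr E g s := Real.sSup_nonneg fun _ ht => ht.1

lemma lt_rearr_iff (hb : ∀ x ∈ E, |g x| ≤ M) {s t : ℝ} (ht : 0 ≤ t) :
    t < rearr E g s ↔ ENNReal.ofReal s < volume {x | x ∈ E ∧ t < |g x|} := by
  constructor
  · intro h
    have hne : {t : ℝ | 0 ≤ t ∧ ENNReal.ofReal s < volume {x | x ∈ E ∧ t < |g x|}}.Nonempty := by
      by_contra hcon
      rw [not_nonempty_iff_eq_empty] at hcon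
      rw [rearr, hcon, Real.sSup_empty] at h
      linarith
    obtain ⟨t', ht', htt⟩ := exists_lt_of_lt_csSup hne h
    exact ht'.2.trans_le (measure_mono fun x hx => ⟨hx.1, htt.trans hx.2⟩)
  · intro h
    have hU : {x | x ∈ E ∧ t < |g x|} =
        ⋃ n : ℕ, {x | x ∈ E ∧ t + 1 / ((n : ℝ) + 1) < |g x|} := by
      ext x
      simp only [mem_ofPred_eq, mem_iUnion]
      constructor
      · rintro ⟨hx, hlt⟩
        obtain ⟨n, hn⟩ := exists_nat_one_div_lt (sub_pos.2 hlt)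
        exact ⟨n, hx, by linarith⟩
      · rintro ⟨n, hx, hn⟩
        exact ⟨hx, by linarith [@Nat.one_div_pos_of_nat ℝ _ _ _ n]⟩
    have hmono : Monotone fun n : ℕ => {x | x ∈ E ∧ t + 1 / ((n : ℝ) + 1) < |g x|} := by
      intro n m hnm x hx
      refine ⟨hx.1, lt_of_le_of_lt ?_ hx.2⟩
      have := Nat.one_div_le_one_div (α := ℝ) hnm
      linarith
    rw [hU, hmono.measure_iUnion] at h
    obtain ⟨n, hn⟩ := lt_iSup_iff.1 h
    have hp := @Nat.one_div_pos_of_nat ℝ _ _ _ n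
    refine lt_of_lt_of_le ?_ (le_csSup (rearr_bddAbove hb s) ⟨?_, hn⟩) <;> linarith

lemma rearr_antitone (hb : ∀ x ∈ E, |g x| ≤ M) : Antitone (rearr E g) := by
  intro s s' hs
  refine le_of_forall_lt fun t ht => ?_
  rcases lt_or_ge t 0 with h0 | h0
  · exact h0.trans_le (rearr_nonneg s)
  · rw [lt_rearr_iff hb h0] at ht ⊢
    exact (ENNReal.ofReal_le_ofReal hs).trans_lt ht

lemma rearr_le (hb : ∀ x ∈ E, |g x| ≤ M) (hM : 0 ≤ M) (s : ℝ) : rearr E g s ≤ M := by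
  refine Real.sSup_le (fun t ht => ?_) hM
  obtain ⟨x, hx⟩ := nonempty_of_measure_ne_zero (ne_bot_of_gt ht.2)
  exact (hx.2.le).trans (hb x hx.1)

lemma lintegral_rearr_excess (hb : ∀ x ∈ E, |g x| ≤ M) (s : ℝ) {t : ℝ}
    (ht : 0 ≤ t) : ∫⁻ σ in Ioo 0 s, ENNReal.ofReal (max (rearr E g σ - t) 0) =
      ∫⁻ τ in Ioi (0 : ℝ), min (ENNReal.ofReal s) (volume {x | x ∈ E ∧ t + τ < |g x|}) := by
  rw [lintegral_eq_lintegral_meas_lt (f := fun σ => max (rearr E g σ - t) 0) _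
    (Eventually.of_forall fun σ => le_max_right _ _)
    (((rearr_antitone hb).measurable.sub measurable_const).max measurable_const).aemeasurable]
  refine setLIntegral_congr_fun measurableSet_Ioi fun τ hτ => ?_
  have hτ : 0 < τ := hτ
  set m := volume {x | x ∈ E ∧ t + τ < |g x|} with hm
  have h1 : {σ : ℝ | τ < max (rearr E g σ - t) 0} = {σ | ENNReal.ofReal σ < m} := by
    ext σ
    simp only [mem_ofPred_eq]
    rw [hm, ← lt_rearr_iff hb (by positivity), lt_max_iff]
    constructor
    · rintro (h | h) <;> linarith
    · intro h; left; linarith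
  rw [h1]
  have hmeas : MeasurableSet {σ : ℝ | ENNReal.ofReal σ < m} :=
    measurableSet_lt ENNReal.measurable_ofReal measurable_const
  rw [Measure.restrict_apply hmeas]
  by_cases hmt : m = ⊤
  · have : {σ : ℝ | ENNReal.ofReal σ < m} ∩ Ioo 0 s = Ioo 0 s := by
      rw [inter_eq_right]
      intro σ _
      simp [hmt]
    rw [this, Real.volume_Ioo, hmt, min_eq_left le_top, sub_zero]
  · have : {σ : ℝ | ENNReal.ofReal σ < m} ∩ Ioo 0 s = Ioo 0 (min s m.toReal) := by
      ext σ
      simp only [mem_inter_iff, mem_ofPred_eq, mem_Ioo, lt_min_iff]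
      constructor
      · rintro ⟨h, h0, hs⟩
        exact ⟨h0, hs, (ENNReal.ofReal_lt_iff_lt_toReal h0.le hmt).1 h⟩
      · rintro ⟨h0, hs, h⟩
        exact ⟨(ENNReal.ofReal_lt_iff_lt_toReal h0.le hmt).2 h, h0, hs⟩
    rw [this, Real.volume_Ioo, sub_zero, ENNReal.ofReal_min, ENNReal.ofReal_toReal hmt]

lemma lintegral_excess (hi : Integrable (E.indicator g)) {t : ℝ} (ht : 0 ≤ t) :
    ∫⁻ x, ENNReal.ofReal (max (|E.indicator g x| - t) 0) =
      ∫⁻ τ in Ioi (0 : ℝ), volume {x | x ∈ E ∧ t + τ < |g x|} := by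
  rw [lintegral_eq_lintegral_meas_lt (f := fun x => max (|E.indicator g x| - t) 0) _
    (Eventually.of_forall fun σ => le_max_right _ _) (integrable_excess hi ht).aemeasurable]
  refine setLIntegral_congr_fun measurableSet_Ioi fun τ hτ => ?_
  have hτ : 0 < τ := hτ
  congr 1
  ext x
  simp only [mem_ofPred_eq, lt_max_iff]
  by_cases hx : x ∈ E
  · rw [indicator_of_mem hx]
    constructor
    · rintro (h | h)
      · exact ⟨hx, by linarith⟩
      · linarith
    · rintro ⟨_, h⟩; left; linarith
  · rw [indicator_of_notMem hx, abs_zero]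
    constructor
    · rintro (h | h) <;> linarith
    · exact fun h => absurd h.1 hx

lemma integrableOn_rearr (hb : ∀ x ∈ E, |g x| ≤ M) (hM : 0 ≤ M) (s : ℝ) :
    IntegrableOn (rearr E g) (Ioo 0 s) :=
  Measure.integrableOn_of_bounded (M := M) (by simp)
    (rearr_antitone hb).measurable.aestronglyMeasurable
    (Eventually.of_forall fun σ => by
      rw [Real.norm_of_nonneg (rearr_nonneg σ)]; exact rearr_le hb hM σ)

/-- The integral of the decreasing rearrangement is the concentration function. -/
lemma integral_rearr_eq_conc (hb : ∀ x ∈ E, |g x| ≤ M) (hM : 0 ≤ M)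
    (hi : Integrable (E.indicator g)) {s : ℝ} (hs : 0 ≤ s) :
    ∫ σ in (0 : ℝ)..s, rearr E g σ = conc (E.indicator g) s := by
  rw [intervalIntegral.integral_of_le hs, integral_Ioc_eq_integral_Ioo]
  have hexc : ∀ t : ℝ, IntegrableOn (fun σ => max (rearr E g σ - t) 0) (Ioo 0 s) := fun t =>
    Measure.integrableOn_of_bounded (M := M + |t|) (by simp)
      (((rearr_antitone hb).measurable.sub measurable_const).max
        measurable_const).aestronglyMeasurable
      (Eventually.of_forall fun σ => by
        rw [Real.norm_of_nonneg (le_max_right _ _)]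
        exact max_le (by linarith [rearr_le hb hM σ, neg_abs_le t]) (by positivity))
  have hconst : ∀ t : ℝ, ∫ _ in Ioo 0 s, t = t * s := fun t => by
    simp [hs, mul_comm]
  have hL : ∀ t : ℝ, ∫ σ in Ioo 0 s, max (rearr E g σ - t) 0 =
      (∫⁻ σ in Ioo 0 s, ENNReal.ofReal (max (rearr E g σ - t) 0)).toReal := fun t =>
    integral_eq_lintegral_of_nonneg_ae (Eventually.of_forall fun σ => le_max_right _ _)
      (hexc t).aestronglyMeasurable
  have hR : ∀ t : ℝ, 0 ≤ t → ∫ x, max (|E.indicator g x| - t) 0 =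
      (∫⁻ x, ENNReal.ofReal (max (|E.indicator g x| - t) 0)).toReal := fun t ht =>
    integral_eq_lintegral_of_nonneg_ae (Eventually.of_forall fun σ => le_max_right _ _)
      (integrable_excess hi ht).aestronglyMeasurable
  apply le_antisymm
  · refine le_ciInf fun t => ?_
    have ht : (0 : ℝ) ≤ t := t.coe_nonneg
    have h1 : ∫ σ in Ioo 0 s, rearr E g σ ≤
        ∫ σ in Ioo 0 s, ((t : ℝ) + max (rearr E g σ - t) 0) := by
      refine integral_mono (integrableOn_rearr hb hM s)
        ((integrable_const _).add (hexc t)) fun σ => ?_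
      dsimp only
      linarith [le_max_left (rearr E g σ - t) 0]
    rw [integral_add (integrable_const _) (hexc t), hconst] at h1
    refine h1.trans (add_le_add le_rfl ?_)
    rw [hL, hR _ ht]
    refine ENNReal.toReal_mono (integrable_excess hi ht).lintegral_lt_top.ne ?_
    rw [lintegral_rearr_excess hb s ht, lintegral_excess hi ht]
    exact lintegral_mono fun τ => min_le_right _ _
  · set t := rearr E g s with ht
    have ht0 : 0 ≤ t := rearr_nonneg s
    refine (conc_le hs ht0).trans ?_
    have h1 : ∫ σ in Ioo 0 s, rearr E g σ =
        ∫ σ in Ioo 0 s, (t + max (rearr E g σ - t) 0) := by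
      refine setIntegral_congr_fun measurableSet_Ioo fun σ hσ => ?_
      have : t ≤ rearr E g σ := rearr_antitone hb hσ.2.le
      rw [max_eq_left (by linarith)]; ring
    rw [h1, integral_add (integrable_const _) (hexc t), hconst, hL, hR t ht0]
    refine add_le_add le_rfl (ENNReal.toReal_mono (hexc t).lintegral_lt_top.ne ?_)
    rw [lintegral_rearr_excess hb s ht0, lintegral_excess hi ht0]
    refine setLIntegral_mono' measurableSet_Ioi fun τ hτ => le_min ?_ le_rfl
    have hτ : 0 < τ := hτ
    have := (lt_rearr_iff hb ht0 (s := s)).not.1 (lt_irrefl t)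
    exact (measure_mono fun x (hx : x ∈ E ∧ t + τ < |g x|) =>
      (⟨hx.1, by linarith [hx.2]⟩ : x ∈ E ∧ t < |g x|)).trans (not_lt.1 this)

end Rearrangement

section Balls

variable {N : ℕ}

lemma omegaN_pos : 0 < omegaN N :=
  ENNReal.toReal_pos (Metric.measure_ball_pos volume _ one_pos).ne' measure_ball_lt_top.ne

lemma volume_ball_zero [NeZero N] {r : ℝ} (hr : 0 ≤ r) :
    volume (Metric.ball (0 : Euc N) r) = ENNReal.ofReal (omegaN N * r ^ N) := by
  rw [Measure.addHaar_ball _ _ hr, finrank_euclideanSpace_fin, mul_comm,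
    ENNReal.ofReal_mul omegaN_pos.le, omegaN, ENNReal.ofReal_toReal measure_ball_lt_top.ne]

lemma volume_closedBall_zero [NeZero N] {r : ℝ} (hr : 0 ≤ r) :
    volume (Metric.closedBall (0 : Euc N) r) = ENNReal.ofReal (omegaN N * r ^ N) := by
  rw [Measure.addHaar_closedBall_eq_addHaar_ball, volume_ball_zero hr]

lemma omegaN_mul_rpow [NeZero N] {s : ℝ} (hs : 0 ≤ s) :
    omegaN N * ((s / omegaN N) ^ ((N : ℝ)⁻¹)) ^ N = s := by
  rw [Real.rpow_inv_natCast_pow (div_nonneg hs omegaN_pos.le) (NeZero.ne N),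
    mul_div_cancel₀ _ omegaN_pos.ne']

lemma map_omegaN_mul_norm_pow [NeZero N] {r : ℝ} (hr : 0 ≤ r) :
    Measure.map (fun x : Euc N => omegaN N * ‖x‖ ^ N) (volume.restrict (Metric.ball 0 r)) =
      volume.restrict (Ioo 0 (omegaN N * r ^ N)) := by
  have hmeas : Measurable fun x : Euc N => omegaN N * ‖x‖ ^ N := by fun_prop
  have hfin : IsFiniteMeasure (volume.restrict (Metric.ball (0 : Euc N) r)) :=
    ⟨by simpa using measure_ball_lt_top⟩
  have hω := omegaN_pos (N := N)
  refine Measure.ext_of_Iic _ _ fun b => ?_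
  rw [Measure.map_apply hmeas measurableSet_Iic, Measure.restrict_apply (hmeas measurableSet_Iic),
    Measure.restrict_apply measurableSet_Iic]
  rcases lt_or_ge b 0 with hb | hb
  · have h1 : (fun x : Euc N => omegaN N * ‖x‖ ^ N) ⁻¹' Iic b = ∅ := by
      ext x
      simp only [mem_preimage, mem_Iic, mem_empty_iff_false, iff_false, not_le]
      exact hb.trans_le (by positivity)
    have h2 : Iic b ∩ Ioo 0 (omegaN N * r ^ N) = ∅ := by
      ext x
      simp only [mem_inter_iff, mem_Iic, mem_Ioo, mem_empty_iff_false, iff_false]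
      intro h; linarith [h.1, h.2.1]
    rw [h1, h2]; simp
  rcases lt_or_ge b (omegaN N * r ^ N) with hbs | hbs
  · set ρ := (b / omegaN N) ^ ((N : ℝ)⁻¹) with hρ
    have hρ0 : 0 ≤ ρ := Real.rpow_nonneg (div_nonneg hb hω.le) _
    have hρb : omegaN N * ρ ^ N = b := omegaN_mul_rpow hb
    have h1 : (fun x : Euc N => omegaN N * ‖x‖ ^ N) ⁻¹' Iic b ∩ Metric.ball 0 r =
        Metric.closedBall 0 ρ := by
      ext x
      simp only [mem_inter_iff, mem_preimage, mem_Iic, mem_ball_zero_iff, mem_closedBall_zero_iff]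
      rw [← hρb, mul_le_mul_iff_right₀ hω, pow_le_pow_iff_left₀ (norm_nonneg _) hρ0 (NeZero.ne N)]
      constructor
      · exact fun h => h.1
      · refine fun h => ⟨h, h.trans_lt ?_⟩
        rw [← hρb, mul_lt_mul_iff_right₀ hω, pow_lt_pow_iff_left₀ hρ0 hr (NeZero.ne N)] at hbs
        exact hbs
    have h2 : Iic b ∩ Ioo 0 (omegaN N * r ^ N) = Ioc 0 b := by
      ext x
      simp only [mem_inter_iff, mem_Iic, mem_Ioo, mem_Ioc]
      constructor
      · rintro ⟨h, h0, -⟩; exact ⟨h0, h⟩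
      · rintro ⟨h0, h⟩; exact ⟨h, h0, h.trans_lt hbs⟩
    rw [h1, h2, volume_closedBall_zero hρ0, hρb, Real.volume_Ioc, sub_zero]
  · have h1 : (fun x : Euc N => omegaN N * ‖x‖ ^ N) ⁻¹' Iic b ∩ Metric.ball 0 r =
        Metric.ball 0 r := by
      rw [inter_eq_right]
      intro x hx
      rw [mem_ball_zero_iff] at hx
      simp only [mem_preimage, mem_Iic]
      refine le_trans ?_ hbs
      gcongr
    have h2 : Iic b ∩ Ioo 0 (omegaN N * r ^ N) = Ioo 0 (omegaN N * r ^ N) := by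
      rw [inter_eq_right]
      intro x hx
      exact hx.2.le.trans hbs
    rw [h1, h2, volume_ball_zero hr, Real.volume_Ioo, sub_zero]

lemma integral_ball_schwarz [NeZero N] {E : Set (Euc N)} {g : Euc N → ℝ} {M : ℝ}
    (hb : ∀ x ∈ E, |g x| ≤ M) {r : ℝ} (hr : 0 ≤ r) :
    ∫ x in Metric.ball (0 : Euc N) r, schwarz E g x =
      ∫ σ in (0 : ℝ)..(omegaN N * r ^ N), rearr E g σ := by
  have hs : 0 ≤ omegaN N * r ^ N := mul_nonneg omegaN_pos.le (pow_nonneg hr _)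
  have hmeas : Measurable fun x : Euc N => omegaN N * ‖x‖ ^ N := by fun_prop
  rw [intervalIntegral.integral_of_le hs, integral_Ioc_eq_integral_Ioo,
    ← map_omegaN_mul_norm_pow hr, integral_map hmeas.aemeasurable
      (rearr_antitone hb).measurable.aestronglyMeasurable]
  rfl

end Balls

/-! ### Radially nonincreasing functions and ball averages -/

/-- The integral of `F` over the closed ball of radius `δ` centred at `x`. -/
def ballInt {N : ℕ} (δ : ℝ) (F : Euc N → ℝ) (x : Euc N) : ℝ :=
  ∫ y, ballProfile δ (dist x y) * F y

section BallAverage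

variable {N : ℕ} {F G : Euc N → ℝ}

lemma ballProfile_nonneg (δ d : ℝ) : 0 ≤ ballProfile δ d := by
  unfold ballProfile; split_ifs <;> norm_num

lemma ballProfile_le_one (δ d : ℝ) : ballProfile δ d ≤ 1 := by
  unfold ballProfile; split_ifs <;> norm_num

lemma norm_ballProfile_le (δ d : ℝ) : ‖ballProfile δ d‖ ≤ 1 := by
  rw [Real.norm_of_nonneg (ballProfile_nonneg δ d)]; exact ballProfile_le_one δ d

lemma measurable_ballProfile (δ : ℝ) : Measurable (ballProfile δ) :=
  (ballProfile_antitone δ).measurable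

lemma integrable_ballProfile_mul (δ : ℝ) (x : Euc N) (hF : Integrable F) :
    Integrable fun y => ballProfile δ (dist x y) * F y :=
  hF.bdd_mul (c := 1)
    ((measurable_ballProfile δ).comp (by fun_prop)).aestronglyMeasurable
    (Eventually.of_forall fun _ => norm_ballProfile_le _ _)

lemma integrable_ballProfile_mul_mul (δ : ℝ) (hG : Integrable G) (hF : Integrable F) :
    Integrable fun p : Euc N × Euc N => ballProfile δ (dist p.1 p.2) * (G p.1 * F p.2) :=
  (hG.mul_prod hF).bdd_mul (c := 1)
    ((measurable_ballProfile δ).comp (by fun_prop)).aestronglyMeasurable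
    (Eventually.of_forall fun _ => norm_ballProfile_le _ _)

lemma integral_kernel_eq (δ : ℝ) (hG : Integrable G) (hF : Integrable F) :
    ∫ p : Euc N × Euc N, ballProfile δ (dist p.1 p.2) * (G p.1 * F p.2) =
      ∫ x, G x * ballInt δ F x := by
  rw [Measure.volume_eq_prod, integral_prod _ (integrable_ballProfile_mul_mul δ hG hF)]
  refine integral_congr_ae (Eventually.of_forall fun x => ?_)
  simp only [ballInt]
  rw [← integral_const_mul]
  refine integral_congr_ae (Eventually.of_forall fun y => ?_)
  ring

lemma integral_kernel_eq' (δ : ℝ) (hG : Integrable G) (hF : Integrable F) :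
    ∫ p : Euc N × Euc N, ballProfile δ (dist p.1 p.2) * (G p.1 * F p.2) =
      ∫ y, ballInt δ G y * F y := by
  rw [Measure.volume_eq_prod, integral_prod_symm _ (integrable_ballProfile_mul_mul δ hG hF)]
  refine integral_congr_ae (Eventually.of_forall fun x => ?_)
  simp only [ballInt]
  rw [← integral_mul_const]
  refine integral_congr_ae (Eventually.of_forall fun y => ?_)
  simp only [dist_comm x y]
  ring

lemma integral_mul_ballInt_comm (δ : ℝ) (hG : Integrable G) (hF : Integrable F) :
    ∫ x, G x * ballInt δ F x = ∫ y, ballInt δ G y * F y := by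
  rw [← integral_kernel_eq δ hG hF, integral_kernel_eq' δ hG hF]

lemma stronglyMeasurable_ballInt (δ : ℝ) (hF : AEStronglyMeasurable F) :
    StronglyMeasurable (ballInt δ F) := by
  have h : ballInt δ F = ballInt δ (hF.mk F) := by
    funext x
    refine integral_congr_ae ?_
    filter_upwards [hF.ae_eq_mk] with y hy
    rw [hy]
  rw [h]
  have : StronglyMeasurable fun p : Euc N × Euc N => ballProfile δ (dist p.1 p.2) * hF.mk F p.2 :=
    ((measurable_ballProfile δ).comp (by fun_prop)).stronglyMeasurable.mul
      (hF.stronglyMeasurable_mk.comp_measurable measurable_snd)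
  exact this.integral_prod_right (ν := volume)

lemma integral_ballProfile [NeZero N] {δ : ℝ} (hδ : 0 ≤ δ) (x : Euc N) :
    ∫ y, ballProfile δ (dist x y) = omegaN N * δ ^ N := by
  have h : (fun y => ballProfile δ (dist x y)) = (Metric.closedBall x δ).indicator fun _ => 1 := by
    funext y
    by_cases hy : dist x y ≤ δ
    · rw [indicator_of_mem (by rwa [Metric.mem_closedBall, dist_comm])]; exact if_pos hy
    · rw [indicator_of_notMem (by rwa [Metric.mem_closedBall, dist_comm])]; exact if_neg hy
  rw [h, integral_indicator Metric.isClosed_closedBall.measurableSet]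
  have hv : volume (Metric.closedBall x δ) = ENNReal.ofReal (omegaN N * δ ^ N) := by
    rw [← volume_closedBall_zero hδ, Measure.addHaar_closedBall_center]
  simp only [integral_const, smul_eq_mul, mul_one, measureReal_restrict_apply_univ]
  rw [Measure.real, hv, ENNReal.toReal_ofReal (mul_nonneg omegaN_pos.le (pow_nonneg hδ _))]

lemma integrable_ballProfile [NeZero N] (δ : ℝ) (x : Euc N) :
    Integrable fun y => ballProfile δ (dist x y) := by
  have h : (fun y => ballProfile δ (dist x y)) = (Metric.closedBall x δ).indicator fun _ => 1 := by
    funext y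
    by_cases hy : dist x y ≤ δ
    · rw [indicator_of_mem (by rwa [Metric.mem_closedBall, dist_comm])]; exact if_pos hy
    · rw [indicator_of_notMem (by rwa [Metric.mem_closedBall, dist_comm])]; exact if_neg hy
  rw [h, integrable_indicator_iff Metric.isClosed_closedBall.measurableSet]
  exact integrableOn_const measure_closedBall_lt_top.ne

lemma integrable_ballProfile_mul_snd [NeZero N] {δ : ℝ} (hδ : 0 ≤ δ) (hF : Integrable F) :
    Integrable (fun p : Euc N × Euc N => ballProfile δ (dist p.1 p.2) * F p.2)
      (volume.prod volume) := by
  have hm : AEStronglyMeasurable (fun p : Euc N × Euc N => ballProfile δ (dist p.1 p.2) * F p.2)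
      (volume.prod volume) :=
    ((measurable_ballProfile δ).comp (by fun_prop)).aestronglyMeasurable.mul
      hF.aestronglyMeasurable.comp_snd
  refine (integrable_prod_iff' hm).2 ⟨Eventually.of_forall fun y => ?_, ?_⟩
  · simp only [dist_comm _ y]
    exact (integrable_ballProfile δ y).mul_const _
  · have : (fun y : Euc N => ∫ x : Euc N, ‖ballProfile δ (dist x y) * F y‖) =
        fun y => (omegaN N * δ ^ N) * ‖F y‖ := by
      funext y
      rw [← integral_ballProfile hδ y, ← integral_mul_const]
      simp only [dist_comm _ y, norm_mul, Real.norm_of_nonneg (ballProfile_nonneg _ _)]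
    simp only [this]
    exact hF.norm.const_mul _

lemma integrable_ballInt [NeZero N] {δ : ℝ} (hδ : 0 ≤ δ) (hF : Integrable F) :
    Integrable (ballInt δ F) :=
  (integrable_ballProfile_mul_snd hδ hF).integral_prod_left

lemma integral_ballInt [NeZero N] {δ : ℝ} (hδ : 0 ≤ δ) (hF : Integrable F) :
    ∫ x, ballInt δ F x = omegaN N * δ ^ N * ∫ x, F x := by
  have h := integral_integral_swap
    (f := fun (x y : Euc N) => ballProfile δ (dist x y) * F y)
    (integrable_ballProfile_mul_snd hδ hF)
  refine h.trans ?_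
  rw [← integral_const_mul]
  refine integral_congr_ae (Eventually.of_forall fun y => ?_)
  dsimp only
  rw [integral_mul_const, ← integral_ballProfile hδ y]
  simp only [dist_comm]

/-- Ball averages of radially nonincreasing functions are radially nonincreasing. -/
lemma ballInt_radial (δ : ℝ) (hF : Integrable F) (hr : ∀ x x', ‖x‖ ≤ ‖x'‖ → F x' ≤ F x)
    (x x' : Euc N) (h : ‖x‖ ≤ ‖x'‖) : ballInt δ F x' ≤ ballInt δ F x := by
  rcases eq_or_ne x x' with rfl | hne
  · exact le_rfl
  obtain ⟨a, c, ha, hc, hx, hxx, -⟩ := exists_hyperRefl_eq h hne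
  set k : Euc N → ℝ := fun y => ballProfile δ (dist x y) with hk
  have hFσ : Integrable fun y => F (hyperRefl a c y) :=
    (measurePreserving_hyperRefl ha).integrable_comp_of_integrable hF
  have e1 : ballInt δ F x' = ∫ y, k y * F (hyperRefl a c y) := by
    rw [ballInt, ← integral_comp_hyperRefl ha (c := c), ← hxx]
    simp only [dist_hyperRefl_hyperRefl ha, hk]
  have e2 : ballInt δ F x' = ∫ y, k (hyperRefl a c y) * F y := by
    rw [e1, ← integral_comp_hyperRefl ha (c := c)]
    simp only [hyperRefl_hyperRefl ha]
  have e3 : ballInt δ F x = ∫ y, k (hyperRefl a c y) * F (hyperRefl a c y) := by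
    rw [integral_comp_hyperRefl ha (c := c) fun y => k y * F y]; rfl
  have i1 : Integrable fun y => k y * F y := integrable_ballProfile_mul δ x hF
  have i2 : Integrable fun y => k y * F (hyperRefl a c y) := integrable_ballProfile_mul δ x hFσ
  have i3 : Integrable fun y => k (hyperRefl a c y) * F (hyperRefl a c y) :=
    (measurePreserving_hyperRefl ha).integrable_comp_of_integrable i1
  have i4 : Integrable fun y => k (hyperRefl a c y) * F y := by
    have := (measurePreserving_hyperRefl (c := c) ha).integrable_comp_of_integrable i2
    simpa only [Function.comp_def, hyperRefl_hyperRefl ha] using this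
  have hm : ∫ y, (k y * F (hyperRefl a c y) + k (hyperRefl a c y) * F y) ≤
      ∫ y, (k y * F y + k (hyperRefl a c y) * F (hyperRefl a c y)) := by
    refine integral_mono (i2.add i4) (i1.add i3) fun y => ?_
    dsimp only
    have hns := norm_hyperRefl_sq (c := c) ha y
    have hds := dist_hyperRefl_sq (c := c) ha x y
    rcases le_total (inner ℝ a y) c with hy | hy
    · have hn : F (hyperRefl a c y) ≤ F y := by
        refine hr _ _ ((pow_le_pow_iff_left₀ (norm_nonneg _) (norm_nonneg _) two_ne_zero).1 ?_)
        nlinarith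
      have hd : k (hyperRefl a c y) ≤ k y := by
        refine ballProfile_antitone δ
          ((pow_le_pow_iff_left₀ dist_nonneg dist_nonneg two_ne_zero).1 ?_)
        nlinarith
      nlinarith
    · have hn : F y ≤ F (hyperRefl a c y) := by
        refine hr _ _ ((pow_le_pow_iff_left₀ (norm_nonneg _) (norm_nonneg _) two_ne_zero).1 ?_)
        nlinarith
      have hd : k y ≤ k (hyperRefl a c y) := by
        refine ballProfile_antitone δ
          ((pow_le_pow_iff_left₀ dist_nonneg dist_nonneg two_ne_zero).1 ?_)
        nlinarith
      nlinarith
  rw [integral_add i2 i4, integral_add i1 i3, ← e1, ← e2, ← e3] at hm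
  have : ∫ y, k y * F y = ballInt δ F x := rfl
  linarith

/-- Among weights in `[0, 1]` with prescribed mass, the indicator of a centred ball maximizes the
integral against a radially nonincreasing function. -/
lemma integral_mul_le_of_radial [NeZero N] {ψ : Euc N → ℝ} (hψ : Integrable ψ)
    (hr : ∀ x x', ‖x‖ ≤ ‖x'‖ → ψ x' ≤ ψ x) (hG : Integrable G) (hG0 : ∀ x, 0 ≤ G x)
    (hG1 : ∀ x, G x ≤ 1) {r : ℝ} (hr0 : 0 ≤ r) (hm : ∫ x, G x = omegaN N * r ^ N) :
    ∫ x, G x * ψ x ≤ ∫ x, (Metric.ball (0 : Euc N) r).indicator 1 x * ψ x := by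
  set B : Euc N → ℝ := (Metric.ball (0 : Euc N) r).indicator 1 with hB
  have hBi : Integrable B := (integrable_indicator_iff Metric.isOpen_ball.measurableSet).2
    (integrableOn_const measure_ball_lt_top.ne)
  have hBint : ∫ x, B x = omegaN N * r ^ N := by
    rw [hB, integral_indicator_one Metric.isOpen_ball.measurableSet, Measure.real,
      volume_ball_zero hr0, ENNReal.toReal_ofReal (mul_nonneg omegaN_pos.le (pow_nonneg hr0 _))]
  obtain ⟨x₀, hx₀⟩ : ∃ x₀ : Euc N, ‖x₀‖ = r := by
    refine ⟨EuclideanSpace.single (0 : Fin N) r, ?_⟩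
    simp [abs_of_nonneg hr0]
  have iG : Integrable fun x => G x * ψ x := hψ.bdd_mul hG.aestronglyMeasurable (c := 1)
    (Eventually.of_forall fun x => by rw [Real.norm_of_nonneg (hG0 x)]; exact hG1 x)
  have iB : Integrable fun x => B x * ψ x := hψ.bdd_mul hBi.aestronglyMeasurable (c := 1)
    (Eventually.of_forall fun x => by
      by_cases hx : x ∈ Metric.ball (0 : Euc N) r <;> simp [hB, hx])
  have h : ∫ x, (G x * ψ x + ψ x₀ * B x) ≤ ∫ x, (B x * ψ x + ψ x₀ * G x) := by
    refine integral_mono (iG.add (hBi.const_mul _)) (iB.add (hG.const_mul _)) fun x => ?_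
    dsimp only
    by_cases hx : x ∈ Metric.ball (0 : Euc N) r
    · rw [hB, indicator_of_mem hx, Pi.one_apply]
      rw [mem_ball_zero_iff] at hx
      nlinarith [hr x x₀ (by rw [hx₀]; exact hx.le), hG1 x]
    · rw [hB, indicator_of_notMem hx]
      rw [mem_ball_zero_iff, not_lt] at hx
      nlinarith [hr x₀ x (by rwa [hx₀]), hG0 x]
  rw [integral_add iG (hBi.const_mul _), integral_add iB (hG.const_mul _), integral_const_mul,
    integral_const_mul, hBint, hm] at h
  linarith

/-- A radially nonincreasing set coincides with a centred ball up to a null set. -/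
lemma exists_ball_ae_eq [NeZero N] {S : Set (Euc N)} {R : ℝ} (hR : 0 ≤ R)
    (hS : ∀ x x', ‖x‖ ≤ ‖x'‖ → x' ∈ S → x ∈ S) (hSR : ∀ x ∈ S, ‖x‖ ≤ R) :
    ∃ ρ ∈ Icc 0 R, S =ᵐ[volume] Metric.ball (0 : Euc N) ρ := by
  have hbdd : BddAbove (norm '' S) := ⟨R, by rintro _ ⟨x, hx, rfl⟩; exact hSR x hx⟩
  refine ⟨sSup (norm '' S), ⟨Real.sSup_nonneg ?_, Real.sSup_le ?_ hR⟩, ?_⟩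
  · rintro _ ⟨x, -, rfl⟩; exact norm_nonneg x
  · rintro _ ⟨x, hx, rfl⟩; exact hSR x hx
  set ρ := sSup (norm '' S)
  have h1 : Metric.ball (0 : Euc N) ρ ⊆ S := by
    intro x hx
    rw [mem_ball_zero_iff] at hx
    rcases (norm '' S).eq_empty_or_nonempty with he | hne
    · have : ρ = 0 := by simp only [ρ, he, Real.sSup_empty]
      linarith [norm_nonneg x]
    · obtain ⟨_, ⟨x', hx', rfl⟩, hlt⟩ := exists_lt_of_lt_csSup hne hx
      exact hS x x' hlt.le hx'
  have h2 : S ⊆ Metric.closedBall 0 ρ := fun x hx =>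
    mem_closedBall_zero_iff.2 (le_csSup hbdd ⟨x, hx, rfl⟩)
  refine (ae_le_set.2 ?_).antisymm h1.eventuallyLE
  refine measure_mono_null (t := Metric.sphere 0 ρ) (fun x hx => ?_)
    (Measure.addHaar_sphere volume (0 : Euc N) ρ)
  have := mem_closedBall_zero_iff.1 (h2 hx.1)
  have h3 := hx.2
  rw [mem_ball_zero_iff, not_lt] at h3
  exact mem_sphere_zero_iff_norm.2 (le_antisymm this h3)

/-- If `p` has mass at most `C` on every centred ball of radius at most `R`, then the integral of
`p` against a radially nonincreasing weight with values in `[0, K]` is at most `K C`. -/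
lemma integral_radial_mul_le [NeZero N] {p q : Euc N → ℝ} {R K C : ℝ} (hR : 0 ≤ R) (hK : 0 ≤ K)
    (hp : Integrable p) (hpC : ∀ ρ ∈ Icc 0 R, ∫ x in Metric.ball (0 : Euc N) ρ, p x ≤ C)
    (hqm : Measurable q) (hq0 : ∀ x, 0 ≤ q x) (hqK : ∀ x, q x ≤ K)
    (hqr : ∀ x x', ‖x‖ ≤ ‖x'‖ → q x' ≤ q x) (hqR : ∀ x, R < ‖x‖ → q x = 0) :
    ∫ x, q x * p x ≤ K * C := by
  set S : Set (Euc N × ℝ) := {z | z.2 < q z.1} with hSdef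
  have hSm : MeasurableSet S := measurableSet_lt measurable_snd (hqm.comp measurable_fst)
  have hfin : IsFiniteMeasure (volume.restrict (Ioo (0 : ℝ) K)) := ⟨by simp⟩
  have hInt : Integrable (S.indicator fun z : Euc N × ℝ => p z.1)
      (volume.prod (volume.restrict (Ioo (0 : ℝ) K))) :=
    (hp.comp_fst _).indicator hSm
  have h1 : ∫ x, q x * p x = ∫ x, ∫ τ in Ioo (0 : ℝ) K, S.indicator (fun z => p z.1) (x, τ) := by
    refine integral_congr_ae (Eventually.of_forall fun x => ?_)
    have hset : Ioo (0 : ℝ) K ∩ Iio (q x) = Ioo 0 (q x) := by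
      rw [Ioo_inter_Iio, min_eq_right (hqK x)]
    have : (fun τ : ℝ => S.indicator (fun z => p z.1) (x, τ)) =
        (Iio (q x)).indicator fun _ => p x := by
      funext τ
      by_cases h : τ < q x
      · rw [indicator_of_mem (s := S) h, indicator_of_mem (s := Iio (q x)) h]
      · rw [indicator_of_notMem (s := S) h, indicator_of_notMem (s := Iio (q x)) h]
    dsimp only
    rw [this, setIntegral_indicator measurableSet_Iio, hset]
    simp [hq0 x]
  rw [h1, integral_integral_swap (f := fun x τ => S.indicator (fun z => p z.1) (x, τ)) hInt]
  have h2 : ∀ τ ∈ Ioo (0 : ℝ) K, ∫ x, S.indicator (fun z => p z.1) (x, τ) ≤ C := by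
    intro τ hτ
    have : (fun x : Euc N => S.indicator (fun z => p z.1) (x, τ)) =
        {x | τ < q x}.indicator p := by
      funext x
      by_cases h : τ < q x
      · rw [indicator_of_mem (s := S) h, indicator_of_mem (s := {x | τ < q x}) h]
      · rw [indicator_of_notMem (s := S) h, indicator_of_notMem (s := {x | τ < q x}) h]
    rw [this, integral_indicator (measurableSet_lt measurable_const hqm)]
    obtain ⟨ρ, hρ, hae⟩ := exists_ball_ae_eq (S := {x : Euc N | τ < q x}) hR
      (fun x x' h hx' => lt_of_lt_of_le hx' (hqr x x' h)) (fun x hx => by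
        by_contra hcon
        have h0 := hqR x (not_le.1 hcon)
        have h3 : τ < q x := hx
        linarith [hτ.1])
    rw [setIntegral_congr_set hae]
    exact hpC ρ hρ
  refine (setIntegral_mono_on hInt.integral_prod_right (integrable_const C)
    measurableSet_Ioo h2).trans ?_
  simp [hK]

end BallAverage

/-! ### Comparison of ball averages -/

/-- The weight which is `1` above the level `t`, `θ` at the level `t` and `0` below. -/
def levelWeight (t θ s : ℝ) : ℝ := if t < s then 1 else if s = t then θ else 0

/-- Clamping to `[0, 1]`. -/
def clampUnit (s : ℝ) : ℝ := max 0 (min 1 s)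

/-- Continuous monotone approximations of `levelWeight t θ`. -/
def levelApprox (t θ : ℝ) (n : ℕ) (s : ℝ) : ℝ :=
  (1 - θ) * clampUnit ((n + 1 / t) * (s - t)) + θ * clampUnit (1 + (n + 1 / t) * (s - t))

section LevelWeight

variable {t θ : ℝ}

lemma measurable_levelWeight : Measurable (levelWeight t θ) :=
  Measurable.ite measurableSet_Ioi measurable_const
    (Measurable.ite (measurableSet_singleton t) measurable_const measurable_const)

lemma levelWeight_nonneg (hθ : θ ∈ Icc (0 : ℝ) 1) (s : ℝ) : 0 ≤ levelWeight t θ s := by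
  unfold levelWeight; split_ifs <;> linarith [hθ.1]

lemma levelWeight_le_one (hθ : θ ∈ Icc (0 : ℝ) 1) (s : ℝ) : levelWeight t θ s ≤ 1 := by
  unfold levelWeight; split_ifs <;> linarith [hθ.2]

lemma levelWeight_of_lt {s : ℝ} (h : t < s) : levelWeight t θ s = 1 := if_pos h

lemma levelWeight_of_gt {s : ℝ} (h : s < t) : levelWeight t θ s = 0 := by
  rw [levelWeight, if_neg h.not_gt, if_neg h.ne]

lemma levelWeight_self : levelWeight t θ t = θ := by simp [levelWeight]

lemma clampUnit_nonneg (s : ℝ) : 0 ≤ clampUnit s := le_max_left _ _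

lemma clampUnit_le_one (s : ℝ) : clampUnit s ≤ 1 := max_le zero_le_one (min_le_left _ _)

lemma clampUnit_of_nonpos {s : ℝ} (h : s ≤ 0) : clampUnit s = 0 :=
  max_eq_left ((min_le_right _ _).trans h)

lemma clampUnit_of_one_le {s : ℝ} (h : 1 ≤ s) : clampUnit s = 1 := by
  rw [clampUnit, min_eq_left h, max_eq_right zero_le_one]

lemma clampUnit_mono : Monotone clampUnit := fun _ _ h =>
  max_le_max le_rfl (min_le_min le_rfl h)

lemma continuous_levelApprox (n : ℕ) : Continuous (levelApprox t θ n) := by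
  unfold levelApprox clampUnit; fun_prop

lemma levelApprox_mono (ht : 0 < t) (hθ : θ ∈ Icc (0 : ℝ) 1) (n : ℕ) :
    Monotone (levelApprox t θ n) := by
  intro a b hab
  have h : ((n : ℝ) + 1 / t) * (a - t) ≤ (n + 1 / t) * (b - t) := by gcongr
  exact add_le_add
    (mul_le_mul_of_nonneg_left (clampUnit_mono h) (by linarith [hθ.2]))
    (mul_le_mul_of_nonneg_left (clampUnit_mono (by linarith)) hθ.1)

lemma levelApprox_zero (ht : 0 < t) (n : ℕ) : levelApprox t θ n 0 = 0 := by
  have h : ((n : ℝ) + 1 / t) * (0 - t) = -(n * t) - 1 := by field_simp; ring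
  have h0 : 0 ≤ (n : ℝ) * t := by positivity
  rw [levelApprox, h, clampUnit_of_nonpos (by linarith), clampUnit_of_nonpos (by linarith)]
  ring

lemma levelApprox_nonneg (hθ : θ ∈ Icc (0 : ℝ) 1) (n : ℕ) (s : ℝ) : 0 ≤ levelApprox t θ n s :=
  add_nonneg (mul_nonneg (by linarith [hθ.2]) (clampUnit_nonneg _))
    (mul_nonneg hθ.1 (clampUnit_nonneg _))

lemma levelApprox_le_one (hθ : θ ∈ Icc (0 : ℝ) 1) (n : ℕ) (s : ℝ) : levelApprox t θ n s ≤ 1 := by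
  have h1 := mul_le_mul_of_nonneg_left (clampUnit_le_one ((n + 1 / t) * (s - t)))
    (sub_nonneg.2 hθ.2)
  have h2 := mul_le_mul_of_nonneg_left (clampUnit_le_one (1 + (n + 1 / t) * (s - t))) hθ.1
  unfold levelApprox
  linarith

lemma tendsto_levelApprox (ht : 0 < t) (s : ℝ) :
    Tendsto (fun n : ℕ => levelApprox t θ n s) atTop (nhds (levelWeight t θ s)) := by
  have hp : 0 < 1 / t := by positivity
  refine tendsto_const_nhds.congr' ?_
  rcases lt_trichotomy s t with h | rfl | h
  · obtain ⟨m, hm⟩ := exists_nat_gt (1 / (t - s))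
    filter_upwards [eventually_ge_atTop m] with n hn
    have hn' : (m : ℝ) ≤ n := by exact_mod_cast hn
    have h1 : 1 < (n : ℝ) * (t - s) := by
      rw [div_lt_iff₀ (by linarith)] at hm
      nlinarith
    have h2 := mul_pos hp (sub_pos.2 h)
    have h3 : ((n : ℝ) + 1 / t) * (s - t) ≤ -1 := by nlinarith
    rw [levelWeight_of_gt h, levelApprox, clampUnit_of_nonpos (by linarith),
      clampUnit_of_nonpos (by linarith)]
    ring
  · refine Eventually.of_forall fun n => ?_
    change levelWeight s θ s = levelApprox s θ n s
    rw [levelWeight_self, levelApprox, sub_self, mul_zero, clampUnit_of_nonpos le_rfl,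
      clampUnit_of_one_le (by linarith)]
    ring
  · obtain ⟨m, hm⟩ := exists_nat_gt (1 / (s - t))
    filter_upwards [eventually_ge_atTop m] with n hn
    have hn' : (m : ℝ) ≤ n := by exact_mod_cast hn
    have h1 : 1 < (n : ℝ) * (s - t) := by
      rw [div_lt_iff₀ (by linarith)] at hm
      nlinarith
    have h2 := mul_pos hp (sub_pos.2 h)
    have h3 : 1 ≤ ((n : ℝ) + 1 / t) * (s - t) := by nlinarith
    rw [levelWeight_of_lt h, levelApprox, clampUnit_of_one_le h3,
      clampUnit_of_one_le (by linarith)]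
    ring

variable {N : ℕ} {u : Euc N → ℝ} {R : ℝ}

lemma integrable_indicator_closedBall (R : ℝ) :
    Integrable ((Metric.closedBall (0 : Euc N) R).indicator (1 : Euc N → ℝ)) :=
  (integrable_indicator_iff Metric.isClosed_closedBall.measurableSet).2
    (integrableOn_const measure_closedBall_lt_top.ne)

lemma le_indicator_closedBall {G : ℝ → ℝ} (hG1 : ∀ s, G s ≤ 1) (h0 : G 0 = 0)
    (hs : ∀ x, R < ‖x‖ → u x = 0) (x : Euc N) :
    G (u x) ≤ (Metric.closedBall (0 : Euc N) R).indicator 1 x := by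
  by_cases hx : ‖x‖ ≤ R
  · rw [indicator_of_mem (mem_closedBall_zero_iff.2 hx)]; exact hG1 _
  · rw [indicator_of_notMem (by rwa [mem_closedBall_zero_iff]), hs x (not_le.1 hx), h0]

lemma integrable_levelWeight_comp (ht : 0 < t) (hθ : θ ∈ Icc (0 : ℝ) 1) (hu : Measurable u)
    (hs : ∀ x, R < ‖x‖ → u x = 0) : Integrable fun x => levelWeight t θ (u x) := by
  refine (integrable_indicator_closedBall R).mono'
    (measurable_levelWeight.comp hu).aestronglyMeasurable (Eventually.of_forall fun x => ?_)
  rw [Real.norm_of_nonneg (levelWeight_nonneg hθ _)]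
  exact le_indicator_closedBall (levelWeight_le_one hθ) (levelWeight_of_gt ht) hs x

lemma tendsto_integral_levelApprox (ht : 0 < t) (hθ : θ ∈ Icc (0 : ℝ) 1) (hu : Measurable u)
    (hs : ∀ x, R < ‖x‖ → u x = 0) :
    Tendsto (fun n : ℕ => ∫ x, levelApprox t θ n (u x)) atTop
      (nhds (∫ x, levelWeight t θ (u x))) := by
  refine tendsto_integral_of_dominated_convergence _
    (fun n => ((continuous_levelApprox n).measurable.comp hu).aestronglyMeasurable)
    (integrable_indicator_closedBall R) (fun n => Eventually.of_forall fun x => ?_)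
    (Eventually.of_forall fun x => tendsto_levelApprox ht _)
  rw [Real.norm_of_nonneg (levelApprox_nonneg hθ _ _)]
  exact le_indicator_closedBall (levelApprox_le_one hθ n) (levelApprox_zero ht n) hs x

lemma tendsto_kernel_levelApprox (ht : 0 < t) (hθ : θ ∈ Icc (0 : ℝ) 1) (hu : Measurable u)
    (hs : ∀ x, R < ‖x‖ → u x = 0) (hi : Integrable u) (δ : ℝ) :
    Tendsto (fun n : ℕ => ∫ p : Euc N × Euc N,
        ballProfile δ (dist p.1 p.2) * (levelApprox t θ n (u p.1) * u p.2)) atTop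
      (nhds (∫ p : Euc N × Euc N,
        ballProfile δ (dist p.1 p.2) * (levelWeight t θ (u p.1) * u p.2))) := by
  have hb := (integrable_ballProfile_mul_mul δ (integrable_indicator_closedBall (N := N) R) hi).norm
  refine tendsto_integral_of_dominated_convergence _ (fun n => ?_) hb
    (fun n => Eventually.of_forall fun p => ?_) (Eventually.of_forall fun p => ?_)
  · exact (((measurable_ballProfile δ).comp (by fun_prop)).mul
      (((continuous_levelApprox n).measurable.comp (hu.comp measurable_fst)).mul
        (hu.comp measurable_snd))).aestronglyMeasurable
  · rw [norm_mul, norm_mul, norm_mul, norm_mul]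
    refine mul_le_mul_of_nonneg_left (mul_le_mul_of_nonneg_right ?_ (norm_nonneg _)) (norm_nonneg _)
    rw [Real.norm_of_nonneg (levelApprox_nonneg hθ _ _)]
    exact (le_indicator_closedBall (levelApprox_le_one hθ n) (levelApprox_zero ht n) hs
      p.1).trans (le_abs_self _)
  · exact ((tendsto_levelApprox ht _).mul_const _).const_mul _

end LevelWeight

section BallIndicator

variable {N : ℕ}

/-- The indicator function of the centred ball of radius `r`. -/
def ballInd (r : ℝ) : Euc N → ℝ := (Metric.ball (0 : Euc N) r).indicator 1

lemma ballInd_nonneg (r : ℝ) (x : Euc N) : 0 ≤ ballInd r x :=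
  indicator_nonneg (fun _ _ => zero_le_one) _

lemma ballInd_le_one (r : ℝ) (x : Euc N) : ballInd r x ≤ 1 :=
  indicator_le_self' (fun _ _ => zero_le_one) _

lemma ballInd_of_lt {r : ℝ} {x : Euc N} (h : ‖x‖ < r) : ballInd r x = 1 :=
  indicator_of_mem (mem_ball_zero_iff.2 h) _

lemma ballInd_of_le {r : ℝ} {x : Euc N} (h : r ≤ ‖x‖) : ballInd r x = 0 :=
  indicator_of_notMem (by rw [mem_ball_zero_iff]; exact h.not_gt) _

lemma ballInd_radial (r : ℝ) (x x' : Euc N) (h : ‖x‖ ≤ ‖x'‖) : ballInd r x' ≤ ballInd r x := by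
  rcases lt_or_ge ‖x‖ r with hx | hx
  · rw [ballInd_of_lt hx]; exact ballInd_le_one _ _
  · rw [ballInd_of_le hx, ballInd_of_le (hx.trans h)]

lemma integrable_ballInd (r : ℝ) : Integrable (ballInd r : Euc N → ℝ) :=
  (integrable_indicator_iff Metric.isOpen_ball.measurableSet).2
    (integrableOn_const measure_ball_lt_top.ne)

lemma integral_ballInd [NeZero N] {r : ℝ} (hr : 0 ≤ r) :
    ∫ x : Euc N, ballInd r x = omegaN N * r ^ N := by
  simp only [ballInd]
  rw [integral_indicator_one Metric.isOpen_ball.measurableSet, Measure.real,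
    volume_ball_zero hr, ENNReal.toReal_ofReal (mul_nonneg omegaN_pos.le (pow_nonneg hr _))]

lemma setIntegral_ball_eq (r : ℝ) (φ : Euc N → ℝ) :
    ∫ x in Metric.ball (0 : Euc N) r, φ x = ∫ x, ballInd r x * φ x := by
  rw [← integral_indicator Metric.isOpen_ball.measurableSet]
  congr 1
  funext x
  by_cases hx : x ∈ Metric.ball (0 : Euc N) r <;> simp [ballInd, hx]

lemma integral_ball_abs_le_conc [NeZero N] {h : Euc N → ℝ} (hh : Integrable h) {r : ℝ}
    (hr : 0 ≤ r) : ∫ x in Metric.ball (0 : Euc N) r, |h x| ≤ conc h (omegaN N * r ^ N) := by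
  rw [setIntegral_ball_eq]
  exact le_conc hh (integrable_ballInd r) (ballInd_nonneg r) (ballInd_le_one r)
    (integral_ballInd hr).le

end BallIndicator

/-- Ball average form of the comparison at a maximum point of the difference of concentration
functions: averaging removes less from the function that is more concentrated. -/
theorem integral_levelWeight_ballInt_sub_le {N : ℕ} [NeZero N] {h V : Euc N → ℝ}
    (hc : Continuous h) (h0 : ∀ x, 0 ≤ h x) {R' : ℝ} (hs : ∀ x, R' < ‖x‖ → h x = 0)
    {t θ : ℝ} (ht : 0 < t) (hθ : θ ∈ Icc (0 : ℝ) 1) {r R δ ε : ℝ} (hr : 0 ≤ r) (hδ : 0 ≤ δ)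
    (hrR : r + δ ≤ R) (hε : 0 ≤ ε) (hm : ∫ x, levelWeight t θ (h x) = omegaN N * r ^ N)
    (hV : Integrable V)
    (hmax : ∀ ρ ∈ Icc 0 R, conc h (omegaN N * ρ ^ N) - (∫ x in Metric.ball (0 : Euc N) ρ, V x) -
        ε * (omegaN N * ρ ^ N) ≤ (∫ x, levelWeight t θ (h x) * h x) -
          (∫ x in Metric.ball (0 : Euc N) r, V x) - ε * (omegaN N * r ^ N)) :
    (∫ x, levelWeight t θ (h x) * ballInt δ h x) -
        (∫ x in Metric.ball (0 : Euc N) r, ballInt δ V x) ≤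
      omegaN N * δ ^ N * ((∫ x, levelWeight t θ (h x) * h x) -
        ∫ x in Metric.ball (0 : Euc N) r, V x) := by
  obtain ⟨F, hFc, hF0, hFs, hFr, hFeq, hFk⟩ := exists_symmetrization hc h0 hs
  have hhi : Integrable h := hc.integrable_of_hasCompactSupport (hasCompactSupport_of_norm hs)
  have hFi : Integrable F := hFc.integrable_of_hasCompactSupport (hasCompactSupport_of_norm hFs)
  have hω := omegaN_pos (N := N)
  have hR : 0 ≤ R := by linarith
  set K := omegaN N * δ ^ N with hK
  have hK0 : 0 ≤ K := mul_nonneg hω.le (pow_nonneg hδ _)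
  have hGh := integrable_levelWeight_comp ht hθ hc.measurable hs
  have hGF := integrable_levelWeight_comp ht hθ hFc.measurable hFs
  have hGFm : ∫ x, levelWeight t θ (F x) = omegaN N * r ^ N := by
    rw [← hm]
    refine tendsto_nhds_unique (tendsto_integral_levelApprox ht hθ hFc.measurable hFs) ?_
    refine (tendsto_integral_levelApprox ht hθ hc.measurable hs).congr fun n => ?_
    exact (hFeq _ (continuous_levelApprox n) (levelApprox_zero ht n)).symm
  have hlevel : ∫ x, levelWeight t θ (h x) * ballInt δ h x ≤
      ∫ x, levelWeight t θ (F x) * ballInt δ F x := by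
    rw [← integral_kernel_eq δ hGh hhi, ← integral_kernel_eq δ hGF hFi]
    exact le_of_tendsto_of_tendsto' (tendsto_kernel_levelApprox ht hθ hc.measurable hs hhi δ)
      (tendsto_kernel_levelApprox ht hθ hFc.measurable hFs hFi δ) fun n =>
        hFk _ δ (continuous_levelApprox n) (levelApprox_mono ht hθ n) (levelApprox_zero ht n)
  have hriesz : ∫ x, levelWeight t θ (F x) * ballInt δ F x ≤ ∫ x, ballInd r x * ballInt δ F x :=
    integral_mul_le_of_radial (integrable_ballInt hδ hFi) (ballInt_radial δ hFi hFr) hGF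
      (fun x => levelWeight_nonneg hθ _) (fun x => levelWeight_le_one hθ _) hr hGFm
  set q := ballInt δ (ballInd r : Euc N → ℝ) with hq
  have hq0 : ∀ x, 0 ≤ q x := fun x =>
    integral_nonneg fun y => mul_nonneg (ballProfile_nonneg _ _) (ballInd_nonneg r y)
  have hqK : ∀ x, q x ≤ K := by
    intro x
    rw [hK, ← integral_ballProfile hδ x]
    refine integral_mono (integrable_ballProfile_mul δ x (integrable_ballInd r))
      (integrable_ballProfile δ x) fun y => ?_
    exact mul_le_of_le_one_right (ballProfile_nonneg _ _) (ballInd_le_one r y)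
  have hqR : ∀ x, R < ‖x‖ → q x = 0 := by
    intro x hx
    refine integral_eq_zero_of_ae (Eventually.of_forall fun y => ?_)
    by_cases hd : dist x y ≤ δ
    · have : r ≤ ‖y‖ := by
        have := norm_sub_norm_le x y
        rw [← dist_eq_norm] at this
        linarith
      simp [ballInd_of_le this]
    · simp [ballProfile, hd]
  have hqi : Integrable q := integrable_ballInt hδ (integrable_ballInd r)
  set C := (∫ x, levelWeight t θ (h x) * h x) - (∫ x in Metric.ball (0 : Euc N) r, V x) -
    ε * (omegaN N * r ^ N) with hC
  have hconc : ∀ s, conc F s = conc h s := by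
    intro s
    unfold conc
    congr 1
    funext τ
    congr 1
    have := hFeq (fun s => max (s - τ) 0) (by fun_prop) (by simp)
    simpa only [abs_of_nonneg (hF0 _), abs_of_nonneg (h0 _)] using this
  have hFV : Integrable fun x => F x - V x := hFi.sub hV
  have hp : Integrable fun x => F x - V x - ε * ballInd R x :=
    hFV.sub ((integrable_ballInd R).const_mul ε)
  have hradial : ∫ x, q x * (F x - V x - ε * ballInd R x) ≤ K * C := by
    refine integral_radial_mul_le hR hK0 hp (fun ρ hρ => ?_)
      (stronglyMeasurable_ballInt δ (integrable_ballInd r).aestronglyMeasurable).measurable hq0 hqK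
      (ballInt_radial δ (integrable_ballInd r) (ballInd_radial r)) hqR
    have h1 := integral_ball_abs_le_conc hFi hρ.1
    simp only [abs_of_nonneg (hF0 _), hconc] at h1
    have h2 : ∫ x in Metric.ball (0 : Euc N) ρ, ε * ballInd R x = ε * (omegaN N * ρ ^ N) := by
      rw [← integral_ballInd hρ.1, integral_const_mul, setIntegral_ball_eq]
      congr 2
      funext x
      rcases lt_or_ge ‖x‖ ρ with hx | hx
      · rw [ballInd_of_lt hx, ballInd_of_lt (hx.trans_le hρ.2), one_mul]
      · rw [ballInd_of_le hx, zero_mul]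
    rw [integral_sub hFV.integrableOn ((integrable_ballInd R).const_mul ε).integrableOn,
      integral_sub hFi.integrableOn hV.integrableOn, h2]
    linarith [hmax ρ hρ]
  have hqF : ∫ x, ballInd r x * ballInt δ F x = ∫ x, q x * F x :=
    integral_mul_ballInt_comm δ (integrable_ballInd r) hFi
  have hqV : ∫ x, ballInd r x * ballInt δ V x = ∫ x, q x * V x :=
    integral_mul_ballInt_comm δ (integrable_ballInd r) hV
  have hqmul : ∀ φ : Euc N → ℝ, Integrable φ → Integrable fun x => q x * φ x := fun φ hφ =>
    hφ.bdd_mul hqi.aestronglyMeasurable (c := K) (Eventually.of_forall fun x => by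
      rw [Real.norm_of_nonneg (hq0 x)]; exact hqK x)
  have hqD : ∫ x, q x * (ε * ballInd R x) ≤ ε * (K * (omegaN N * r ^ N)) := by
    rw [← integral_ballInd hr, hK, ← integral_ballInt hδ (integrable_ballInd r),
      ← integral_const_mul]
    refine integral_mono (hqmul _ ((integrable_ballInd R).const_mul ε)) (hqi.const_mul ε)
      fun x => ?_
    dsimp only
    nlinarith [mul_nonneg hε (hq0 x), ballInd_le_one R x]
  have hsplit : ∫ x, q x * (F x - V x - ε * ballInd R x) =
      (∫ x, q x * F x) - (∫ x, q x * V x) - ∫ x, q x * (ε * ballInd R x) := by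
    have hqFV : Integrable fun x => q x * F x - q x * V x := (hqmul _ hFi).sub (hqmul _ hV)
    rw [← integral_sub (hqmul _ hFi) (hqmul _ hV), ← integral_sub hqFV
      (hqmul _ ((integrable_ballInd R).const_mul ε))]
    congr 1
    funext x
    ring
  rw [hsplit] at hradial
  rw [setIntegral_ball_eq r (ballInt δ V), hqV]
  have : K * C = K * ((∫ x, levelWeight t θ (h x) * h x) -
      ∫ x in Metric.ball (0 : Euc N) r, V x) - ε * (K * (omegaN N * r ^ N)) := by
    rw [hC]; ring
  linarith

/-! ### Ball averages of twice differentiable functions -/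

/-- The second moment of the closed ball of radius `δ`. -/
def ballMoment (N : ℕ) (δ : ℝ) : ℝ := ∫ z : Euc N, ballProfile δ ‖z‖ * ‖z‖ ^ 2

/-- The trace of the second derivative. -/
def lap {N : ℕ} (u : Euc N → ℝ) (x : Euc N) : ℝ :=
  ∑ i : Fin N, fderiv ℝ (fderiv ℝ u) x (EuclideanSpace.single i 1) (EuclideanSpace.single i 1)

section Moments

variable {N : ℕ}

lemma integrable_ballProfile_mul_continuous {φ : Euc N → ℝ} (hφ : Continuous φ) (δ : ℝ) :
    Integrable fun z => ballProfile δ ‖z‖ * φ z := by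
  have h : (fun z => ballProfile δ ‖z‖ * φ z) = (Metric.closedBall (0 : Euc N) δ).indicator φ := by
    funext z
    by_cases hz : ‖z‖ ≤ δ
    · rw [indicator_of_mem (mem_closedBall_zero_iff.2 hz), ballProfile, if_pos hz, one_mul]
    · rw [indicator_of_notMem (by rwa [mem_closedBall_zero_iff]), ballProfile, if_neg hz, zero_mul]
  rw [h, integrable_indicator_iff Metric.isClosed_closedBall.measurableSet]
  exact hφ.continuousOn.integrableOn_compact (isCompact_closedBall 0 δ)

lemma integral_ballProfile_mul_odd {φ : Euc N → ℝ} (h : ∀ z, φ (-z) = -φ z) (δ : ℝ) :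
    ∫ z : Euc N, ballProfile δ ‖z‖ * φ z = 0 := by
  have h1 : ∫ z : Euc N, ballProfile δ ‖z‖ * φ z = ∫ z : Euc N, ballProfile δ ‖-z‖ * φ (-z) :=
    (integral_neg_eq_self (fun z => ballProfile δ ‖z‖ * φ z) volume).symm
  simp only [norm_neg, h, mul_neg, integral_neg] at h1
  linarith

lemma norm_hyperRefl_zero {a : Euc N} (ha : ‖a‖ = 1) (z : Euc N) : ‖hyperRefl a 0 z‖ = ‖z‖ := by
  have := norm_hyperRefl_sq (c := 0) ha z
  refine (pow_left_inj₀ (norm_nonneg _) (norm_nonneg _) two_ne_zero).1 ?_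
  linarith

lemma integral_ballProfile_hyperRefl {a : Euc N} (ha : ‖a‖ = 1) (δ : ℝ) (φ : Euc N → ℝ) :
    ∫ z : Euc N, ballProfile δ ‖z‖ * φ (hyperRefl a 0 z) =
      ∫ z : Euc N, ballProfile δ ‖z‖ * φ z := by
  rw [← integral_comp_hyperRefl ha (c := 0) fun z => ballProfile δ ‖z‖ * φ z]
  simp only [norm_hyperRefl_zero ha]

lemma integral_ballProfile_mul_coord {i j : Fin N} (hij : i ≠ j) (δ : ℝ) :
    ∫ z : Euc N, ballProfile δ ‖z‖ * (z i * z j) = 0 := by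
  have ha : ‖(EuclideanSpace.single i (1 : ℝ) : Euc N)‖ = 1 := by simp
  have h := integral_ballProfile_hyperRefl ha δ fun z => z i * z j
  have h2 : ∀ z : Euc N, hyperRefl (EuclideanSpace.single i (1 : ℝ)) 0 z i *
      hyperRefl (EuclideanSpace.single i (1 : ℝ)) 0 z j = -(z i * z j) := by
    intro z
    simp [hyperRefl, hij.symm, EuclideanSpace.inner_single_left]
    ring
  simp only [h2, mul_neg, integral_neg] at h
  linarith

lemma integral_ballProfile_mul_coord_sq (i j : Fin N) (δ : ℝ) :
    ∫ z : Euc N, ballProfile δ ‖z‖ * (z i * z i) = ∫ z : Euc N, ballProfile δ ‖z‖ * (z j * z j) := by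
  let e : Euc N ≃ₗᵢ[ℝ] Euc N := LinearIsometryEquiv.piLpCongrLeft 2 ℝ ℝ (Equiv.swap i j)
  rw [← e.measurePreserving.integral_comp e.toHomeomorph.measurableEmbedding]
  refine integral_congr_ae (Eventually.of_forall fun z => ?_)
  have : e z i = z j := by
    simp [e, LinearIsometryEquiv.piLpCongrLeft_apply]
  simp only [e.norm_map, this]

lemma ballMoment_eq [NeZero N] (i : Fin N) (δ : ℝ) :
    ∫ z : Euc N, ballProfile δ ‖z‖ * (z i * z i) = ballMoment N δ / N := by
  have h : ballMoment N δ = ∑ j : Fin N, ∫ z : Euc N, ballProfile δ ‖z‖ * (z j * z j) := by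
    rw [← integral_finsetSum _ fun j _ =>
      integrable_ballProfile_mul_continuous (φ := fun z => z j * z j) (by fun_prop) δ]
    refine integral_congr_ae (Eventually.of_forall fun z => ?_)
    simp only
    rw [EuclideanSpace.real_norm_sq_eq, Finset.mul_sum]
    simp only [sq]
  rw [h, Finset.sum_congr rfl fun j _ => integral_ballProfile_mul_coord_sq j i δ]
  have : (N : ℝ) ≠ 0 := Nat.cast_ne_zero.2 (NeZero.ne N)
  simp
  field_simp

lemma ballMoment_pos [NeZero N] {δ : ℝ} (hδ : 0 < δ) : 0 < ballMoment N δ := by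
  have hi := integrable_ballProfile_mul_continuous (N := N) (φ := fun z => ‖z‖ ^ 2) (by fun_prop) δ
  refine (integral_pos_iff_support_of_nonneg
    (fun z => mul_nonneg (ballProfile_nonneg _ _) (sq_nonneg _)) hi).2 ?_
  have hsub : Metric.ball (0 : Euc N) δ \ {0} ⊆
      Function.support fun z : Euc N => ballProfile δ ‖z‖ * ‖z‖ ^ 2 := by
    intro z hz
    have h1 : ‖z‖ ≤ δ := (mem_ball_zero_iff.1 hz.1).le
    have h2 : z ≠ 0 := hz.2
    rw [Function.mem_support, ballProfile, if_pos h1, one_mul]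
    exact pow_ne_zero _ (norm_ne_zero_iff.2 h2)
  refine lt_of_lt_of_le ?_ (measure_mono hsub)
  rw [measure_sdiff_null (by simp)]
  exact Metric.measure_ball_pos _ _ hδ

lemma integral_ballProfile_bilin [NeZero N] (b : Euc N →L[ℝ] Euc N →L[ℝ] ℝ) (δ : ℝ) :
    ∫ z : Euc N, ballProfile δ ‖z‖ * b z z =
      (∑ i, b (EuclideanSpace.single i 1) (EuclideanSpace.single i 1)) * (ballMoment N δ / N) := by
  have hz : ∀ z : Euc N, z = ∑ i, z i • (EuclideanSpace.single i (1 : ℝ) : Euc N) := by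
    intro z
    ext j
    simp [Finset.sum_apply, Pi.single_apply]
  have hb : ∀ z : Euc N, b z z = ∑ i, ∑ j, (z i * z j) *
      b (EuclideanSpace.single i 1) (EuclideanSpace.single j 1) := by
    intro z
    conv_lhs => rw [hz z]
    simp only [map_sum, map_smul, sum_apply, smul_apply, smul_eq_mul, Finset.mul_sum]
    exact Finset.sum_comm.trans (Finset.sum_congr rfl fun i _ => Finset.sum_congr rfl fun j _ => by
      ring)
  have hInt : ∀ i j : Fin N, Integrable fun z : Euc N => ballProfile δ ‖z‖ * ((z i * z j) *
      b (EuclideanSpace.single i 1) (EuclideanSpace.single j 1)) := fun i j =>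
    integrable_ballProfile_mul_continuous (by fun_prop) δ
  have hI : ∀ i j : Fin N, ∫ z : Euc N, ballProfile δ ‖z‖ * ((z i * z j) *
      b (EuclideanSpace.single i 1) (EuclideanSpace.single j 1)) =
      (∫ z : Euc N, ballProfile δ ‖z‖ * (z i * z j)) *
        b (EuclideanSpace.single i 1) (EuclideanSpace.single j 1) := by
    intro i j
    rw [← integral_mul_const]
    simp only [mul_assoc]
  have hbI : ∫ z : Euc N, ballProfile δ ‖z‖ * b z z = ∫ z : Euc N, ∑ i, ∑ j, ballProfile δ ‖z‖ *
      ((z i * z j) * b (EuclideanSpace.single i 1) (EuclideanSpace.single j 1)) := by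
    refine integral_congr_ae (Eventually.of_forall fun z => ?_)
    dsimp only
    rw [hb]
    simp only [Finset.mul_sum]
  rw [hbI, integral_finsetSum _ fun i _ => integrable_finsetSum _ fun j _ => hInt i j,
    Finset.sum_mul]
  refine Finset.sum_congr rfl fun i _ => ?_
  rw [integral_finsetSum _ fun j _ => hInt i j, Finset.sum_eq_single i]
  · rw [hI, ballMoment_eq, mul_comm]
  · intro j _ hj
    rw [hI, integral_ballProfile_mul_coord hj.symm, zero_mul]
  · simp

end Moments

section TaylorExpansion

lemma abs_taylor_two_sub_le {E : Type*} [NormedAddCommGroup E] [NormedSpace ℝ E] {u : E → ℝ}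
    {x z : E} {ρ ε : ℝ} (hu : ∀ y ∈ Metric.ball x ρ, ContDiffAt ℝ 2 u y)
    (hε : ∀ y ∈ Metric.ball x ρ, ‖fderiv ℝ (fderiv ℝ u) y - fderiv ℝ (fderiv ℝ u) x‖ ≤ ε)
    (hz : ‖z‖ < ρ) :
    |u (x + z) - u x - fderiv ℝ u x z - fderiv ℝ (fderiv ℝ u) x z z / 2| ≤ ε * ‖z‖ ^ 2 := by
  have hmem : ∀ t ∈ Icc (0 : ℝ) 1, x + t • z ∈ Metric.ball x ρ := by
    intro t ht
    rw [mem_ball_iff_norm, add_sub_cancel_left, norm_smul, Real.norm_of_nonneg ht.1]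
    exact (mul_le_of_le_one_left (norm_nonneg _) ht.2).trans_lt hz
  have hline : ∀ t : ℝ, HasDerivAt (fun t : ℝ => x + t • z) z t := by
    intro t
    simpa using ((hasDerivAt_id t).smul_const z).const_add x
  have h1 : ∀ t ∈ Icc (0 : ℝ) 1,
      HasDerivAt (fun t : ℝ => u (x + t • z)) (fderiv ℝ u (x + t • z) z) t := fun t ht =>
    ((hu _ (hmem t ht)).differentiableAt two_ne_zero).hasFDerivAt.comp_hasDerivAt t (hline t)
  have h2 : ∀ t ∈ Icc (0 : ℝ) 1, HasDerivAt (fun t : ℝ => fderiv ℝ u (x + t • z) z)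
      (fderiv ℝ (fderiv ℝ u) (x + t • z) z z) t := by
    intro t ht
    have hd : DifferentiableAt ℝ (fderiv ℝ u) (x + t • z) :=
      ((hu _ (hmem t ht)).fderiv_right (m := 1) (by norm_num)).differentiableAt one_ne_zero
    have := hd.hasFDerivAt.comp_hasDerivAt t (hline t)
    exact (this.clm_apply (hasDerivAt_const t z)).congr_deriv (by simp)
  set c := fderiv ℝ (fderiv ℝ u) x z z with hc
  have hx0 : (0 : ℝ) ∈ Icc (0 : ℝ) 1 := by simp
  have hd2 : ∀ t ∈ Icc (0 : ℝ) 1, |fderiv ℝ u (x + t • z) z - fderiv ℝ u x z - t * c| ≤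
      ε * ‖z‖ ^ 2 := by
    intro t ht
    have hD : ∀ t ∈ Icc (0 : ℝ) 1, HasDerivWithinAt
        (fun t : ℝ => fderiv ℝ u (x + t • z) z - t * c)
        (fderiv ℝ (fderiv ℝ u) (x + t • z) z z - c) (Icc 0 1) t := fun t ht => by
      exact (((h2 t ht).sub ((hasDerivAt_id t).mul_const c)).congr_deriv
        (by simp)).hasDerivWithinAt
    have hB : ∀ t ∈ Icc (0 : ℝ) 1, ‖fderiv ℝ (fderiv ℝ u) (x + t • z) z z - c‖ ≤ ε * ‖z‖ ^ 2 := by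
      intro t ht
      have : fderiv ℝ (fderiv ℝ u) (x + t • z) z z - c =
          (fderiv ℝ (fderiv ℝ u) (x + t • z) - fderiv ℝ (fderiv ℝ u) x) z z := by simp [hc]
      rw [this]
      refine ((_ : E →L[ℝ] ℝ).le_opNorm z).trans ?_
      rw [sq, ← mul_assoc]
      refine mul_le_mul_of_nonneg_right ?_ (norm_nonneg _)
      exact (ContinuousLinearMap.le_opNorm _ _).trans
        (mul_le_mul_of_nonneg_right (hε _ (hmem t ht)) (norm_nonneg _))
    have := (convex_Icc (0 : ℝ) 1).norm_image_sub_le_of_norm_hasDerivWithin_le hD hB hx0 ht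
    simp only [zero_smul, add_zero, zero_mul, sub_zero, Real.norm_eq_abs, abs_of_nonneg ht.1] at this
    have h0 : 0 ≤ ε * ‖z‖ ^ 2 := (norm_nonneg _).trans (hB 0 hx0)
    calc _ = |fderiv ℝ u (x + t • z) z - t * c - fderiv ℝ u x z| := by congr 1; ring
      _ ≤ ε * ‖z‖ ^ 2 * t := this
      _ ≤ _ := mul_le_of_le_one_right h0 ht.2
  have hD : ∀ t ∈ Icc (0 : ℝ) 1, HasDerivWithinAt
      (fun t : ℝ => u (x + t • z) - t * fderiv ℝ u x z - t ^ 2 / 2 * c)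
      (fderiv ℝ u (x + t • z) z - fderiv ℝ u x z - t * c) (Icc 0 1) t := fun t ht => by
    have h3 : HasDerivAt (fun t : ℝ => t ^ 2 / 2 * c) (t * c) t := by
      have := (((hasDerivAt_id t).pow 2).div_const 2).mul_const c
      exact this.congr_deriv (by simp)
    exact ((((h1 t ht).sub ((hasDerivAt_id t).mul_const (fderiv ℝ u x z))).sub h3).congr_deriv
      (by simp)).hasDerivWithinAt
  have := (convex_Icc (0 : ℝ) 1).norm_image_sub_le_of_norm_hasDerivWithin_le hD hd2 hx0
    (y := 1) (by simp)
  simp only [one_smul, zero_smul, add_zero, Real.norm_eq_abs, sub_zero, abs_one, mul_one] at this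
  convert this using 2
  ring

variable {N : ℕ}

lemma ballInt_eq_translate (δ : ℝ) (u : Euc N → ℝ) (x : Euc N) :
    ballInt δ u x = ∫ z, ballProfile δ ‖z‖ * u (x + z) := by
  rw [ballInt, ← integral_add_left_eq_self _ x]
  simp [dist_eq_norm]

lemma abs_ballInt_sub_le [NeZero N] {u : Euc N → ℝ} {x : Euc N} {ρ ε δ : ℝ}
    (hu : ∀ y ∈ Metric.ball x ρ, ContDiffAt ℝ 2 u y)
    (hε : ∀ y ∈ Metric.ball x ρ, ‖fderiv ℝ (fderiv ℝ u) y - fderiv ℝ (fderiv ℝ u) x‖ ≤ ε)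
    (hδ : 0 < δ) (hδρ : δ < ρ) (hi : Integrable u) :
    |ballInt δ u x - omegaN N * δ ^ N * u x - lap u x * (ballMoment N δ / (2 * N))| ≤
      ε * ballMoment N δ := by
  have hiu : Integrable fun z => ballProfile δ ‖z‖ * u (x + z) := by
    have := (integrable_ballProfile_mul δ x hi).comp_add_left x
    simpa [dist_eq_norm] using this
  have hi0 : Integrable fun z : Euc N => ballProfile δ ‖z‖ * u x :=
    integrable_ballProfile_mul_continuous continuous_const δ
  have hi1 : Integrable fun z : Euc N => ballProfile δ ‖z‖ * fderiv ℝ u x z :=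
    integrable_ballProfile_mul_continuous (by fun_prop) δ
  have hi2 : Integrable fun z : Euc N => ballProfile δ ‖z‖ * fderiv ℝ (fderiv ℝ u) x z z :=
    integrable_ballProfile_mul_continuous (by fun_prop) δ
  have hi2' : Integrable fun z : Euc N => ballProfile δ ‖z‖ * fderiv ℝ (fderiv ℝ u) x z z / 2 :=
    hi2.div_const 2
  have hi3 : Integrable fun z : Euc N => ballProfile δ ‖z‖ * ‖z‖ ^ 2 :=
    integrable_ballProfile_mul_continuous (by fun_prop) δ
  have e0 : ∫ z : Euc N, ballProfile δ ‖z‖ * u x = omegaN N * δ ^ N * u x := by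
    rw [integral_mul_const, ← integral_ballProfile hδ.le (0 : Euc N)]
    simp
  have e1 : ∫ z : Euc N, ballProfile δ ‖z‖ * fderiv ℝ u x z = 0 :=
    integral_ballProfile_mul_odd (by simp) δ
  have e2 : ∫ z : Euc N, ballProfile δ ‖z‖ * fderiv ℝ (fderiv ℝ u) x z z / 2 =
      lap u x * (ballMoment N δ / (2 * N)) := by
    rw [integral_div, integral_ballProfile_bilin, lap]
    ring
  have ha : Integrable fun z => ballProfile δ ‖z‖ * u (x + z) - ballProfile δ ‖z‖ * u x :=
    hiu.sub hi0
  have hb : Integrable fun z => ballProfile δ ‖z‖ * u (x + z) - ballProfile δ ‖z‖ * u x -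
      ballProfile δ ‖z‖ * fderiv ℝ u x z := ha.sub hi1
  have key : ballInt δ u x - omegaN N * δ ^ N * u x - lap u x * (ballMoment N δ / (2 * N)) =
      ∫ z, (ballProfile δ ‖z‖ * u (x + z) - ballProfile δ ‖z‖ * u x -
      ballProfile δ ‖z‖ * fderiv ℝ u x z - ballProfile δ ‖z‖ * fderiv ℝ (fderiv ℝ u) x z z / 2) := by
    rw [integral_sub hb hi2', integral_sub ha hi1, integral_sub hiu hi0, e0, e1, e2, sub_zero,
      ballInt_eq_translate]
  rw [key, ballMoment, ← integral_const_mul, ← Real.norm_eq_abs]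
  refine norm_integral_le_of_norm_le (hi3.const_mul ε) (Eventually.of_forall fun z => ?_)
  by_cases hz : ‖z‖ ≤ δ
  · simpa [ballProfile, hz] using abs_taylor_two_sub_le hu hε (hz.trans_lt hδρ)
  · simp [ballProfile, hz]

lemma exists_norm_sub_le_of_isCompact {X F : Type*} [PseudoMetricSpace X] [SeminormedAddCommGroup F]
    {G : X → F} {K : Set X} (hK : IsCompact K) (hc : ∀ x ∈ K, ContinuousAt G x) {ε : ℝ}
    (hε : 0 < ε) : ∃ ρ > 0, ∀ x ∈ K, ∀ y, dist y x < ρ → ‖G y - G x‖ ≤ ε := by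
  have h1 := hK.uniformContinuousAt_of_continuousAt _ hc (Metric.dist_mem_uniformity hε)
  obtain ⟨ρ, hρ, h1⟩ := Metric.mem_uniformity_dist.1 h1
  refine ⟨ρ, hρ, fun x hx y hy => ?_⟩
  have := h1 (a := x) (b := y) (by rwa [dist_comm]) hx
  rw [← dist_eq_norm, dist_comm]
  exact (show dist _ _ < ε from this).le

lemma exists_abs_ballInt_sub_le [NeZero N] {u : Euc N → ℝ} {U K : Set (Euc N)} (hU : IsOpen U)
    (hK : IsCompact K) (hKU : K ⊆ U) (hu : ContDiffOn ℝ 2 u U) (hi : Integrable u) {ε : ℝ}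
    (hε : 0 < ε) : ∃ ρ > 0, ∀ δ, 0 < δ → δ < ρ → ∀ x ∈ K,
      |ballInt δ u x - omegaN N * δ ^ N * u x - lap u x * (ballMoment N δ / (2 * N))| ≤
        ε * ballMoment N δ := by
  have hcd : ∀ x ∈ U, ContDiffAt ℝ 2 u x := fun x hx => hu.contDiffAt (hU.mem_nhds hx)
  have hc : ∀ x ∈ K, ContinuousAt (fderiv ℝ (fderiv ℝ u)) x := fun x hx =>
    (((hcd x (hKU hx)).fderiv_right (m := 1) (by norm_num)).fderiv_right (m := 0)
      (by norm_num)).continuousAt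
  obtain ⟨ρ1, hρ1, h1⟩ := exists_norm_sub_le_of_isCompact (F := Euc N →L[ℝ] Euc N →L[ℝ] ℝ)
    (G := fderiv ℝ (fderiv ℝ u)) hK hc hε
  obtain ⟨ρ2, hρ2, h2⟩ := hK.exists_thickening_subset_open hU hKU
  refine ⟨min ρ1 ρ2, lt_min hρ1 hρ2, fun δ hδ hδρ x hx => ?_⟩
  refine abs_ballInt_sub_le (ρ := min ρ1 ρ2) (fun y hy => hcd y (h2 ?_)) (fun y hy => ?_) hδ hδρ hi
  · exact Metric.mem_thickening_iff.2 ⟨x, hx, (Metric.mem_ball.1 hy).trans_le (min_le_right _ _)⟩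
  · exact h1 x hx y ((Metric.mem_ball.1 hy).trans_le (min_le_left _ _))

end TaylorExpansion

section WeightedLaplacian

variable {N : ℕ}

lemma deriv_deriv_line {E : Type*} [NormedAddCommGroup E] [NormedSpace ℝ E] {u : E → ℝ} {x : E}
    (h : ContDiffAt ℝ 2 u x) (e : E) :
    deriv (deriv fun t : ℝ => u (x + t • e)) 0 = fderiv ℝ (fderiv ℝ u) x e e := by
  have hline : ∀ t : ℝ, HasDerivAt (fun t : ℝ => x + t • e) e t := by
    intro t
    simpa using ((hasDerivAt_id t).smul_const e).const_add x
  have hev : ∀ᶠ t : ℝ in nhds 0, ContDiffAt ℝ 2 u (x + t • e) := by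
    have hcont : Tendsto (fun t : ℝ => x + t • e) (nhds 0) (nhds x) := by
      simpa using (hline 0).continuousAt.tendsto
    exact hcont.eventually (h.eventually (by simp))
  have h1 : (deriv fun t : ℝ => u (x + t • e)) =ᶠ[nhds 0] fun t => fderiv ℝ u (x + t • e) e := by
    filter_upwards [hev] with t ht
    exact ((ht.differentiableAt two_ne_zero).hasFDerivAt.comp_hasDerivAt t (hline t)).deriv
  have hd : HasFDerivAt (fderiv ℝ u) (fderiv ℝ (fderiv ℝ u) x) (x + (0 : ℝ) • e) := by
    rw [zero_smul, add_zero]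
    exact ((h.fderiv_right (m := 1) (by norm_num)).differentiableAt one_ne_zero).hasFDerivAt
  have h2 : HasDerivAt (fun t : ℝ => fderiv ℝ u (x + t • e) e)
      (fderiv ℝ (fderiv ℝ u) x e e) 0 := by
    have h3 := hd.comp_hasDerivAt (0 : ℝ) (hline 0)
    exact (h3.clm_apply (hasDerivAt_const (0 : ℝ) e)).congr_deriv (by simp)
  rw [h1.deriv_eq, h2.deriv]

lemma lapx_eq_lap {w : Euc N → ℝ → ℝ} {x : Euc N} {y : ℝ}
    (h : ContDiffAt ℝ 2 (fun x => w x y) x) : lapx w x y = lap (fun x => w x y) x :=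
  Finset.sum_congr rfl fun _ _ => deriv_deriv_line h _

lemma continuousOn_lap {u : Euc N → ℝ} {U : Set (Euc N)} (hU : IsOpen U)
    (hu : ContDiffOn ℝ 2 u U) : ContinuousOn (lap u) U := by
  intro x hx
  have hc : ContinuousAt (fderiv ℝ (fderiv ℝ u)) x :=
    (((hu.contDiffAt (hU.mem_nhds hx)).fderiv_right (m := 1) (by norm_num)).fderiv_right (m := 0)
      (by norm_num)).continuousAt
  refine ContinuousAt.continuousWithinAt ?_
  unfold lap
  exact tendsto_finsetSum _ fun i _ =>
    (hc.clm_apply continuousAt_const).clm_apply continuousAt_const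

lemma integrable_mul_of_continuousOn {γ φ : Euc N → ℝ} {K : Set (Euc N)} (hK : IsCompact K)
    (hγ : AEStronglyMeasurable γ volume) (hγ1 : ∀ x, |γ x| ≤ 1) (hγK : ∀ x ∉ K, γ x = 0)
    (hφ : ContinuousOn φ K) : Integrable fun x => γ x * φ x := by
  have h : (fun x => γ x * φ x) = fun x => γ x * K.indicator φ x := by
    funext x
    by_cases hx : x ∈ K
    · rw [indicator_of_mem hx]
    · rw [hγK x hx, zero_mul, zero_mul]
  rw [h]
  exact ((integrable_indicator_iff hK.measurableSet).2 (hφ.integrableOn_compact hK)).bdd_mul hγ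
    (Eventually.of_forall hγ1)

lemma exists_abs_integral_ballInt_sub_le [NeZero N] {u γ : Euc N → ℝ} {U K : Set (Euc N)}
    (hU : IsOpen U) (hK : IsCompact K) (hKU : K ⊆ U) (hu : ContDiffOn ℝ 2 u U) (hi : Integrable u)
    (hγ : Integrable γ) (hγ1 : ∀ x, |γ x| ≤ 1) (hγK : ∀ x ∉ K, γ x = 0) {ε : ℝ} (hε : 0 < ε) :
    ∃ ρ > 0, ∀ δ, 0 < δ → δ < ρ →
      |(∫ x, γ x * ballInt δ u x) - omegaN N * δ ^ N * (∫ x, γ x * u x) -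
        (∫ x, γ x * lap u x) * (ballMoment N δ / (2 * N))| ≤
        ε * ballMoment N δ * ∫ x, |γ x| := by
  obtain ⟨ρ, hρ, h⟩ := exists_abs_ballInt_sub_le hU hK hKU hu hi hε
  refine ⟨ρ, hρ, fun δ hδ hδρ => ?_⟩
  have i1 : Integrable fun x => γ x * ballInt δ u x :=
    (integrable_ballInt hδ.le hi).bdd_mul hγ.1 (Eventually.of_forall hγ1)
  have i2 : Integrable fun x => omegaN N * δ ^ N * (γ x * u x) :=
    (hi.bdd_mul hγ.1 (Eventually.of_forall hγ1)).const_mul _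
  have i3 : Integrable fun x => γ x * lap u x * (ballMoment N δ / (2 * N)) :=
    (integrable_mul_of_continuousOn hK hγ.1 hγ1 hγK
      ((continuousOn_lap hU hu).mono hKU)).mul_const _
  have i12 : Integrable fun x => γ x * ballInt δ u x - omegaN N * δ ^ N * (γ x * u x) := i1.sub i2
  rw [← integral_const_mul, ← integral_mul_const, ← integral_sub i1 i2, ← integral_sub i12 i3,
    ← integral_const_mul, ← Real.norm_eq_abs]
  refine norm_integral_le_of_norm_le (hγ.abs.const_mul _) (Eventually.of_forall fun x => ?_)
  by_cases hx : x ∈ K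
  · have := mul_le_mul_of_nonneg_left (h δ hδ hδρ x hx) (abs_nonneg (γ x))
    rw [← abs_mul] at this
    rw [Real.norm_eq_abs]
    calc _ = |γ x * (ballInt δ u x - omegaN N * δ ^ N * u x -
          lap u x * (ballMoment N δ / (2 * N)))| := by congr 1; ring
      _ ≤ _ := this
      _ = _ := by ring
  · simp [hγK x hx]

/-- An inequality between ball averages at all small scales passes to the Laplacians. -/
lemma integral_mul_lap_le [NeZero N] {u γ u' γ' : Euc N → ℝ} {U K U' K' : Set (Euc N)}
    (hU : IsOpen U) (hK : IsCompact K) (hKU : K ⊆ U) (hu : ContDiffOn ℝ 2 u U) (hi : Integrable u)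
    (hγ : Integrable γ) (hγ1 : ∀ x, |γ x| ≤ 1) (hγK : ∀ x ∉ K, γ x = 0)
    (hU' : IsOpen U') (hK' : IsCompact K') (hKU' : K' ⊆ U') (hu' : ContDiffOn ℝ 2 u' U')
    (hi' : Integrable u')
    (hγ' : Integrable γ') (hγ1' : ∀ x, |γ' x| ≤ 1) (hγK' : ∀ x ∉ K', γ' x = 0)
    {δ₀ : ℝ} (hδ₀ : 0 < δ₀)
    (h : ∀ δ, 0 < δ → δ < δ₀ →
      (∫ x, γ x * ballInt δ u x) - omegaN N * δ ^ N * (∫ x, γ x * u x) ≤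
        (∫ x, γ' x * ballInt δ u' x) - omegaN N * δ ^ N * (∫ x, γ' x * u' x)) :
    ∫ x, γ x * lap u x ≤ ∫ x, γ' x * lap u' x := by
  by_contra! hlt
  set A := ∫ x, |γ x|
  set B := ∫ x, |γ' x|
  have hA : 0 ≤ A := integral_nonneg fun x => abs_nonneg _
  have hB : 0 ≤ B := integral_nonneg fun x => abs_nonneg _
  set d := (∫ x, γ x * lap u x) - ∫ x, γ' x * lap u' x with hd
  have hd0 : 0 < d := sub_pos.2 hlt
  have hN : (0 : ℝ) < N := Nat.cast_pos.2 (NeZero.pos N)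
  set ε := d / (4 * N * (A + B + 1)) with hεd
  have hε : 0 < ε := by positivity
  obtain ⟨ρ, hρ, h1⟩ := exists_abs_integral_ballInt_sub_le hU hK hKU hu hi hγ hγ1 hγK hε
  obtain ⟨ρ', hρ', h1'⟩ :=
    exists_abs_integral_ballInt_sub_le hU' hK' hKU' hu' hi' hγ' hγ1' hγK' hε
  obtain ⟨δ, hδ, hδm⟩ := exists_between (lt_min hδ₀ (lt_min hρ hρ'))
  have h2 := (abs_le.1 (h1 δ hδ (hδm.trans_le ((min_le_right _ _).trans (min_le_left _ _))))).1
  have h3 := (abs_le.1 (h1' δ hδ (hδm.trans_le ((min_le_right _ _).trans (min_le_right _ _))))).2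
  have h4 := h δ hδ (hδm.trans_le (min_le_left _ _))
  have hm := ballMoment_pos (N := N) hδ
  set m := ballMoment N δ
  have h5 : d * (m / (2 * N)) ≤ ε * m * (A + B) := by
    rw [hd, sub_mul, mul_add]
    linarith
  have h6 : d * (m / (2 * N)) = 2 * (ε * m * (A + B + 1)) := by
    rw [hεd]
    field_simp
    ring
  have : 0 < ε * m := by positivity
  nlinarith [mul_nonneg this.le (add_nonneg hA hB)]

end WeightedLaplacian

/-! ### Regularity of solutions of the extension problem -/

namespace IsExtSol

variable {N : ℕ} {α : ℝ} {Ω : Set (Euc N)} {f : Euc N → ℝ} {w : Euc N → ℝ → ℝ}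

lemma contDiffAt (hw : IsExtSol α Ω f w) (hΩ : IsOpen Ω) {x : Euc N} (hx : x ∈ Ω) {y : ℝ}
    (hy : 0 < y) : ContDiffAt ℝ 2 (fun p : Euc N × ℝ => w p.1 p.2) (x, y) :=
  hw.smooth.contDiffAt ((hΩ.prod isOpen_Ioi).mem_nhds ⟨hx, hy⟩)

lemma contDiffOn_slice (hw : IsExtSol α Ω f w) {y : ℝ} (hy : 0 < y) :
    ContDiffOn ℝ 2 (fun x => w x y) Ω :=
  hw.smooth.comp (f := fun x : Euc N => (x, y)) (by fun_prop) fun _ hx => ⟨hx, hy⟩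

lemma hasDerivAt_pair (x : Euc N) (y : ℝ) :
    HasDerivAt (fun y : ℝ => (x, y)) ((0 : Euc N), (1 : ℝ)) y :=
  (hasDerivAt_const y x).prodMk (hasDerivAt_id y)

lemma hasDerivAt_y (hw : IsExtSol α Ω f w) (hΩ : IsOpen Ω) {x : Euc N} (hx : x ∈ Ω) {y : ℝ}
    (hy : 0 < y) :
    HasDerivAt (w x) (fderiv ℝ (fun p : Euc N × ℝ => w p.1 p.2) (x, y) (0, 1)) y :=
  ((hw.contDiffAt hΩ hx hy).differentiableAt two_ne_zero).hasFDerivAt.comp_hasDerivAt y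
    (hasDerivAt_pair x y)

lemma hasDerivAt_y_y (hw : IsExtSol α Ω f w) (hΩ : IsOpen Ω) {x : Euc N} (hx : x ∈ Ω) {y : ℝ}
    (hy : 0 < y) :
    HasDerivAt (deriv (w x))
      (fderiv ℝ (fderiv ℝ fun p : Euc N × ℝ => w p.1 p.2) (x, y) (0, 1) (0, 1)) y := by
  have h1 : deriv (w x) =ᶠ[nhds y]
      fun y => fderiv ℝ (fun p : Euc N × ℝ => w p.1 p.2) (x, y) (0, 1) := by
    filter_upwards [lt_mem_nhds hy] with z hz
    exact (hw.hasDerivAt_y hΩ hx hz).deriv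
  have hd := (((hw.contDiffAt hΩ hx hy).fderiv_right (m := 1) (by norm_num)).differentiableAt
    one_ne_zero).hasFDerivAt
  have h2 := hd.comp_hasDerivAt y (hasDerivAt_pair x y)
  refine HasDerivAt.congr_of_eventuallyEq ?_ h1
  exact (h2.clm_apply (hasDerivAt_const y ((0 : Euc N), (1 : ℝ)))).congr_deriv (by simp)

lemma exists_deriv_bound (hw : IsExtSol α Ω f w) (hΩ : IsOpen Ω) :
    ∃ M, 0 ≤ M ∧ ∀ x ∈ Ω, ∀ y, 0 < y → |deriv (w x) y| ≤ M ∧ |deriv (deriv (w x)) y| ≤ M := by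
  obtain ⟨M, hM⟩ := hw.derivBdd
  refine ⟨max M 0, le_max_right _ _, fun x hx y hy => ?_⟩
  obtain ⟨h1, h2⟩ := hM (x, y) ⟨hx, hy⟩
  have he : ‖((0 : Euc N), (1 : ℝ))‖ = 1 := by simp [Prod.norm_def]
  rw [(hw.hasDerivAt_y hΩ hx hy).deriv, (hw.hasDerivAt_y_y hΩ hx hy).deriv]
  constructor
  · have := (fderiv ℝ (fun p : Euc N × ℝ => w p.1 p.2) (x, y)).le_opNorm (0, 1)
    rw [he, mul_one] at this
    exact this.trans (h1.trans (le_max_left _ _))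
  · have h3 := (fderiv ℝ (fderiv ℝ fun p : Euc N × ℝ => w p.1 p.2) (x, y) (0, 1)).le_opNorm (0, 1)
    have h4 := (fderiv ℝ (fderiv ℝ fun p : Euc N × ℝ => w p.1 p.2) (x, y)).le_opNorm (0, 1)
    rw [he, mul_one] at h3 h4
    exact h3.trans (h4.trans (h2.trans (le_max_left _ _)))

lemma continuousOn_deriv (hw : IsExtSol α Ω f w) (hΩ : IsOpen Ω) {y : ℝ} (hy : 0 < y) :
    ContinuousOn (fun x => deriv (w x) y) Ω := by
  have h : ContinuousOn
      (fun x => fderiv ℝ (fun p : Euc N × ℝ => w p.1 p.2) (x, y) (0, 1)) Ω := by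
    intro x hx
    have hc := ((hw.contDiffAt hΩ hx hy).fderiv_right (m := 1) (by norm_num)).continuousAt
    have h2 : ContinuousAt (fun x : Euc N => (x, y)) x := by fun_prop
    exact ((ContinuousAt.comp (f := fun x : Euc N => (x, y)) hc h2).clm_apply
      continuousAt_const).continuousWithinAt
  exact h.congr fun x hx => (hw.hasDerivAt_y hΩ hx hy).deriv

lemma continuousOn_deriv_deriv (hw : IsExtSol α Ω f w) (hΩ : IsOpen Ω) {y : ℝ} (hy : 0 < y) :
    ContinuousOn (fun x => deriv (deriv (w x)) y) Ω := by
  have h : ContinuousOn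
      (fun x => fderiv ℝ (fderiv ℝ fun p : Euc N × ℝ => w p.1 p.2) (x, y) (0, 1) (0, 1)) Ω := by
    intro x hx
    have hc := (((hw.contDiffAt hΩ hx hy).fderiv_right (m := 1) (by norm_num)).fderiv_right
      (m := 0) (by norm_num)).continuousAt
    have h2 : ContinuousAt (fun x : Euc N => (x, y)) x := by fun_prop
    exact (((ContinuousAt.comp (f := fun x : Euc N => (x, y)) hc h2).clm_apply
      continuousAt_const).clm_apply continuousAt_const).continuousWithinAt
  exact h.congr fun x hx => (hw.hasDerivAt_y_y hΩ hx hy).deriv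

/-- The weighted normal derivative is bounded near the bottom of the cylinder. -/
lemma exists_rpow_mul_deriv_bound (hw : IsExtSol α Ω f w) (hΩ : IsOpen Ω)
    (hα : α ∈ Ioo (0 : ℝ) 2) :
    ∃ M, ∀ x ∈ Ω, ∀ y ∈ Ioo (0 : ℝ) 1, |y ^ (1 - α) * deriv (w x) y| ≤ M := by
  obtain ⟨M, hM0, hM⟩ := hw.exists_deriv_bound hΩ
  refine ⟨M, fun x hx y hy => ?_⟩
  rw [abs_mul, abs_of_nonneg (Real.rpow_nonneg hy.1.le _)]
  rcases le_or_gt α 1 with h1 | h1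
  · calc y ^ (1 - α) * |deriv (w x) y| ≤ 1 * M :=
          mul_le_mul (Real.rpow_le_one hy.1.le hy.2.le (by linarith)) (hM x hx y hy.1).1
            (abs_nonneg _) zero_le_one
      _ = M := one_mul M
  · have hlim : Tendsto (deriv (w x)) (nhdsWithin 0 (Ioi 0)) (nhds 0) := by
      have h2 : Tendsto (fun z : ℝ => z ^ (α - 1)) (nhdsWithin 0 (Ioi 0)) (nhds 0) := by
        have : Tendsto (fun z : ℝ => z ^ (α - 1)) (nhds 0) (nhds ((0 : ℝ) ^ (α - 1))) :=
          (Real.continuousAt_rpow_const 0 (α - 1) (Or.inr (by linarith))).tendsto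
        rw [Real.zero_rpow (by linarith)] at this
        exact this.mono_left nhdsWithin_le_nhds
      have h3 := h2.mul (hw.neumann x hx)
      rw [zero_mul] at h3
      refine h3.congr' ?_
      filter_upwards [self_mem_nhdsWithin] with z hz
      rw [← mul_assoc, ← Real.rpow_add hz]
      simp
    have hle : |deriv (w x) y| ≤ M * y := by
      have h4 : ∀ z ∈ Ioo 0 y, |deriv (w x) y - deriv (w x) z| ≤ M * y := by
        intro z hz
        have := (convex_Ioi (0 : ℝ)).norm_image_sub_le_of_norm_hasDerivWithin_le
          (f := deriv (w x)) (f' := deriv (deriv (w x))) (C := M) (x := z) (y := y)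
          (fun t ht => by
            have := hw.hasDerivAt_y_y hΩ hx ht
            rw [← this.deriv] at this
            exact this.hasDerivWithinAt)
          (fun t ht => (hM x hx t ht).2) hz.1 hy.1
        refine this.trans (mul_le_mul_of_nonneg_left ?_ hM0)
        rw [Real.norm_of_nonneg (by linarith [hz.2])]
        linarith [hz.1]
      have h5 : Tendsto (fun z => |deriv (w x) y - deriv (w x) z|) (nhdsWithin 0 (Ioi 0))
          (nhds |deriv (w x) y - 0|) := (tendsto_const_nhds.sub hlim).abs
      rw [sub_zero] at h5
      refine le_of_tendsto h5 ?_
      filter_upwards [Ioo_mem_nhdsGT hy.1] with z hz using h4 z hz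
    calc y ^ (1 - α) * |deriv (w x) y| ≤ y ^ (1 - α) * (M * y) :=
          mul_le_mul_of_nonneg_left hle (Real.rpow_nonneg hy.1.le _)
      _ = M * y ^ (2 - α) := by
          have : y ^ (2 - α) = y ^ (1 - α) * y := by
            rw [← Real.rpow_add_one hy.1.ne']; congr 1; ring
          rw [this]; ring
      _ ≤ M * 1 := mul_le_mul_of_nonneg_left
          (Real.rpow_le_one hy.1.le hy.2.le (by linarith [hα.2])) hM0
      _ = M := mul_one M

end IsExtSol

/-- Zero extension in `x`, and constant extension to negative `y`, of a function on a cylinder. -/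
def zext {N : ℕ} (Ω : Set (Euc N)) (w : Euc N → ℝ → ℝ) (x : Euc N) (y : ℝ) : ℝ :=
  Ω.indicator (fun x => w x (max y 0)) x

section Zext

variable {N : ℕ} {α : ℝ} {Ω : Set (Euc N)} {f γ : Euc N → ℝ} {w : Euc N → ℝ → ℝ}

lemma zext_of_mem {x : Euc N} (hx : x ∈ Ω) {y : ℝ} (hy : 0 ≤ y) : zext Ω w x y = w x y := by
  rw [zext, indicator_of_mem hx, max_eq_left hy]

lemma zext_of_notMem {x : Euc N} (hx : x ∉ Ω) (y : ℝ) : zext Ω w x y = 0 :=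
  indicator_of_notMem hx _

lemma closure_cylinder : closure (Ω ×ˢ Ioi (0 : ℝ)) = closure Ω ×ˢ Ici 0 := by
  rw [closure_prod_eq, closure_Ioi]

lemma IsExtSol.continuous_zext (hw : IsExtSol α Ω f w) :
    Continuous fun p : Euc N × ℝ => zext Ω w p.1 p.2 := by
  have h : (fun p : Euc N × ℝ => zext Ω w p.1 p.2) =
      (Ω ×ˢ (univ : Set ℝ)).indicator fun p => w p.1 (max p.2 0) := by
    funext p
    by_cases hp : p.1 ∈ Ω
    · have hp' : p ∈ Ω ×ˢ (univ : Set ℝ) := mem_prod.2 ⟨hp, mem_univ _⟩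
      rw [zext, indicator_of_mem hp, indicator_of_mem hp']
    · rw [zext_of_notMem hp, indicator_of_notMem fun h => hp h.1]
  rw [h]
  refine continuous_indicator (fun p hp => ?_) ?_
  · rw [frontier_prod_univ_eq] at hp
    exact hw.lateral p.1 hp.1 _ (mem_Ici.2 (le_max_right _ _))
  · rw [closure_prod_eq, closure_univ]
    have hc := hw.cont
    rw [closure_cylinder] at hc
    exact hc.comp (f := fun p : Euc N × ℝ => (p.1, max p.2 0)) (by fun_prop)
      fun p hp => ⟨hp.1, mem_Ici.2 (le_max_right _ _)⟩

lemma IsExtSol.exists_zext_bound (hw : IsExtSol α Ω f w) :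
    ∃ M, 0 ≤ M ∧ ∀ x y, |zext Ω w x y| ≤ M := by
  obtain ⟨M, hM⟩ := hw.bdd
  refine ⟨max M 0, le_max_right _ _, fun x y => ?_⟩
  by_cases hx : x ∈ Ω
  · rw [zext, indicator_of_mem hx]
    refine (hM (x, max y 0) ?_).trans (le_max_left _ _)
    rw [closure_cylinder]
    exact ⟨subset_closure hx, mem_Ici.2 (le_max_right _ _)⟩
  · rw [zext_of_notMem hx, abs_zero]
    exact le_max_right _ _

lemma IsExtSol.continuous_zext_slice (hw : IsExtSol α Ω f w) (y : ℝ) :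
    Continuous fun x => zext Ω w x y :=
  hw.continuous_zext.comp (by fun_prop : Continuous fun x : Euc N => (x, y))

lemma IsExtSol.integrable_zext (hw : IsExtSol α Ω f w) (hΩb : Bornology.IsBounded Ω) (y : ℝ) :
    Integrable fun x => zext Ω w x y := by
  obtain ⟨R, hR⟩ := hΩb.subset_closedBall 0
  refine (hw.continuous_zext_slice y).integrable_of_hasCompactSupport
    (hasCompactSupport_of_norm (R := R) fun x hx => zext_of_notMem (fun h => ?_) y)
  exact absurd (mem_closedBall_zero_iff.1 (hR h)) (not_le.2 hx)

lemma IsExtSol.contDiffOn_zext (hw : IsExtSol α Ω f w) {y : ℝ} (hy : 0 < y) :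
    ContDiffOn ℝ 2 (fun x => zext Ω w x y) Ω :=
  (hw.contDiffOn_slice hy).congr fun _ hx => zext_of_mem hx hy.le

lemma IsExtSol.lap_zext (hw : IsExtSol α Ω f w) (hΩ : IsOpen Ω) {x : Euc N} (hx : x ∈ Ω) {y : ℝ}
    (hy : 0 < y) : lap (fun x => zext Ω w x y) x = lapx w x y := by
  rw [lapx_eq_lap ((hw.contDiffOn_slice hy).contDiffAt (hΩ.mem_nhds hx))]
  have h : (fun x => zext Ω w x y) =ᶠ[nhds x] fun x => w x y := by
    filter_upwards [hΩ.mem_nhds hx] with z hz using zext_of_mem hz hy.le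
  unfold lap
  rw [h.fderiv.fderiv_eq]

lemma aestronglyMeasurable_weight_mul {φ : Euc N → ℝ} (hΩ : IsOpen Ω)
    (hγ : Integrable γ) (hγΩ : ∀ x ∉ Ω, γ x = 0) (hφ : ContinuousOn φ Ω) :
    AEStronglyMeasurable (fun x => γ x * φ x) volume := by
  have h : (fun x => γ x * φ x) = fun x => γ x * Ω.indicator φ x := by
    funext x
    by_cases hx : x ∈ Ω
    · rw [indicator_of_mem hx]
    · rw [hγΩ x hx, zero_mul, zero_mul]
  rw [h]
  exact hγ.1.mul ((aestronglyMeasurable_indicator_iff hΩ.measurableSet).2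
    (hφ.aestronglyMeasurable hΩ.measurableSet))

lemma abs_weight_mul_le {φ : Euc N → ℝ} {M : ℝ} (hγΩ : ∀ x ∉ Ω, γ x = 0)
    (hφ : ∀ x ∈ Ω, |φ x| ≤ M) (x : Euc N) : ‖γ x * φ x‖ ≤ M * |γ x| := by
  by_cases hx : x ∈ Ω
  · rw [norm_mul, mul_comm]
    exact mul_le_mul_of_nonneg_right (hφ x hx) (abs_nonneg _)
  · simp [hγΩ x hx]

lemma integrable_weight_mul_of_bound {φ : Euc N → ℝ} {M : ℝ} (hΩ : IsOpen Ω)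
    (hγ : Integrable γ) (hγΩ : ∀ x ∉ Ω, γ x = 0) (hφ : ContinuousOn φ Ω)
    (hφM : ∀ x ∈ Ω, |φ x| ≤ M) : Integrable fun x => γ x * φ x :=
  (hγ.abs.const_mul M).mono' (aestronglyMeasurable_weight_mul hΩ hγ hγΩ hφ)
    (Eventually.of_forall (abs_weight_mul_le hγΩ hφM))

lemma hasDerivAt_integral_weight {F F' : Euc N → ℝ → ℝ} {M : ℝ} (hΩ : IsOpen Ω)
    (hγ : Integrable γ) (hγΩ : ∀ x ∉ Ω, γ x = 0)
    (hF : ∀ x ∈ Ω, ∀ y, 0 < y → HasDerivAt (F x) (F' x y) y)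
    (hFc : ∀ y, 0 < y → ContinuousOn (fun x => F x y) Ω)
    (hFc' : ∀ y, 0 < y → ContinuousOn (fun x => F' x y) Ω)
    (hFM : ∀ x ∈ Ω, ∀ y, 0 < y → |F x y| ≤ M) (hFM' : ∀ x ∈ Ω, ∀ y, 0 < y → |F' x y| ≤ M)
    {y : ℝ} (hy : 0 < y) :
    HasDerivAt (fun y => ∫ x, γ x * F x y) (∫ x, γ x * F' x y) y := by
  refine (hasDerivAt_integral_of_dominated_loc_of_deriv_le (F := fun y x => γ x * F x y)
    (F' := fun y x => γ x * F' x y) (bound := fun x => M * |γ x|) (Ioi_mem_nhds hy) ?_ ?_ ?_ ?_ ?_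
    ?_).2
  · filter_upwards [Ioi_mem_nhds hy] with z hz
      using aestronglyMeasurable_weight_mul hΩ hγ hγΩ (hFc z hz)
  · exact integrable_weight_mul_of_bound hΩ hγ hγΩ (hFc y hy) fun x hx => hFM x hx y hy
  · exact aestronglyMeasurable_weight_mul hΩ hγ hγΩ (hFc' y hy)
  · exact Eventually.of_forall fun x z hz => abs_weight_mul_le (φ := fun x => F' x z) hγΩ
      (fun x hx => hFM' x hx z hz) x
  · exact hγ.abs.const_mul M
  · refine Eventually.of_forall fun x z hz => ?_
    by_cases hx : x ∈ Ω
    · exact (hF x hx z hz).const_mul (γ x)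
    · simpa [hγΩ x hx] using hasDerivAt_const z (0 : ℝ)

lemma IsExtSol.continuous_integral_zext (hw : IsExtSol α Ω f w) (hγ : Integrable γ) :
    Continuous fun y => ∫ x, γ x * zext Ω w x y := by
  obtain ⟨M, hM0, hM⟩ := hw.exists_zext_bound
  refine continuous_of_dominated (bound := fun x => M * |γ x|) (fun y => ?_) (fun y => ?_)
    (hγ.abs.const_mul M) ?_
  · exact hγ.1.mul (hw.continuous_zext_slice y).aestronglyMeasurable
  · refine Eventually.of_forall fun x => ?_
    rw [norm_mul, mul_comm]
    exact mul_le_mul_of_nonneg_right (hM x y) (abs_nonneg _)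
  · exact Eventually.of_forall fun x => continuous_const.mul
      (hw.continuous_zext.comp (by fun_prop : Continuous fun y : ℝ => (x, y)))

/-- The first `y`-derivative of a weighted integral of a solution. -/
def derivInt (γ : Euc N → ℝ) (w : Euc N → ℝ → ℝ) (y : ℝ) : ℝ := ∫ x, γ x * deriv (w x) y

/-- The second `y`-derivative of a weighted integral of a solution. -/
def derivTwoInt (γ : Euc N → ℝ) (w : Euc N → ℝ → ℝ) (y : ℝ) : ℝ :=
  ∫ x, γ x * deriv (deriv (w x)) y

lemma IsExtSol.hasDerivAt_integral_zext (hw : IsExtSol α Ω f w) (hΩ : IsOpen Ω)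
    (hγ : Integrable γ) (hγΩ : ∀ x ∉ Ω, γ x = 0) {y : ℝ} (hy : 0 < y) :
    HasDerivAt (fun y => ∫ x, γ x * zext Ω w x y) (derivInt γ w y) y := by
  obtain ⟨M, hM0, hM⟩ := hw.exists_zext_bound
  obtain ⟨M', hM0', hM'⟩ := hw.exists_deriv_bound hΩ
  refine hasDerivAt_integral_weight (M := max M M') hΩ hγ hγΩ (fun x hx z hz => ?_)
    (fun z _ => (hw.continuous_zext_slice z).continuousOn) (fun z hz => hw.continuousOn_deriv hΩ hz)
    (fun x _ z _ => (hM x z).trans (le_max_left _ _))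
    (fun x hx z hz => (hM' x hx z hz).1.trans (le_max_right _ _)) hy
  have h := hw.hasDerivAt_y hΩ hx hz
  rw [← h.deriv] at h
  refine h.congr_of_eventuallyEq ?_
  filter_upwards [Ioi_mem_nhds hz] with t ht using zext_of_mem hx (le_of_lt ht)

lemma IsExtSol.hasDerivAt_derivInt (hw : IsExtSol α Ω f w) (hΩ : IsOpen Ω)
    (hγ : Integrable γ) (hγΩ : ∀ x ∉ Ω, γ x = 0) {y : ℝ} (hy : 0 < y) :
    HasDerivAt (derivInt γ w) (derivTwoInt γ w y) y := by
  obtain ⟨M, hM0, hM⟩ := hw.exists_deriv_bound hΩ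
  refine hasDerivAt_integral_weight (M := M) hΩ hγ hγΩ (fun x hx z hz => ?_)
    (fun z hz => hw.continuousOn_deriv hΩ hz) (fun z hz => hw.continuousOn_deriv_deriv hΩ hz)
    (fun x hx z hz => (hM x hx z hz).1) (fun x hx z hz => (hM x hx z hz).2) hy
  have h := hw.hasDerivAt_y_y hΩ hx hz
  rwa [← h.deriv] at h

lemma IsExtSol.integrated_pde (hw : IsExtSol α Ω f w) (hΩ : IsOpen Ω)
    (hγ : Integrable γ) (hγΩ : ∀ x ∉ Ω, γ x = 0) {y : ℝ} (hy : 0 < y) :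
    (∫ x, γ x * lap (fun x => zext Ω w x y) x) + (1 - α) / y * derivInt γ w y +
      derivTwoInt γ w y = 0 := by
  obtain ⟨M, hM0, hM⟩ := hw.exists_deriv_bound hΩ
  have i1 : Integrable fun x => (1 - α) / y * (γ x * deriv (w x) y) :=
    (integrable_weight_mul_of_bound hΩ hγ hγΩ (hw.continuousOn_deriv hΩ hy)
      fun x hx => (hM x hx y hy).1).const_mul _
  have i2 : Integrable fun x => γ x * deriv (deriv (w x)) y :=
    integrable_weight_mul_of_bound hΩ hγ hγΩ (hw.continuousOn_deriv_deriv hΩ hy)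
      fun x hx => (hM x hx y hy).2
  have h : ∫ x, γ x * lap (fun x => zext Ω w x y) x =
      ∫ x, -((1 - α) / y * (γ x * deriv (w x) y) + γ x * deriv (deriv (w x)) y) := by
    refine integral_congr_ae (Eventually.of_forall fun x => ?_)
    dsimp only
    by_cases hx : x ∈ Ω
    · rw [hw.lap_zext hΩ hx hy]
      linear_combination γ x * hw.pde x hx y hy
    · simp [hγΩ x hx]
  rw [h, integral_neg, integral_add i1 i2, integral_const_mul, derivInt, derivTwoInt]
  ring

lemma IsExtSol.tendsto_rpow_mul_derivInt (hw : IsExtSol α Ω f w) (hΩ : IsOpen Ω)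
    (hα : α ∈ Ioo (0 : ℝ) 2) (hγ : Integrable γ) (hγΩ : ∀ x ∉ Ω, γ x = 0) :
    Tendsto (fun y => y ^ (1 - α) * derivInt γ w y) (nhdsWithin 0 (Ioi 0))
      (nhds (-kappa α * ∫ x, γ x * f x)) := by
  obtain ⟨M, hM⟩ := hw.exists_rpow_mul_deriv_bound hΩ hα
  have h : Tendsto (fun y => ∫ x, γ x * (y ^ (1 - α) * deriv (w x) y)) (nhdsWithin 0 (Ioi 0))
      (nhds (∫ x, γ x * (-kappa α * f x))) := by
    refine tendsto_integral_filter_of_dominated_convergence (fun x => M * |γ x|) ?_ ?_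
      (hγ.abs.const_mul M) ?_
    · filter_upwards [self_mem_nhdsWithin] with y hy
      exact aestronglyMeasurable_weight_mul hΩ hγ hγΩ
        (continuousOn_const.mul (hw.continuousOn_deriv hΩ hy))
    · filter_upwards [Ioo_mem_nhdsGT zero_lt_one] with y hy
      exact Eventually.of_forall (abs_weight_mul_le hγΩ fun x hx => hM x hx y hy)
    · refine Eventually.of_forall fun x => ?_
      by_cases hx : x ∈ Ω
      · exact (hw.neumann x hx).const_mul _
      · simp [hγΩ x hx]
  have e1 : ∀ y, ∫ x, γ x * (y ^ (1 - α) * deriv (w x) y) = y ^ (1 - α) * derivInt γ w y := by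
    intro y
    rw [derivInt, ← integral_const_mul]
    exact integral_congr_ae (Eventually.of_forall fun x => by simp only; ring)
  have e2 : ∫ x, γ x * (-kappa α * f x) = -kappa α * ∫ x, γ x * f x := by
    rw [← integral_const_mul]
    exact integral_congr_ae (Eventually.of_forall fun x => by simp only; ring)
  simpa only [e1, e2] using h

end Zext

/-! ### One-dimensional maximum principle in the extension variable -/

section OneDim

variable {A A₁ A₂ : ℝ → ℝ} {α ε : ℝ}

lemma kappa_pos (hα : α ∈ Ioo (0 : ℝ) 2) : 0 < kappa α := by
  have h1 : 0 < 1 - α / 2 := by linarith [hα.2]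
  have h2 : 0 < α / 2 := by linarith [hα.1]
  exact div_pos (mul_pos (Real.rpow_pos_of_pos two_pos _) (Real.Gamma_pos_of_pos h1))
    (Real.Gamma_pos_of_pos h2)

lemma hasDerivAt_add_barrier (hA : ∀ y, 0 < y → HasDerivAt A (A₁ y) y) {y : ℝ} (hy : 0 < y) :
    HasDerivAt (fun y => A y + ε * (y ^ α + y ^ 2))
      (A₁ y + ε * (α * y ^ (α - 1) + 2 * y)) y := by
  have h1 := Real.hasDerivAt_rpow_const (p := α) (Or.inl hy.ne')
  have h2 := hasDerivAt_pow 2 y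
  exact ((hA y hy).add ((h1.add h2).const_mul ε)).congr_deriv (by simp)

lemma not_isLocalMax_add_barrier (hα : α < 2) (hε : 0 < ε)
    (hA : ∀ y, 0 < y → HasDerivAt A (A₁ y) y) (hA₁ : ∀ y, 0 < y → HasDerivAt A₁ (A₂ y) y)
    {y : ℝ} (hy : 0 < y) (h : 0 ≤ (1 - α) / y * A₁ y + A₂ y) :
    ¬IsLocalMax (fun y => A y + ε * (y ^ α + y ^ 2)) y := by
  intro hmax
  set p := fun y => A y + ε * (y ^ α + y ^ 2) with hp
  have hd : ∀ z, 0 < z → HasDerivAt p (A₁ z + ε * (α * z ^ (α - 1) + 2 * z)) z :=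
    fun z hz => hasDerivAt_add_barrier hA hz
  have hdev : deriv p =ᶠ[nhds y] fun z => A₁ z + ε * (α * z ^ (α - 1) + 2 * z) := by
    filter_upwards [Ioi_mem_nhds hy] with z hz using (hd z hz).deriv
  have hd2 : HasDerivAt (deriv p) (A₂ y + ε * (α * ((α - 1) * y ^ (α - 1 - 1)) + 2)) y := by
    refine HasDerivAt.congr_of_eventuallyEq ?_ hdev
    have h1 := (Real.hasDerivAt_rpow_const (p := α - 1) (Or.inl hy.ne')).const_mul α
    have h2 := (hasDerivAt_id y).const_mul 2
    exact ((hA₁ y hy).add ((h1.add h2).const_mul ε)).congr_deriv (by simp)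
  have h0 : A₁ y + ε * (α * y ^ (α - 1) + 2 * y) = 0 := hmax.hasDerivAt_eq_zero (hd y hy)
  have hpos : 0 < deriv (deriv p) y := by
    rw [hd2.deriv]
    have e1 : y ^ (α - 1) = y ^ (α - 1 - 1) * y := by
      rw [← Real.rpow_add_one hy.ne']; congr 1; ring
    have e2 : A₂ y + ε * (α * ((α - 1) * y ^ (α - 1 - 1)) + 2) =
        ((1 - α) / y * A₁ y + A₂ y) + ε * (2 * (2 - α)) := by
      have e3 : A₁ y = -(ε * (α * (y ^ (α - 1 - 1) * y) + 2 * y)) := by rw [← e1]; linarith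
      rw [e3]
      field_simp
      ring
    rw [e2]
    have : 0 < ε * (2 * (2 - α)) := mul_pos hε (by linarith)
    linarith
  have hmin : IsLocalMin p y := isLocalMin_of_deriv_deriv_pos hpos
    ((hd y hy).deriv.trans h0) (hd y hy).continuousAt
  have hconst : p =ᶠ[nhds y] fun _ => p y := by
    filter_upwards [hmax, hmin] with z h1 h2 using le_antisymm h1 h2
  have : deriv (deriv p) y = 0 := by
    rw [hconst.deriv.deriv_eq]
    simp
  exact hpos.ne' this

lemma exists_barrier_gt (hα : α ∈ Ioo (0 : ℝ) 2) (hε : 0 < ε) (hAc : Continuous A)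
    (hA : ∀ y, 0 < y → HasDerivAt A (A₁ y) y) {c : ℝ} (hc : 0 ≤ c)
    (hlim : Tendsto (fun y => y ^ (1 - α) * A₁ y) (nhdsWithin 0 (Ioi 0)) (nhds c)) {Y : ℝ}
    (hY : 0 < Y) : ∃ y ∈ Ioo 0 Y, A 0 < A y + ε * (y ^ α + y ^ 2) := by
  have h1 : ∀ᶠ y in nhdsWithin (0 : ℝ) (Ioi 0), -(ε * α) < y ^ (1 - α) * A₁ y :=
    hlim.eventually (lt_mem_nhds (by have := mul_pos hε hα.1; linarith))
  obtain ⟨η, hη, hη1⟩ := mem_nhdsGT_iff_exists_Ioo_subset.1 h1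
  have hη0 : 0 < η := hη
  obtain ⟨z, hz0, hz⟩ := exists_between (lt_min hη0 hY)
  have hmono : StrictMonoOn (fun y => A y + ε * (y ^ α + y ^ 2)) (Icc 0 z) := by
    refine strictMonoOn_of_deriv_pos (convex_Icc 0 z) ?_ fun y hy => ?_
    · have : Continuous fun y : ℝ => y ^ α :=
        continuous_id.rpow_const fun _ => Or.inr hα.1.le
      exact Continuous.continuousOn (by fun_prop)
    · rw [interior_Icc] at hy
      rw [(hasDerivAt_add_barrier hA hy.1).deriv]
      have h2 : -(ε * α) < y ^ (1 - α) * A₁ y :=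
        hη1 ⟨hy.1, hy.2.trans (hz.trans_le (min_le_left _ _))⟩
      have hy' := hy.1
      have h3 : 0 < y ^ (1 - α) := Real.rpow_pos_of_pos hy.1 _
      have h4 : y ^ (1 - α) * y ^ (α - 1) = 1 := by
        rw [← Real.rpow_add hy.1]; simp
      have h5 : 0 < y ^ (1 - α) * (A₁ y + ε * (α * y ^ (α - 1) + 2 * y)) := by
        have : y ^ (1 - α) * (A₁ y + ε * (α * y ^ (α - 1) + 2 * y)) =
            y ^ (1 - α) * A₁ y + ε * α * (y ^ (1 - α) * y ^ (α - 1)) +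
              2 * ε * (y * y ^ (1 - α)) := by ring
        rw [this, h4]
        have : 0 < 2 * ε * (y * y ^ (1 - α)) := by positivity
        linarith
      exact pos_of_mul_pos_right h5 h3.le
  refine ⟨z, ⟨hz0, hz.trans_le (min_le_right _ _)⟩, ?_⟩
  have := hmono (left_mem_Icc.2 hz0.le) (right_mem_Icc.2 hz0.le) hz0
  simpa [Real.zero_rpow hα.1.ne'] using this

end OneDim

/-! ### Exclusion of maxima of the penalized difference of concentration functions -/

section Exclusion

variable {N : ℕ}

lemma conc_abs (h : Euc N → ℝ) (s : ℝ) : conc (fun x => |h x|) s = conc h s := by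
  simp only [conc, abs_abs]

/-- The difference of the concentration function of `z` and the ball integral of `V`, penalized. -/
def penDiff (α ε ε' : ℝ) (z V : Euc N → ℝ → ℝ) (r y : ℝ) : ℝ :=
  conc (fun x => z x y) (omegaN N * r ^ N) - (∫ x in Metric.ball (0 : Euc N) r, V x y) +
    ε * (y ^ α + y ^ 2) - ε' * (omegaN N * r ^ N)

lemma abs_ballInt_le (δ : ℝ) (F : Euc N → ℝ) (x : Euc N) :
    |ballInt δ F x| ≤ ballInt δ (fun x => |F x|) x := by
  refine (abs_integral_le_integral_abs).trans (le_of_eq ?_)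
  refine integral_congr_ae (Eventually.of_forall fun y => ?_)
  simp only [abs_mul, abs_of_nonneg (ballProfile_nonneg _ _)]

/-- A signed weight concentrated on the superlevel set of `|z|`. -/
def signedWeight (t θ : ℝ) (z : Euc N → ℝ) (x : Euc N) : ℝ :=
  levelWeight t θ |z x| * SignType.sign (z x)

lemma signedWeight_mul_self (t θ : ℝ) (z : Euc N → ℝ) (x : Euc N) :
    signedWeight t θ z x * z x = levelWeight t θ |z x| * |z x| := by
  rw [signedWeight, mul_assoc, sign_mul_self]

lemma abs_signedWeight_le {t θ : ℝ} (hθ : θ ∈ Icc (0 : ℝ) 1) (z : Euc N → ℝ) (x : Euc N) :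
    |signedWeight t θ z x| ≤ levelWeight t θ |z x| := by
  rw [signedWeight, abs_mul, abs_of_nonneg (levelWeight_nonneg hθ _)]
  refine mul_le_of_le_one_right (levelWeight_nonneg hθ _) ?_
  rcases lt_trichotomy (z x) 0 with h | h | h <;> simp [h]

lemma signedWeight_of_abs_lt {t θ : ℝ} {z : Euc N → ℝ} {x : Euc N} (h : |z x| < t) :
    signedWeight t θ z x = 0 := by
  rw [signedWeight, levelWeight_of_gt h, zero_mul]

lemma measurable_signedWeight {t θ : ℝ} {z : Euc N → ℝ} (hz : Measurable z) :
    Measurable (signedWeight t θ z) := by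
  have h : Measurable fun s : ℝ => ((SignType.sign s : SignType) : ℝ) := by
    have : (fun s : ℝ => ((SignType.sign s : SignType) : ℝ)) =
        fun s => if 0 < s then 1 else if s < 0 then -1 else 0 := by
      funext s
      rcases lt_trichotomy s 0 with h | h | h <;> simp [h, h.not_gt]
    rw [this]
    exact Measurable.ite measurableSet_Ioi measurable_const
      (Measurable.ite measurableSet_Iio measurable_const measurable_const)
  exact (measurable_levelWeight.comp hz.abs).mul (h.comp hz)

theorem not_max_penDiff [NeZero N] {α : ℝ} (hα : α ∈ Ioo (0 : ℝ) 2) {Ω : Set (Euc N)}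
    (hΩo : IsOpen Ω) (hΩb : Bornology.IsBounded Ω) {f : Euc N → ℝ} (hfc : ContinuousOn f Ω)
    (hfb : ∃ M : ℝ, ∀ x ∈ Ω, |f x| ≤ M) {w v : Euc N → ℝ → ℝ} (hw : IsExtSol α Ω f w)
    (hv : IsExtSol α (symmBall Ω) (schwarz Ω f) v) {ε ε' : ℝ} (hε : 0 < ε) (hε' : 0 < ε')
    {r₀ y₀ Y : ℝ} (hr0 : 0 ≤ r₀) (hrR : r₀ < ballRad Ω) (hy0 : 0 ≤ y₀) (hyY : y₀ < Y)
    {t θ : ℝ} (ht : 0 < t) (hθ : θ ∈ Icc (0 : ℝ) 1)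
    (hm : ∫ x, levelWeight t θ |zext Ω w x y₀| = omegaN N * r₀ ^ N)
    (hmax : ∀ r ∈ Icc 0 (ballRad Ω), ∀ y ∈ Icc 0 Y,
      penDiff α ε ε' (zext Ω w) (zext (symmBall Ω) v) r y ≤
        penDiff α ε ε' (zext Ω w) (zext (symmBall Ω) v) r₀ y₀) : False := by
  have hBo : IsOpen (symmBall Ω) := Metric.isOpen_ball
  have hBb : Bornology.IsBounded (symmBall Ω) := Metric.isBounded_ball
  obtain ⟨R', hR'⟩ := hΩb.subset_closedBall 0
  set z : Euc N → ℝ := fun x => zext Ω w x y₀ with hz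
  have hzc : Continuous z := hw.continuous_zext_slice y₀
  have hzi : Integrable z := hw.integrable_zext hΩb y₀
  have hzs : ∀ x, R' < ‖x‖ → |z x| = 0 := by
    intro x hx
    rw [hz, abs_eq_zero]
    exact zext_of_notMem (fun h => absurd (mem_closedBall_zero_iff.1 (hR' h)) (not_le.2 hx)) _
  set g : Euc N → ℝ := fun x => levelWeight t θ |z x| with hg
  set γ : Euc N → ℝ := signedWeight t θ z with hγdef
  set s₀ := omegaN N * r₀ ^ N with hs₀
  have hs₀0 : 0 ≤ s₀ := mul_nonneg omegaN_pos.le (pow_nonneg hr0 _)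
  have hgi : Integrable g := integrable_levelWeight_comp ht hθ hzc.abs.measurable hzs
  have hg0 : ∀ x, 0 ≤ g x := fun x => levelWeight_nonneg hθ _
  have hg1 : ∀ x, g x ≤ 1 := fun x => levelWeight_le_one hθ _
  have hγg : ∀ x, |γ x| ≤ g x := abs_signedWeight_le hθ z
  have hγ1 : ∀ x, |γ x| ≤ 1 := fun x => (hγg x).trans (hg1 x)
  have hγi : Integrable γ := hgi.mono' (measurable_signedWeight hzc.measurable).aestronglyMeasurable
    (Eventually.of_forall hγg)
  set K : Set (Euc N) := {x | t ≤ |z x|} with hK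
  have hKΩ : K ⊆ Ω := by
    intro x hx
    by_contra hcon
    have h1 : t ≤ |z x| := hx
    have h2 : z x = 0 := zext_of_notMem hcon _
    rw [h2, abs_zero] at h1
    exact absurd ht (not_lt.2 h1)
  have hKc : IsCompact K := Metric.isCompact_of_isClosed_isBounded
    (isClosed_le continuous_const hzc.abs) (hΩb.subset hKΩ)
  have hγK : ∀ x ∉ K, γ x = 0 := fun x hx => signedWeight_of_abs_lt (not_le.1 hx)
  have hγΩ : ∀ x ∉ Ω, γ x = 0 := fun x hx => hγK x fun h => hx (hKΩ h)
  -- the comparison weight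
  set β : Euc N → ℝ := ballInd r₀ with hβ
  have hβi : Integrable β := integrable_ballInd r₀
  have hβ1 : ∀ x, |β x| ≤ 1 := fun x => by
    rw [abs_of_nonneg (ballInd_nonneg _ _)]; exact ballInd_le_one _ _
  have hβK : ∀ x ∉ Metric.closedBall (0 : Euc N) r₀, β x = 0 := fun x hx =>
    ballInd_of_le (by rw [mem_closedBall_zero_iff, not_le] at hx; exact hx.le)
  have hKB : Metric.closedBall (0 : Euc N) r₀ ⊆ symmBall Ω := Metric.closedBall_subset_ball hrR
  have hβB : ∀ x ∉ symmBall Ω, β x = 0 := fun x hx => hβK x fun h => hx (hKB h)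
  set A : ℝ → ℝ := fun y => (∫ x, γ x * zext Ω w x y) - ∫ x, β x * zext (symmBall Ω) v x y with hA
  have hAc : Continuous A :=
    (hw.continuous_integral_zext hγi).sub (hv.continuous_integral_zext hβi)
  have hA1 : ∀ y, 0 < y → HasDerivAt A (derivInt γ w y - derivInt β v y) y := fun y hy =>
    (hw.hasDerivAt_integral_zext hΩo hγi hγΩ hy).sub (hv.hasDerivAt_integral_zext hBo hβi hβB hy)
  have hA2 : ∀ y, 0 < y → HasDerivAt (fun y => derivInt γ w y - derivInt β v y)
      (derivTwoInt γ w y - derivTwoInt β v y) y := fun y hy =>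
    (hw.hasDerivAt_derivInt hΩo hγi hγΩ hy).sub (hv.hasDerivAt_derivInt hBo hβi hβB hy)
  have hweight : ∀ φ : Euc N → ℝ, Integrable φ → ∫ x, γ x * φ x ≤ conc φ s₀ := by
    intro φ hφ
    refine le_trans (integral_mono (hφ.bdd_mul hγi.1 (Eventually.of_forall hγ1))
      (integrable_weight_mul hφ hgi hg0 hg1) fun x => ?_) (le_conc hφ hgi hg0 hg1 hm.le)
    calc γ x * φ x ≤ |γ x * φ x| := le_abs_self _
      _ = |γ x| * |φ x| := abs_mul _ _
      _ ≤ g x * |φ x| := mul_le_mul_of_nonneg_right (hγg x) (abs_nonneg _)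
  have hconc0 : conc z s₀ = ∫ x, γ x * z x := by
    refine le_antisymm ?_ (hweight z hzi)
    refine (conc_le_of_level hzi hgi ht.le (fun x hx => levelWeight_of_lt hx)
      (fun x hx => levelWeight_of_gt hx) hm hs₀0).trans (le_of_eq ?_)
    exact integral_congr_ae (Eventually.of_forall fun x => (signedWeight_mul_self t θ z x).symm)
  have hAmax : ∀ y ∈ Icc 0 Y, A y + ε * (y ^ α + y ^ 2) ≤ A y₀ + ε * (y₀ ^ α + y₀ ^ 2) := by
    intro y hy
    have h1 := hmax r₀ ⟨hr0, hrR.le⟩ y hy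
    have h2 := hweight _ (hw.integrable_zext hΩb y)
    simp only [penDiff, setIntegral_ball_eq] at h1
    change _ - _ + _ - _ ≤ conc z s₀ - _ + _ - _ at h1
    rw [hconc0] at h1
    simp only [hA]
    linarith
  rcases hy0.eq_or_lt with h | hy0pos
  · -- maximum on the bottom of the cylinder
    have hlim := (hw.tendsto_rpow_mul_derivInt hΩo hα hγi hγΩ).sub
      (hv.tendsto_rpow_mul_derivInt hBo hα hβi hβB)
    simp only [← mul_sub] at hlim
    obtain ⟨M, hM⟩ := hfb
    have hM' : ∀ x ∈ Ω, |f x| ≤ max M 0 := fun x hx => (hM x hx).trans (le_max_left _ _)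
    have hfi : Integrable (Ω.indicator f) := by
      rw [integrable_indicator_iff hΩo.measurableSet]
      exact (integrableOn_const hΩb.measure_lt_top.ne : IntegrableOn (fun _ => M) Ω).mono'
        (hfc.aestronglyMeasurable hΩo.measurableSet)
        ((ae_restrict_iff' hΩo.measurableSet).2 (Eventually.of_forall hM))
    have h1 : ∫ x, γ x * f x ≤ ∫ x, β x * schwarz Ω f x := by
      have e1 : ∫ x, γ x * f x = ∫ x, γ x * Ω.indicator f x := by
        refine integral_congr_ae (Eventually.of_forall fun x => ?_)
        dsimp only
        by_cases hx : x ∈ Ω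
        · rw [indicator_of_mem hx]
        · rw [hγΩ x hx, zero_mul, zero_mul]
      rw [e1]
      refine (hweight _ hfi).trans (le_of_eq ?_)
      rw [← integral_rearr_eq_conc hM' (le_max_right _ _) hfi hs₀0, hs₀,
        ← integral_ball_schwarz hM' hr0, setIntegral_ball_eq]
    have hc : 0 ≤ -kappa α * (∫ x, γ x * f x) - -kappa α * ∫ x, β x * schwarz Ω f x := by
      have := mul_le_mul_of_nonneg_left h1 (kappa_pos hα).le
      linarith
    rw [← mul_sub] at hc
    obtain ⟨y, hy, hlt⟩ := exists_barrier_gt hα hε hAc hA1 hc hlim (h ▸ hyY)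
    have h2 := hAmax y ⟨hy.1.le, hy.2.le⟩
    rw [← h] at h2
    simp only [Real.zero_rpow hα.1.ne', ne_eq, OfNat.ofNat_ne_zero, not_false_eq_true, zero_pow,
      add_zero, mul_zero] at h2
    exact absurd hlt (not_lt.2 h2)
  · -- maximum inside the cylinder
    have hlap : ∫ x, γ x * lap z x ≤ ∫ x, β x * lap (fun x => zext (symmBall Ω) v x y₀) x := by
      refine integral_mul_lap_le hΩo hKc hKΩ (hw.contDiffOn_zext hy0pos) hzi hγi hγ1 hγK
        hBo (isCompact_closedBall 0 r₀) hKB (hv.contDiffOn_zext hy0pos) (hv.integrable_zext hBb y₀)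
        hβi hβ1 hβK (sub_pos.2 hrR) fun δ hδ hδR => ?_
      have hsp := integral_levelWeight_ballInt_sub_le (h := fun x => |z x|)
        (V := fun x => zext (symmBall Ω) v x y₀) hzc.abs (fun x => abs_nonneg _) hzs ht hθ hr0
        hδ.le (by linarith : r₀ + δ ≤ ballRad Ω) hε'.le hm (hv.integrable_zext hBb y₀)
        (fun ρ hρ => by
          have h1 := hmax ρ hρ y₀ ⟨hy0, hyY.le⟩
          simp only [penDiff] at h1
          change conc z _ - _ + _ - _ ≤ conc z s₀ - _ + _ - _ at h1
          rw [conc_abs]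
          have h2 : conc z s₀ = ∫ x, levelWeight t θ |z x| * |z x| := by
            rw [hconc0]
            exact integral_congr_ae (Eventually.of_forall fun x => signedWeight_mul_self t θ z x)
          rw [← h2]
          linarith)
      have h3 : ∫ x, γ x * ballInt δ z x ≤
          ∫ x, levelWeight t θ |z x| * ballInt δ (fun x => |z x|) x := by
        refine integral_mono ((integrable_ballInt hδ.le hzi).bdd_mul hγi.1
          (Eventually.of_forall hγ1)) ((integrable_ballInt hδ.le hzi.abs).bdd_mul hgi.1 (c := 1)
          (Eventually.of_forall fun x => by
            rw [Real.norm_of_nonneg (hg0 x)]; exact hg1 x)) fun x => ?_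
        calc γ x * ballInt δ z x ≤ |γ x * ballInt δ z x| := le_abs_self _
          _ = |γ x| * |ballInt δ z x| := abs_mul _ _
          _ ≤ g x * ballInt δ (fun x => |z x|) x :=
            mul_le_mul (hγg x) (abs_ballInt_le _ _ x) (abs_nonneg _) (hg0 x)
      have h4 : ∫ x, γ x * z x = ∫ x, levelWeight t θ |z x| * |z x| :=
        integral_congr_ae (Eventually.of_forall fun x => signedWeight_mul_self t θ z x)
      rw [setIntegral_ball_eq, setIntegral_ball_eq] at hsp
      rw [h4]
      rw [mul_sub] at hsp
      linarith
    have hp1 := hw.integrated_pde hΩo hγi hγΩ hy0pos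
    have hp2 := hv.integrated_pde hBo hβi hβB hy0pos
    refine not_isLocalMax_add_barrier hα.2 hε hA1 hA2 hy0pos ?_ ?_
    · rw [mul_sub]
      linarith
    · filter_upwards [Ioo_mem_nhds hy0pos hyY] with y hy using hAmax y ⟨hy.1.le, hy.2.le⟩

end Exclusion

/-! ### Choice of a level at a maximum of the penalized difference -/

section LevelChoice

variable {N : ℕ} {h : Euc N → ℝ} {R M s₀ t ε : ℝ}

lemma levelWeight_eq_add (t θ s : ℝ) :
    levelWeight t θ s = (1 - θ) * levelWeight t 0 s + θ * levelWeight t 1 s := by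
  unfold levelWeight; split_ifs <;> ring

lemma integral_levelWeight_zero (hc : Continuous h) (t : ℝ) :
    ∫ x, levelWeight t 0 (h x) = volume.real {x | t < h x} := by
  rw [← integral_indicator_one (measurableSet_lt measurable_const hc.measurable)]
  refine integral_congr_ae (Eventually.of_forall fun x => ?_)
  by_cases hx : t < h x
  · simp [levelWeight, hx]
  · simp [levelWeight, hx]

lemma exists_weight_integral_levelWeight_eq (hc : Continuous h) (hs : ∀ x, R < ‖x‖ → h x = 0)
    (ht : 0 < t) (hlo : ∫ x, levelWeight t 0 (h x) ≤ s₀)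
    (hhi : s₀ ≤ ∫ x, levelWeight t 1 (h x)) :
    ∃ θ ∈ Icc (0 : ℝ) 1, ∫ x, levelWeight t θ (h x) = s₀ := by
  have h0 := integrable_levelWeight_comp ht (left_mem_Icc.2 zero_le_one) hc.measurable hs
  have h1 := integrable_levelWeight_comp ht (right_mem_Icc.2 zero_le_one) hc.measurable hs
  have heq : ∀ θ, ∫ x, levelWeight t θ (h x) =
      (1 - θ) * (∫ x, levelWeight t 0 (h x)) + θ * ∫ x, levelWeight t 1 (h x) := by
    intro θ
    have h0' : Integrable fun x => (1 - θ) * levelWeight t 0 (h x) := h0.const_mul _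
    have h1' : Integrable fun x => θ * levelWeight t 1 (h x) := h1.const_mul _
    rw [← integral_const_mul, ← integral_const_mul, ← integral_add h0' h1']
    exact integral_congr_ae (Eventually.of_forall fun x => levelWeight_eq_add t θ (h x))
  have hivt := intermediate_value_Icc (zero_le_one' ℝ)
    (f := fun θ => (1 - θ) * (∫ x, levelWeight t 0 (h x)) + θ * ∫ x, levelWeight t 1 (h x))
    (by fun_prop)
  obtain ⟨θ, hθ, hθs⟩ := hivt (show s₀ ∈ _ by simpa using ⟨hlo, hhi⟩)
  exact ⟨θ, hθ, (heq θ).trans hθs⟩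

lemma le_integral_levelWeight_one (hc : Continuous h) (hs : ∀ x, R < ‖x‖ → h x = 0) (ht : 0 < t)
    (hlt : ∀ τ, 0 < τ → τ < t → s₀ ≤ ∫ x, levelWeight τ 0 (h x)) :
    s₀ ≤ ∫ x, levelWeight t 1 (h x) := by
  set τ : ℕ → ℝ := fun n => t - t / (n + 2) with hτ
  have hτ0 : ∀ n, t / 2 ≤ τ n := by
    intro n
    have : t / (n + 2) ≤ t / 2 := by gcongr; linarith [n.cast_nonneg (α := ℝ)]
    simp only [hτ]; linarith
  have hτ1 : ∀ n, τ n < t := by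
    intro n
    have : 0 < t / ((n : ℝ) + 2) := by positivity
    simp only [hτ]; linarith
  have hτl : Tendsto τ atTop (nhds t) := by
    have h1 : Tendsto (fun n : ℕ => t / ((n : ℝ) + 2)) atTop (nhds 0) :=
      tendsto_const_nhds.div_atTop
        (tendsto_atTop_add_const_right _ _ tendsto_natCast_atTop_atTop)
    simpa using tendsto_const_nhds.sub h1
  have hlim : Tendsto (fun n => ∫ x, levelWeight (τ n) 0 (h x)) atTop
      (nhds (∫ x, levelWeight t 1 (h x))) := by
    have hz : (0 : ℝ) ∈ Icc (0 : ℝ) 1 := left_mem_Icc.2 zero_le_one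
    refine tendsto_integral_of_dominated_convergence _
      (fun n => (measurable_levelWeight.comp hc.measurable).aestronglyMeasurable)
      (integrable_indicator_closedBall R) (fun n => Eventually.of_forall fun x => ?_)
      (Eventually.of_forall fun x => ?_)
    · rw [Real.norm_of_nonneg (levelWeight_nonneg hz _)]
      exact le_indicator_closedBall (levelWeight_le_one hz)
        (levelWeight_of_gt (lt_of_lt_of_le (by linarith) (hτ0 n))) hs x
    · refine tendsto_const_nhds.congr' ?_
      rcases lt_or_ge (h x) t with hx | hx
      · filter_upwards [hτl.eventually_const_lt hx] with n hn
        rw [levelWeight_of_gt hx, levelWeight_of_gt hn]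
      · refine Eventually.of_forall fun n => ?_
        dsimp only
        rw [levelWeight_of_lt ((hτ1 n).trans_le hx)]
        rcases hx.eq_or_lt with rfl | hx
        · exact levelWeight_self
        · exact levelWeight_of_lt hx
  exact ge_of_tendsto' hlim fun n => hlt _ (lt_of_lt_of_le (by linarith) (hτ0 n)) (hτ1 n)

lemma exists_level (hc : Continuous h) (h0 : ∀ x, 0 ≤ h x) (hs : ∀ x, R < ‖x‖ → h x = 0)
    (hM : ∀ x, |h x| ≤ M) (hs₀ : 0 ≤ s₀) (hε : 0 < ε)
    (hmax : ∀ s ∈ Icc 0 s₀, conc h s + ε * (s₀ - s) ≤ conc h s₀) :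
    ∃ t, 0 < t ∧ ∃ θ ∈ Icc (0 : ℝ) 1, ∫ x, levelWeight t θ (h x) = s₀ := by
  have hhi : Integrable h := hc.integrable_of_hasCompactSupport (hasCompactSupport_of_norm hs)
  have hz : (0 : ℝ) ∈ Icc (0 : ℝ) 1 := left_mem_Icc.2 zero_le_one
  have ho : (1 : ℝ) ∈ Icc (0 : ℝ) 1 := right_mem_Icc.2 zero_le_one
  have hiff : ∀ τ, 0 < τ → (τ < rearr univ h s₀ ↔ s₀ < ∫ x, levelWeight τ 0 (h x)) := by
    intro τ hτ
    have hset : {x | x ∈ (univ : Set (Euc N)) ∧ τ < |h x|} = {x | τ < h x} := by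
      ext x; simp [abs_of_nonneg (h0 x)]
    have hfin : volume {x | τ < h x} ≠ ⊤ := by
      refine (measure_mono_top ?_).mt (measure_closedBall_lt_top (x := (0 : Euc N)) (r := R)).ne
      intro x hx
      by_contra hcon
      rw [mem_closedBall_zero_iff, not_le] at hcon
      have hx' : τ < h x := hx
      rw [hs x hcon] at hx'
      linarith
    rw [lt_rearr_iff (M := M) (fun x _ => hM x) hτ.le, hset, integral_levelWeight_zero hc,
      Measure.real, ENNReal.ofReal_lt_iff_lt_toReal hs₀ hfin]
  rcases (rearr_nonneg (E := univ) (g := h) s₀).eq_or_lt with hr | hr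
  · have ht : 0 < ε / 2 := by positivity
    refine ⟨ε / 2, ht, exists_weight_integral_levelWeight_eq hc hs ht ?_ ?_⟩
    · exact not_lt.1 fun hcon => absurd ((hiff _ ht).2 hcon) (by rw [← hr]; exact ht.le.not_gt)
    · by_contra! hcon
      set s₁ := ∫ x, levelWeight (ε / 2) 1 (h x) with hs₁
      have hs₁0 : 0 ≤ s₁ := integral_nonneg fun x => levelWeight_nonneg ho _
      have hgi := integrable_levelWeight_comp ht ho hc.measurable hs
      have h1 := hmax s₁ ⟨hs₁0, hcon.le⟩
      have h2 : conc h s₀ ≤ ε / 2 * s₀ + ∫ x, max (|h x| - ε / 2) 0 := conc_le hs₀ ht.le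
      have h3 : ∫ x, levelWeight (ε / 2) 1 (h x) * |h x| ≤ conc h s₁ :=
        le_conc hhi hgi (fun x => levelWeight_nonneg ho _) (fun x => levelWeight_le_one ho _) le_rfl
      have h4 : ∫ x, levelWeight (ε / 2) 1 (h x) * |h x| =
          ε / 2 * s₁ + ∫ x, max (|h x| - ε / 2) 0 := by
        rw [hs₁, ← integral_const_mul,
          ← integral_add (hgi.const_mul _) (integrable_excess hhi ht.le)]
        refine integral_congr_ae (Eventually.of_forall fun x => ?_)
        dsimp only
        rw [abs_of_nonneg (h0 x)]
        rcases lt_trichotomy (h x) (ε / 2) with hx | hx | hx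
        · rw [levelWeight_of_gt hx, max_eq_right (by linarith)]; ring
        · rw [hx, levelWeight_self, sub_self, max_self]; ring
        · rw [levelWeight_of_lt hx, max_eq_left (by linarith)]; ring
      nlinarith [mul_pos hε (sub_pos.2 hcon)]
  · refine ⟨_, hr, exists_weight_integral_levelWeight_eq hc hs hr ?_ ?_⟩
    · exact not_lt.1 fun hcon => absurd ((hiff _ hr).2 hcon) (lt_irrefl _)
    · exact le_integral_levelWeight_one hc hs hr fun τ hτ hτr => ((hiff τ hτ).1 hτr).le

lemma integral_levelWeight_lt_measure [NeZero N] {Ω : Set (Euc N)} (hΩo : IsOpen Ω)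
    (hΩb : Bornology.IsBounded Ω) (hne : Ω.Nonempty) (hc : Continuous h)
    (hΩ : ∀ x ∉ Ω, h x = 0) (ht : 0 < t) {θ : ℝ} (hθ : θ ∈ Icc (0 : ℝ) 1) :
    ∫ x, levelWeight t θ (h x) < volume.real Ω := by
  have hΩf : volume Ω ≠ ⊤ := hΩb.measure_lt_top.ne
  set K : Set (Euc N) := {x | t ≤ h x} with hK
  have hKcl : IsClosed K := isClosed_le continuous_const hc
  have hKΩ : K ⊆ Ω := by
    intro x hx
    by_contra hcon
    have h1 : t ≤ h x := hx
    rw [hΩ x hcon] at h1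
    exact absurd ht (not_lt.2 h1)
  have hle : ∫ x, levelWeight t θ (h x) ≤ volume.real K := by
    rw [← integral_indicator_one hKcl.measurableSet]
    refine integral_mono_of_nonneg (Eventually.of_forall fun x => levelWeight_nonneg hθ _)
      ((integrable_indicator_iff hKcl.measurableSet).2
        (integrableOn_const (measure_ne_top_of_subset hKΩ hΩf))) (Eventually.of_forall fun x => ?_)
    dsimp only
    by_cases hx : x ∈ K
    · rw [indicator_of_mem hx]; exact levelWeight_le_one hθ _
    · rw [indicator_of_notMem hx, levelWeight_of_gt (not_le.1 hx)]
  refine hle.trans_lt ?_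
  have hpos : 0 < volume (Ω \ K) := by
    refine (hΩo.sdiff hKcl).measure_pos volume ?_
    by_contra hcon
    rw [not_nonempty_iff_eq_empty, sdiff_eq_empty] at hcon
    have hclopen : IsClopen Ω := ⟨hcon.antisymm hKΩ ▸ hKcl, hΩo⟩
    rcases isClopen_iff.1 hclopen with h | h
    · exact hne.ne_empty h
    · rw [h] at hΩb
      exact NormedSpace.unbounded_univ ℝ (Euc N) hΩb
  have hsd := measureReal_sdiff hKΩ hKcl.measurableSet hΩf
    (μ := volume)
  have hpos' : 0 < volume.real (Ω \ K) :=
    ENNReal.toReal_pos hpos.ne' (measure_ne_top_of_subset sdiff_subset hΩf)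
  linarith

end LevelChoice

/-! ### Existence of maxima of the penalized difference -/

section Semicontinuity

variable {N : ℕ} {α : ℝ} {Ω : Set (Euc N)} {f : Euc N → ℝ} {w v : Euc N → ℝ → ℝ}

lemma IsExtSol.exists_zext_le_indicator (hw : IsExtSol α Ω f w) (hΩb : Bornology.IsBounded Ω) :
    ∃ M R, ∀ x y, |zext Ω w x y| ≤ M * (Metric.closedBall (0 : Euc N) R).indicator 1 x := by
  obtain ⟨M, hM0, hM⟩ := hw.exists_zext_bound
  obtain ⟨R, hR⟩ := hΩb.subset_closedBall 0
  refine ⟨M, R, fun x y => ?_⟩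
  by_cases hx : x ∈ Ω
  · rw [indicator_of_mem (hR hx)]; simpa using hM x y
  · rw [zext_of_notMem hx, abs_zero]
    exact mul_nonneg hM0 (indicator_nonneg (fun _ _ => zero_le_one) _)

lemma IsExtSol.continuous_integral_excess (hw : IsExtSol α Ω f w) (hΩb : Bornology.IsBounded Ω)
    {t : ℝ} (ht : 0 ≤ t) : Continuous fun y => ∫ x, max (|zext Ω w x y| - t) 0 := by
  obtain ⟨M, R, hM⟩ := hw.exists_zext_le_indicator hΩb
  refine continuous_of_dominated (fun y => ?_) (fun y => ?_)
    ((integrable_indicator_closedBall R).const_mul M) ?_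
  · exact (((hw.continuous_zext_slice y).abs.sub continuous_const).max
      continuous_const).aestronglyMeasurable
  · refine Eventually.of_forall fun x => (?_ : _ ≤ |zext Ω w x y|).trans (hM x y)
    rw [Real.norm_of_nonneg (le_max_right _ _)]
    exact max_le (by linarith) (abs_nonneg _)
  · exact Eventually.of_forall fun x => ((hw.continuous_zext.comp
      (by fun_prop : Continuous fun y : ℝ => (x, y))).abs.sub continuous_const).max continuous_const

lemma continuousAt_ballInd {r : ℝ} {x : Euc N} (h : ‖x‖ ≠ r) :
    ContinuousAt (fun ρ => ballInd ρ x) r := by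
  rcases h.lt_or_gt with h | h
  · refine continuousAt_const.congr (f := fun _ => (1 : ℝ)) ?_
    filter_upwards [Ioi_mem_nhds h] with ρ hρ using (ballInd_of_lt hρ).symm
  · refine continuousAt_const.congr (f := fun _ => (0 : ℝ)) ?_
    filter_upwards [Iio_mem_nhds h] with ρ hρ using (ballInd_of_le (le_of_lt hρ)).symm

lemma IsExtSol.continuous_setIntegral_ball [NeZero N] (hw : IsExtSol α Ω f w)
    (hΩb : Bornology.IsBounded Ω) :
    Continuous fun p : ℝ × ℝ => ∫ x in Metric.ball (0 : Euc N) p.1, zext Ω w x p.2 := by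
  obtain ⟨M, R, hM⟩ := hw.exists_zext_le_indicator hΩb
  simp only [setIntegral_ball_eq]
  refine continuous_iff_continuousAt.2 fun p => ?_
  refine continuousAt_of_dominated (Eventually.of_forall fun q => ?_)
    (Eventually.of_forall fun q => ?_) ((integrable_indicator_closedBall R).const_mul M) ?_
  · exact (integrable_ballInd q.1).1.mul (hw.continuous_zext_slice q.2).aestronglyMeasurable
  · refine Eventually.of_forall fun x => (?_ : _ ≤ |zext Ω w x q.2|).trans (hM x q.2)
    rw [norm_mul, Real.norm_of_nonneg (ballInd_nonneg _ _)]
    exact mul_le_of_le_one_left (abs_nonneg _) (ballInd_le_one _ _)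
  · have hnull : volume (Metric.sphere (0 : Euc N) p.1) = 0 := Measure.addHaar_sphere _ _ _
    filter_upwards [compl_mem_ae_iff.2 hnull] with x hx
    have hx' : ‖x‖ ≠ p.1 := fun h => hx (mem_sphere_zero_iff_norm.2 h)
    have h1 : ContinuousAt (fun q : ℝ × ℝ => ballInd q.1 x) p :=
      ContinuousAt.comp (f := fun q : ℝ × ℝ => q.1) (continuousAt_ballInd hx') continuousAt_fst
    exact h1.mul (hw.continuous_zext.comp
      (by fun_prop : Continuous fun q : ℝ × ℝ => (x, q.2))).continuousAt

lemma exists_isMaxOn_penDiff [NeZero N] {Ω' : Set (Euc N)} {f' : Euc N → ℝ} (hα : 0 < α)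
    (hw : IsExtSol α Ω f w) (hΩb : Bornology.IsBounded Ω)
    (hv : IsExtSol α Ω' f' v) (hΩb' : Bornology.IsBounded Ω') (ε ε' : ℝ) {R Y : ℝ} (hR : 0 ≤ R)
    (hY : 0 ≤ Y) : ∃ r₀ ∈ Icc 0 R, ∃ y₀ ∈ Icc 0 Y, ∀ r ∈ Icc 0 R, ∀ y ∈ Icc 0 Y,
      penDiff α ε ε' (zext Ω w) (zext Ω' v) r y ≤
        penDiff α ε ε' (zext Ω w) (zext Ω' v) r₀ y₀ := by
  have h1 : UpperSemicontinuousOn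
      (fun p : ℝ × ℝ => conc (fun x => zext Ω w x p.2) (omegaN N * p.1 ^ N))
      (Icc 0 R ×ˢ Icc 0 Y) := by
    refine upperSemicontinuousOn_ciInf (fun p hp => conc_bddBelow _
      (mul_nonneg omegaN_pos.le (pow_nonneg hp.1.1 _))) fun t => ?_
    have h4 : Continuous fun p : ℝ × ℝ => (t : ℝ) * (omegaN N * p.1 ^ N) := by fun_prop
    have h5 : Continuous fun p : ℝ × ℝ => ∫ x, max (|zext Ω w x p.2| - t) 0 :=
      (hw.continuous_integral_excess hΩb t.coe_nonneg).comp continuous_snd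
    exact (h4.add h5).upperSemicontinuous.upperSemicontinuousOn _
  have h2 : Continuous fun p : ℝ × ℝ =>
      -(∫ x in Metric.ball (0 : Euc N) p.1, zext Ω' v x p.2) + ε * (p.2 ^ α + p.2 ^ 2) -
        ε' * (omegaN N * p.1 ^ N) := by
    have h3 : Continuous fun p : ℝ × ℝ => p.2 ^ α :=
      (Real.continuous_rpow_const hα.le).comp continuous_snd
    have h4 := hv.continuous_setIntegral_ball hΩb'
    fun_prop
  have h3 : UpperSemicontinuousOn
      (fun p : ℝ × ℝ => penDiff α ε ε' (zext Ω w) (zext Ω' v) p.1 p.2) (Icc 0 R ×ˢ Icc 0 Y) := by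
    have h4 := h1.add (h2.upperSemicontinuous.upperSemicontinuousOn _)
    have h5 : (fun p : ℝ × ℝ => penDiff α ε ε' (zext Ω w) (zext Ω' v) p.1 p.2) = fun p =>
        conc (fun x => zext Ω w x p.2) (omegaN N * p.1 ^ N) +
          (-(∫ x in Metric.ball (0 : Euc N) p.1, zext Ω' v x p.2) + ε * (p.2 ^ α + p.2 ^ 2) -
            ε' * (omegaN N * p.1 ^ N)) := by
      funext p
      simp only [penDiff]
      ring
    rw [h5]
    exact h4
  have hne : (Icc 0 R ×ˢ Icc 0 Y).Nonempty :=
    (nonempty_Icc.2 hR).prod (nonempty_Icc.2 hY)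
  obtain ⟨p, hp, hmax⟩ := h3.exists_isMaxOn hne (isCompact_Icc.prod isCompact_Icc)
  exact ⟨p.1, hp.1, p.2, hp.2, fun r hr y hy => isMaxOn_iff.1 hmax (r, y) (mk_mem_prod hr hy)⟩

lemma zext_symmBall_nonneg [NeZero N] {Ω' : Set (Euc N)} {f' : Euc N → ℝ}
    (hv : IsExtSol α (symmBall Ω') f' v) (hvrad : RadialDecr v) (x : Euc N) (y : ℝ) :
    0 ≤ zext (symmBall Ω') v x y := by
  by_cases hx : x ∈ symmBall Ω'
  · rw [zext, indicator_of_mem hx]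
    have hx' : ‖x‖ < ballRad Ω' := mem_ball_zero_iff.1 hx
    have hR : 0 < ballRad Ω' := (norm_nonneg x).trans_lt hx'
    obtain ⟨e, he⟩ := exists_norm_eq (Euc N) hR.le
    have hfr : e ∈ frontier (symmBall Ω') := by
      rw [symmBall, frontier_ball _ hR.ne']
      exact mem_sphere_zero_iff_norm.2 he
    have h1 := hvrad _ (le_max_right y 0) x e (by rw [he]; exact hx'.le)
    rwa [hv.lateral e hfr _ (mem_Ici.2 (le_max_right _ _))] at h1
  · rw [zext_of_notMem hx]

end Semicontinuity

section Comparison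

variable {N : ℕ} {α : ℝ} {Ω : Set (Euc N)} {f : Euc N → ℝ} {w : Euc N → ℝ → ℝ}

lemma omegaN_mul_ballRad_pow [NeZero N] (Ω : Set (Euc N)) :
    omegaN N * ballRad Ω ^ N = (volume Ω).toReal := omegaN_mul_rpow ENNReal.toReal_nonneg

lemma IsExtSol.integral_rearr_trace (hw : IsExtSol α Ω f w) (hΩb : Bornology.IsBounded Ω)
    {s : ℝ} (hs : 0 ≤ s) :
    ∫ σ in (0 : ℝ)..s, rearr Ω (fun x => w x 0) σ = conc (fun x => zext Ω w x 0) s := by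
  obtain ⟨M, hM0, hM⟩ := hw.exists_zext_bound
  have heq : Ω.indicator (fun x => w x 0) = fun x => zext Ω w x 0 := by
    funext x
    simp only [zext, max_self]
  rw [integral_rearr_eq_conc (M := M) (fun x hx => ?_) hM0 ?_ hs, heq]
  · rw [heq]
    exact hw.integrable_zext hΩb 0
  · rw [← zext_of_mem (w := w) hx le_rfl]
    exact hM x 0

lemma IsExtSol.exists_conc_zext_le (hw : IsExtSol α Ω f w) (hΩo : IsOpen Ω)
    (hΩb : Bornology.IsBounded Ω) {m : ℝ} (hm : 0 < m) :
    ∃ Y, 0 < Y ∧ ∀ s, 0 ≤ s → conc (fun x => zext Ω w x Y) s ≤ m := by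
  set δ := m / ((volume Ω).toReal + 1) with hδ
  have hvol : 0 ≤ (volume Ω).toReal := ENNReal.toReal_nonneg
  have hδ0 : 0 < δ := by positivity
  obtain ⟨Y, hY⟩ := hw.decay δ hδ0
  refine ⟨max Y 1, lt_max_of_lt_right one_pos, fun s hs => (conc_le hs le_rfl).trans ?_⟩
  rw [zero_mul, zero_add]
  have h1 : ∫ x, max (|zext Ω w x (max Y 1)| - 0) 0 ≤ ∫ x, Ω.indicator (fun _ => δ) x := by
    refine integral_mono_of_nonneg (Eventually.of_forall fun x => le_max_right _ _)
      ((integrable_indicator_iff hΩo.measurableSet).2 (integrableOn_const hΩb.measure_lt_top.ne))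
      (Eventually.of_forall fun x => ?_)
    dsimp only
    rw [sub_zero, max_eq_left (abs_nonneg _)]
    by_cases hx : x ∈ Ω
    · rw [indicator_of_mem hx, zext_of_mem hx (zero_le_one.trans (le_max_right _ _))]
      exact hY _ (le_max_left _ _) x hx
    · rw [indicator_of_notMem hx, zext_of_notMem hx, abs_zero]
  refine h1.trans ?_
  rw [integral_indicator hΩo.measurableSet, setIntegral_const, smul_eq_mul, Measure.real, hδ,
    mul_div_assoc', div_le_iff₀ (by positivity)]
  nlinarith

/-- The core comparison: concentration functions of traces are dominated by ball integrals of the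
symmetrized solution. -/
theorem conc_zext_le_setIntegral [NeZero N] (hα : α ∈ Ioo (0 : ℝ) 2) (hΩo : IsOpen Ω)
    (hΩb : Bornology.IsBounded Ω) (hne : Ω.Nonempty) (hfc : ContinuousOn f Ω)
    (hfb : ∃ M : ℝ, ∀ x ∈ Ω, |f x| ≤ M) {v : Euc N → ℝ → ℝ} (hw : IsExtSol α Ω f w)
    (hv : IsExtSol α (symmBall Ω) (schwarz Ω f) v) (hvrad : RadialDecr v) {r : ℝ} (hr : 0 ≤ r)
    (hrR : r ≤ ballRad Ω) :
    conc (fun x => zext Ω w x 0) (omegaN N * r ^ N) ≤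
      ∫ x in Metric.ball (0 : Euc N) r, zext (symmBall Ω) v x 0 := by
  by_contra! hlt
  set m := conc (fun x => zext Ω w x 0) (omegaN N * r ^ N) -
    ∫ x in Metric.ball (0 : Euc N) r, zext (symmBall Ω) v x 0 with hmdef
  have hm : 0 < m := sub_pos.2 hlt
  have hω := omegaN_pos (N := N)
  have hBb : Bornology.IsBounded (symmBall Ω) := Metric.isBounded_ball
  have hV := zext_symmBall_nonneg hv hvrad
  have hvol : 0 ≤ (volume Ω).toReal := ENNReal.toReal_nonneg
  have hpow : ∀ {a b : ℝ}, 0 ≤ b → omegaN N * a ^ N ≤ omegaN N * b ^ N → a ≤ b := by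
    intro a b hb hab
    exact le_of_not_gt fun h => absurd hab
      (not_le.2 (mul_lt_mul_of_pos_left (pow_lt_pow_left₀ h hb (NeZero.ne N)) hω))
  have hR : 0 ≤ ballRad Ω := hr.trans hrR
  obtain ⟨Y, hY0, hY⟩ := hw.exists_conc_zext_le hΩo hΩb (m := m / 4) (by positivity)
  have hYα : 0 < Y ^ α + Y ^ 2 := by positivity
  set ε := m / 4 / (Y ^ α + Y ^ 2) with hε
  have hε0 : 0 < ε := by positivity
  set ε' := m / 4 / ((volume Ω).toReal + 1) with hε'
  have hε'0 : 0 < ε' := by positivity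
  obtain ⟨r₀, hr₀, y₀, hy₀, hmax⟩ := exists_isMaxOn_penDiff hα.1 hw hΩb hv hBb ε ε' hR hY0.le
  have hs₀ : 0 ≤ omegaN N * r₀ ^ N := mul_nonneg hω.le (pow_nonneg hr₀.1 _)
  have hlow : 3 * m / 4 ≤ penDiff α ε ε' (zext Ω w) (zext (symmBall Ω) v) r₀ y₀ := by
    refine le_trans ?_ (hmax r ⟨hr, hrR⟩ 0 ⟨le_rfl, hY0.le⟩)
    have h1 : omegaN N * r ^ N ≤ (volume Ω).toReal := by
      rw [← omegaN_mul_ballRad_pow Ω]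
      gcongr
    have h2 : ε' * (omegaN N * r ^ N) ≤ m / 4 := by
      rw [hε', div_mul_eq_mul_div, div_le_iff₀ (by positivity)]
      nlinarith
    simp only [penDiff, Real.zero_rpow hα.1.ne', ne_eq, OfNat.ofNat_ne_zero, not_false_eq_true,
      zero_pow, add_zero, mul_zero]
    rw [← hmdef]
    linarith
  have hyY : y₀ < Y := by
    refine lt_of_le_of_ne hy₀.2 fun h => ?_
    have h1 := hY _ hs₀
    have h2 : 0 ≤ ∫ x in Metric.ball (0 : Euc N) r₀, zext (symmBall Ω) v x Y :=
      integral_nonneg fun x => hV x Y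
    have h3 : ε * (Y ^ α + Y ^ 2) = m / 4 := div_mul_cancel₀ _ hYα.ne'
    have h4 : 0 ≤ ε' * (omegaN N * r₀ ^ N) := mul_nonneg hε'0.le hs₀
    rw [h, penDiff] at hlow
    linarith
  obtain ⟨M, hM0, hM⟩ := hw.exists_zext_bound
  obtain ⟨R', hR'⟩ := hΩb.subset_closedBall 0
  have hc : Continuous fun x => |zext Ω w x y₀| := (hw.continuous_zext_slice y₀).abs
  have hzero : ∀ x ∉ Ω, |zext Ω w x y₀| = 0 := fun x hx => by rw [zext_of_notMem hx, abs_zero]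
  obtain ⟨t, ht, θ, hθ, hlev⟩ := exists_level (R := R') (M := M) (ε := ε')
    (s₀ := omegaN N * r₀ ^ N) hc
    (fun x => abs_nonneg _)
    (fun x hx => hzero x fun h => absurd (mem_closedBall_zero_iff.1 (hR' h)) (not_le.2 hx))
    (fun x => by rw [abs_abs]; exact hM x y₀) hs₀ hε'0 (fun s hs => by
      set ρ := (s / omegaN N) ^ ((N : ℝ)⁻¹) with hρdef
      have hρ : omegaN N * ρ ^ N = s := omegaN_mul_rpow hs.1
      have hρ0 : 0 ≤ ρ := Real.rpow_nonneg (div_nonneg hs.1 hω.le) _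
      have hρr : ρ ≤ r₀ := hpow hr₀.1 (hρ.trans_le hs.2)
      have h1 := hmax ρ ⟨hρ0, hρr.trans hr₀.2⟩ y₀ hy₀
      have h2 : ∫ x in Metric.ball (0 : Euc N) ρ, zext (symmBall Ω) v x y₀ ≤
          ∫ x in Metric.ball (0 : Euc N) r₀, zext (symmBall Ω) v x y₀ :=
        setIntegral_mono_set (hv.integrable_zext hBb y₀).integrableOn
          (Eventually.of_forall fun x => hV x y₀)
          (Metric.ball_subset_ball hρr).eventuallyLE
      simp only [penDiff, hρ] at h1
      rw [conc_abs, conc_abs]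
      linarith)
  have hr₀R : r₀ < ballRad Ω := by
    have h1 := integral_levelWeight_lt_measure hΩo hΩb hne hc hzero ht hθ
    rw [hlev, Measure.real, ← omegaN_mul_ballRad_pow Ω] at h1
    exact lt_of_not_ge fun h => absurd h1 (not_lt.2 (by gcongr))
  exact not_max_penDiff hα hΩo hΩb hfc hfb hw hv hε0 hε'0 hr₀.1 hr₀R hy₀.1 hyY ht hθ hlev hmax

end Comparison

/-- integral comparison between the traces `u = w(·,0)` and `φ = v(·,0)`:
`∫_0^s u*(σ) dσ ≤ ∫_0^s φ*(σ) dσ` for all `s ∈ [0,|Ω|]`. -/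
theorem trace_comparison
    {N : ℕ} (hN : 2 ≤ N) (α : ℝ) (hα : α ∈ Ioo (0 : ℝ) 2) (hαN : α < N)
    (Ω : Set (Euc N)) (hΩo : IsOpen Ω) (hΩb : Bornology.IsBounded Ω)
    (f : Euc N → ℝ) (hfc : ContinuousOn f Ω) (hfb : ∃ M : ℝ, ∀ x ∈ Ω, |f x| ≤ M)
    (w v : Euc N → ℝ → ℝ)
    (hw : IsExtSol α Ω f w)
    (hv : IsExtSol α (symmBall Ω) (schwarz Ω f) v)
    (hvrad : RadialDecr v) :
    ∀ s ∈ Icc (0 : ℝ) (volume Ω).toReal,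
      (∫ σ in (0 : ℝ)..s, rearr Ω (fun x => w x 0) σ) ≤
        ∫ σ in (0 : ℝ)..s, rearr (symmBall Ω) (fun x => v x 0) σ := by
  intro s hs
  have : NeZero N := ⟨by omega⟩
  rcases Ω.eq_empty_or_nonempty with hΩ | hne
  · have hs0 : s = 0 := le_antisymm (by simpa [hΩ] using hs.2) hs.1
    simp [hs0]
  have hBb : Bornology.IsBounded (symmBall Ω) := Metric.isBounded_ball
  rw [hw.integral_rearr_trace hΩb hs.1, hv.integral_rearr_trace hBb hs.1]
  set r := (s / omegaN N) ^ ((N : ℝ)⁻¹) with hr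
  have hrs : omegaN N * r ^ N = s := omegaN_mul_rpow hs.1
  have hr0 : 0 ≤ r := Real.rpow_nonneg (div_nonneg hs.1 omegaN_pos.le) _
  have hrR : r ≤ ballRad Ω :=
    Real.rpow_le_rpow (div_nonneg hs.1 omegaN_pos.le)
      (div_le_div_of_nonneg_right hs.2 omegaN_pos.le) (by positivity)
  have h1 := conc_zext_le_setIntegral hα hΩo hΩb hne hfc hfb hw hv hvrad hr0 hrR
  have h2 := integral_ball_abs_le_conc (hv.integrable_zext hBb 0) hr0
  simp only [abs_of_nonneg (zext_symmBall_nonneg hv hvrad _ _)] at h2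
  rw [← hrs]
  exact h1.trans h2
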